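/- Races to infinity (genericity in finite-dimensional coefficient space): Fix an integer N ≥ 0 and let I_N := {(4πi/√3)(p₁+p₂ω) : p₁,p₂ ∈ ℤ, |p₁| ≤ N, |p₂| ≤ N} ⊂ Λ*. For a = (a_p)_{p∈I_N} ∈ ℂ^{I_N} set U_a(z) := Σ_{p∈I_N} a_p·exp(i⟨p+K,z⟩), and let W_N := {a ∈ ℂ^{I_N} : U_a(ωz) = ω·U_a(z) for all z} (a ℂ-linear subspace). Then the set of a ∈ W_N for which the implication [the chiral model built from U_a has at least one magic parameter ⟹ it has infinitely many non-simple magic parameters] holds is residual in W_N (it contains a countable intersection of open dense subsets of W_N) and contains W_N ∩ (π·ℚ(ω/√3))^{I_N}, where ℚ(ω/√3) is the smallest subfield of ℂ containing ω/√3. -/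

import Mathlib

noncomputable section

open Complex MeasureTheory

namespace TBG

/-- `ω = exp(2πi/3)`. -/
def ω : ℂ := Complex.exp (2 * Real.pi * Complex.I / 3)

/-- The moiré lattice `Λ = ℤω + ℤ ⊂ ℂ`. -/
def Λ : Set ℂ := {z : ℂ | ∃ m n : ℤ, z = m * ω + n}

/-- The dual lattice `Λ* = (4πi/√3)·Λ`. -/
def Λdual : Set ℂ := {p : ℂ | ∃ m n : ℤ, p = 4 * Real.pi * Complex.I / Real.sqrt 3 * (m * ω + n)}

/-- The high symmetry point `K = 4π/3`. -/
def K : ℂ := 4 * Real.pi / 3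

/-- `⟨z,w⟩ = Re (z · conj w)`. -/
def pair (z w : ℂ) : ℝ := (z * (starRingEnd ℂ) w).re

/-- `2 D_z̄ f = (1/i)(∂_x f + i ∂_y f)`. -/
def Dbar (f : ℂ → ℂ) (z : ℂ) : ℂ :=
  1 / Complex.I * (fderiv ℝ f z 1 + Complex.I * fderiv ℝ f z Complex.I)

/-- A tunnelling potential: smooth, with the translational and rotational symmetries. -/
def IsTunnelling (U : ℂ → ℂ) : Prop :=
  ContDiff ℝ (⊤ : ℕ∞) U ∧
    (∀ γ ∈ Λ, ∀ z : ℂ, U (z + γ) = Complex.exp (Complex.I * (pair γ K : ℂ)) * U z) ∧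
    ∀ z : ℂ, U (ω * z) = ω * U z

/-- Membership in `ker_{L²₀}(D(α)+k)` for the chiral model with tunnelling
potentials `U₊ = Up`, `U₋ = Um`: smooth solutions of `(D(α)+k)u = 0` with the
Floquet boundary conditions. -/
def InKer (Up Um : ℂ → ℂ) (α k : ℂ) (u : ℂ → ℂ × ℂ) : Prop :=
  ContDiff ℝ (⊤ : ℕ∞) u ∧
    (∀ z : ℂ, Dbar (fun w => (u w).1) z + k * (u z).1 + α * Up z * (u z).2 = 0) ∧
    (∀ z : ℂ, Dbar (fun w => (u w).2) z + k * (u z).2 + α * Um z * (u z).1 = 0) ∧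
    (∀ γ ∈ Λ, ∀ z : ℂ, (u (z + γ)).1 = Complex.exp (-Complex.I * (pair γ K : ℂ)) * (u z).1) ∧
    (∀ γ ∈ Λ, ∀ z : ℂ, (u (z + γ)).2 = Complex.exp (Complex.I * (pair γ K : ℂ)) * (u z).2)

/-- `Ker(α,k)` as a set of functions. -/
def kerSet (Up Um : ℂ → ℂ) (α k : ℂ) : Set (ℂ → ℂ × ℂ) := {u | InKer Up Um α k u}

/-- `dim_ℂ Ker(α,k)` (the set `Ker(α,k)` is a linear subspace, so the finrank of its span
is its dimension). -/
def kerDim (Up Um : ℂ → ℂ) (α k : ℂ) : ℕ :=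
  Module.finrank ℂ ↥(Submodule.span ℂ (kerSet Up Um α k))

/-- `Ker_p(α) = {u ∈ Ker(α,0) : u(ωz) = ω^(−p)·u(z)}`. -/
def kerPSet (Up Um : ℂ → ℂ) (α : ℂ) (p : ℕ) : Set (ℂ → ℂ × ℂ) :=
  {u | u ∈ kerSet Up Um α 0 ∧ ∀ z : ℂ, u (ω * z) = (ω ^ (-(p : ℤ))) • u z}

/-- `dim_ℂ Ker_p(α)`. -/
def kerPDim (Up Um : ℂ → ℂ) (α : ℂ) (p : ℕ) : ℕ :=
  Module.finrank ℂ ↥(Submodule.span ℂ (kerPSet Up Um α p))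

/-- `α` is magic: the flat band condition `Ker(α,k) ≠ {0}` for every `k`. -/
def IsMagic (Up Um : ℂ → ℂ) (α : ℂ) : Prop :=
  ∀ k : ℂ, ∃ u ∈ kerSet Up Um α k, u ≠ 0


/-- Membership in `π·ℚ(ω/√3)`: `π` times the smallest subfield of `ℂ` containing `ω/√3`. -/
def InPiQomega (c : ℂ) : Prop :=
  ∃ q ∈ Subfield.closure {ω / (Real.sqrt 3 : ℂ)}, c = (Real.pi : ℂ) * q

/-- The finite index set `I_N = {(4πi/√3)(p₁+p₂ω) : |p₁| ≤ N, |p₂| ≤ N}`. -/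
def IN (N : ℕ) : Finset ℂ :=
  ((Finset.Icc (-(N : ℤ)) (N : ℤ)) ×ˢ (Finset.Icc (-(N : ℤ)) (N : ℤ))).image
    (fun q => 4 * Real.pi * Complex.I / Real.sqrt 3 * ((q.1 : ℂ) + (q.2 : ℂ) * ω))

/-- The potential `U_a(z) = Σ_{p∈I_N} a_p·exp(i⟨p+K,z⟩)`. -/
def Ua (N : ℕ) (a : ↥(IN N) → ℂ) (z : ℂ) : ℂ :=
  ∑ p : ↥(IN N), a p * Complex.exp (Complex.I * (pair ((p : ℂ) + K) z : ℂ))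

/-- `W_N`: the subspace of coefficients whose potential is rotationally symmetric. -/
def WN (N : ℕ) : Submodule ℂ (↥(IN N) → ℂ) where
  carrier := {a | ∀ z : ℂ, Ua N a (ω * z) = ω * Ua N a z}
  add_mem' := by
    intro a b ha hb z
    have h1 : ∀ w : ℂ, Ua N (a + b) w = Ua N a w + Ua N b w := by
      intro w
      simp [Ua, add_mul, Finset.sum_add_distrib]
    rw [h1, h1, ha z, hb z]; ring
  zero_mem' := by intro z; simp [Ua]
  smul_mem' := by
    intro c a ha z
    have h1 : ∀ w : ℂ, Ua N (c • a) w = c * Ua N a w := by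
      intro w
      simp [Ua, Finset.mul_sum, mul_assoc]
    rw [h1, h1, ha z]; ring

/-- The good property: if the chiral model built from `U_a` has a magic parameter then
it has infinitely many non-simple magic parameters. -/
def GoodN (N : ℕ) (a : ↥(WN N)) : Prop :=
  (∃ α : ℂ, IsMagic (Ua N a.1) (fun z => Ua N a.1 (-z)) α) →
    {α : ℂ | IsMagic (Ua N a.1) (fun z => Ua N a.1 (-z)) α ∧
      ∀ k : ℂ, 2 ≤ kerDim (Ua N a.1) (fun z => Ua N a.1 (-z)) α k}.Infinite

section

open Polynomial

/-- `a^m · Σ g(β)` over the `β`s is a rational integer whenever the multiset of the `β`s is Galois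
stable and every `a·β` is an algebraic integer. -/
theorem exists_int_eq_pow_mul_sum_aeval {K : Type*} [Field K] [Algebra ℚ K] [FiniteDimensional ℚ K]
    [IsGalois ℚ K] {ι : Type*} (s : Finset ι) (β : ι → K)
    (hσ : ∀ (σ : Gal(K/ℚ)) (h : K → K), ∑ i ∈ s, h (σ (β i)) = ∑ i ∈ s, h (β i))
    (a : ℤ) (ha : ∀ i ∈ s, IsIntegral ℤ ((a : K) * β i)) (g : ℤ[X]) (m : ℕ) (hm : g.natDegree ≤ m) :
    ∃ J : ℤ, (J : K) = (a : K) ^ m * ∑ i ∈ s, aeval (β i) g := by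
  set y : K := (a : K) ^ m * ∑ i ∈ s, aeval (β i) g
  have hInt : IsIntegral ℤ y := by
    rw [show y = ∑ i ∈ s, (a : K) ^ m * aeval (β i) g from Finset.mul_sum ..]
    refine IsIntegral.sum _ fun i hi => ?_
    rw [aeval_eq_sum_range, Finset.mul_sum]
    refine IsIntegral.sum _ fun j hj => ?_
    have hj' : j ≤ m := by
      have := Finset.mem_range.1 hj; omega
    have : (a : K) ^ m * (g.coeff j • β i ^ j) =
        (g.coeff j : K) * (a : K) ^ (m - j) * ((a : K) * β i) ^ j := by
      rw [zsmul_eq_mul, mul_pow]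
      conv_lhs => rw [← Nat.sub_add_cancel hj', pow_add]
      ring
    rw [this]
    have hz : ∀ z : ℤ, IsIntegral ℤ (z : K) := fun z => by
      simpa using (isIntegral_algebraMap (R := ℤ) (A := K) (x := z))
    exact ((hz _).mul ((hz _).pow _)).mul ((ha i hi).pow _)
  have hfix : y ∈ Set.range (algebraMap ℚ K) := by
    rw [IsGalois.mem_range_algebraMap_iff_fixed]
    intro σ
    simp only [y, map_mul, map_pow, map_intCast, map_sum]
    congr 1
    have : ∀ i, σ (aeval (β i) g) = aeval (σ (β i)) g := fun i => by
      rw [aeval_def, aeval_def]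
      exact (Polynomial.hom_eval₂ (f := algebraMap ℤ K) (p := g) (g := (σ : K →+* K)) _).trans (by
        congr 1; exact RingHom.ext_int _ _)
    simp only [this]
    exact hσ σ fun x => aeval x g
  obtain ⟨q, hq⟩ := hfix
  have hqi : IsIntegral ℤ q := by
    rw [← hq] at hInt
    exact (isIntegral_algebraMap_iff (algebraMap ℚ K).injective).1 hInt
  obtain ⟨J, hJ⟩ := IsIntegrallyClosed.isIntegral_iff.1 hqi
  refine ⟨J, ?_⟩
  rw [← hq, ← hJ]; simp

open Filter Topology in
/-- A vanishing sum `k + Σ exp(βᵢ) = 0` with `k` a positive integer is impossible when the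
`βᵢ` are nonzero and form a Galois stable multiset. -/
theorem natCast_add_sum_exp_ne_zero {K : Type*} [Field K] [Algebra ℚ K] [FiniteDimensional ℚ K]
    [IsGalois ℚ K] (ψ : K →ₐ[ℚ] ℂ) {ι : Type*} (s : Finset ι) (β : ι → K)
    (hσ : ∀ (σ : Gal(K/ℚ)) , s.val.map (fun i => σ (β i)) = s.val.map β)
    (h0 : ∀ i ∈ s, β i ≠ 0) (k : ℕ) (hk : 0 < k) :
    (k : ℂ) + ∑ i ∈ s, Complex.exp (ψ (β i)) ≠ 0 := by
  intro hsum
  have hσ' : ∀ (σ : Gal(K/ℚ)) (h : K → K), ∑ i ∈ s, h (σ (β i)) = ∑ i ∈ s, h (β i) := by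
    intro σ h
    have := congrArg (fun t => (t.map h).sum) (hσ σ)
    simp only [Multiset.map_map, Function.comp_def] at this
    exact this
  set PK : K[X] := ∏ i ∈ s, (X - C (β i)) with hPK
  have hmonK : PK.Monic := monic_prod_of_monic _ _ fun i _ => monic_X_sub_C _
  have hfix : ∀ σ : Gal(K/ℚ), PK.map (σ : K →+* K) = PK := by
    intro σ
    rw [hPK, Polynomial.map_prod]
    simp only [Polynomial.map_sub, map_X, map_C]
    have := congrArg (fun t => (t.map (fun x : K => X - C x)).prod) (hσ σ)
    simp only [Multiset.map_map, Function.comp_def] at this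
    exact this
  have hlift : PK ∈ lifts (algebraMap ℚ K) := by
    rw [lifts_iff_coeff_lifts]
    intro n
    rw [IsGalois.mem_range_algebraMap_iff_fixed]
    intro σ
    conv_rhs => rw [← hfix σ]
    simp
  obtain ⟨PQ, hPQ⟩ := (mem_lifts PK).1 hlift
  obtain ⟨b, hb0, hb⟩ := IsLocalization.integerNormalization_spec (nonZeroDivisors ℤ) PQ
  have hb0 : b ≠ 0 := nonZeroDivisors.ne_zero hb0
  set f : ℤ[X] := IsLocalization.integerNormalization (nonZeroDivisors ℤ) PQ
  have hfK : f.map (algebraMap ℤ K) = C ((b : ℤ) : K) * PK := by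
    have h1 : (f.map (algebraMap ℤ ℚ)).map (algebraMap ℚ K) = f.map (algebraMap ℤ K) := by
      rw [Polynomial.map_map]; congr 1; exact RingHom.ext_int _ _
    rw [← h1, hb, ← hPQ]
    have : (b • PQ : ℚ[X]) = C ((b : ℤ) : ℚ) * PQ := by
      rw [← smul_eq_C_mul]
      ext n
      simp
    rw [this]
    simp
  have : CharZero K := charZero_of_injective_algebraMap (algebraMap ℚ K).injective
  have hbK : ((b : ℤ) : K) ≠ 0 := by exact_mod_cast (Int.cast_ne_zero (α := K)).2 hb0
  have hfC : f.map (algebraMap ℤ ℂ) = C ((b : ℤ) : ℂ) * ∏ i ∈ s, (X - C (ψ (β i))) := by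
    have h1 : (f.map (algebraMap ℤ K)).map (ψ : K →+* ℂ) = f.map (algebraMap ℤ ℂ) := by
      rw [Polynomial.map_map]; congr 1; exact RingHom.ext_int _ _
    rw [← h1, hfK, hPK, Polynomial.map_mul, Polynomial.map_prod]
    simp
  have haroots : f.aroots ℂ = s.val.map fun i => ψ (β i) := by
    rw [aroots_def, hfC, roots_C_mul _ (Int.cast_ne_zero.2 hb0)]
    exact roots_multiset_prod_X_sub_C (s.val.map fun i => ψ (β i)) ▸ by
      rw [Multiset.map_map]; rfl
  have hf0 : f.eval 0 ≠ 0 := by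
    intro h
    have h2 : (f.map (algebraMap ℤ K)).eval 0 = 0 := by
      rw [← coeff_zero_eq_eval_zero, coeff_map, coeff_zero_eq_eval_zero, h, map_zero]
    rw [hfK, hPK, eval_mul, eval_C, eval_prod, mul_eq_zero, Finset.prod_eq_zero_iff] at h2
    rcases h2 with h2 | ⟨i, hi, h2⟩
    · exact hbK h2
    · exact h0 i hi (by simpa using h2)
  set a := f.leadingCoeff with ha
  have ha0 : a ≠ 0 := by
    rw [ha, Ne, leadingCoeff_eq_zero]; rintro h; rw [h] at hf0; simp at hf0
  have haint : ∀ i ∈ s, IsIntegral ℤ ((a : K) * β i) := by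
    intro i hi
    have : aeval (β i) f = 0 := by
      rw [aeval_def, ← eval_map, hfK, hPK, eval_mul, eval_prod, Finset.prod_eq_zero hi (by simp),
        mul_zero]
    simpa [zsmul_eq_mul] using isIntegral_leadingCoeff_smul f (β i) this
  obtain ⟨c, hc⟩ := LindemannWeierstrass.exp_polynomial_approx f hf0
  set d := f.natDegree
  have hlim : Tendsto (fun p : ℕ => (s.card : ℝ) * (|(a : ℝ)| ^ d * c) * ((|(a : ℝ)| ^ d * c) ^ p / (p.factorial : ℝ)))
      atTop (𝓝 0) := by
    simpa using (FloorSemiring.tendsto_pow_div_factorial_atTop (|(a : ℝ)| ^ d * c)).const_mul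
      ((s.card : ℝ) * (|(a : ℝ)| ^ d * c))
  obtain ⟨N, hN⟩ := eventually_atTop.1 (hlim.eventually (gt_mem_nhds one_pos))
  obtain ⟨p, hpge, hp⟩ := Nat.exists_infinite_primes (N + 1 + (f.eval 0).natAbs + 1 + k + 1 + a.natAbs + 1)
  obtain ⟨n, hpn, gp, hgp, happ⟩ := hc p (by omega) hp
  have hdeg : gp.natDegree ≤ d * p := hgp.trans (by rw [mul_comm]; exact Nat.sub_le _ _)
  obtain ⟨J, hJ⟩ := exists_int_eq_pow_mul_sum_aeval s β hσ' a haint gp (d * p) hdeg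
  have hJC : (J : ℂ) = (a : ℂ) ^ (d * p) * ∑ i ∈ s, aeval (ψ (β i)) gp := by
    have := congrArg ψ hJ
    simp only [map_intCast, map_mul, map_pow, map_sum] at this
    rw [this]
    congr 1
    refine Finset.sum_congr rfl fun i _ => ?_
    rw [aeval_def, aeval_def]
    exact (Polynomial.hom_eval₂ (f := algebraMap ℤ K) (p := gp) (g := (ψ : K →+* ℂ)) _).trans (by
      congr 1; exact RingHom.ext_int _ _)
  set I : ℤ := -(n * k * a ^ (d * p)) - p * J with hI
  have hI0 : I ≠ 0 := by
    intro h
    have hdvd : (p : ℤ) ∣ n * k * a ^ (d * p) := ⟨-J, by linarith⟩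
    have hpZ := Nat.prime_iff_prime_int.1 hp
    rcases hpZ.dvd_or_dvd hdvd with h1 | h1
    · rcases hpZ.dvd_or_dvd h1 with h2 | h2
      · exact hpn h2
      · have := Nat.le_of_dvd hk (Int.natCast_dvd_natCast.1 h2); omega
    · have h2 := hpZ.dvd_of_dvd_pow h1
      have := Nat.le_of_dvd (Int.natAbs_pos.2 ha0) (Int.natCast_dvd.1 h2); omega
  have hIeq : (I : ℂ) = (a : ℂ) ^ (d * p) *
      ∑ i ∈ s, (n • Complex.exp (ψ (β i)) - p • aeval (ψ (β i)) gp) := by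
    rw [Finset.sum_sub_distrib, ← Finset.smul_sum, ← Finset.smul_sum,
      show ∑ i ∈ s, Complex.exp (ψ (β i)) = -(k : ℂ) by linear_combination hsum, hI]
    push_cast
    rw [hJC, zsmul_eq_mul, nsmul_eq_mul]
    ring
  have hIle : ‖(I : ℂ)‖ ≤ (s.card : ℝ) * (|(a : ℝ)| ^ d * c) *
      ((|(a : ℝ)| ^ d * c) ^ (p - 1) / ((p - 1).factorial : ℝ)) := by
    rw [hIeq, norm_mul, norm_pow]
    have hb : ‖∑ i ∈ s, (n • Complex.exp (ψ (β i)) - p • aeval (ψ (β i)) gp)‖ ≤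
        s.card • (c ^ p / ((p - 1).factorial : ℝ)) := by
      refine norm_sum_le_of_le _ ?_ |>.trans (by rw [Finset.sum_const])
      intro i hi
      exact happ (by rw [haroots]; exact Multiset.mem_map_of_mem _ hi)
    refine (mul_le_mul_of_nonneg_left hb (by positivity)).trans (le_of_eq ?_)
    rw [Complex.norm_intCast, nsmul_eq_mul, pow_mul]
    obtain ⟨r, rfl⟩ : ∃ r, p = r + 1 := ⟨p - 1, by have := hp.pos; omega⟩
    simp only [Nat.add_sub_cancel]
    rw [mul_pow, pow_succ c, pow_succ (|(a:ℝ)| ^ d)]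
    ring
  have hlt := hIle.trans_lt (hN (p - 1) (by omega))
  rw [Complex.norm_intCast] at hlt
  have : |I| < 1 := by exact_mod_cast hlt
  exact hI0 (Int.abs_lt_one_iff.1 this)

theorem exp_ne_neg_one_of_splits {K : Type*} [Field K] [Algebra ℚ K] {x : ℂ}
    (hxi : IsIntegral ℚ x) [IsSplittingField ℚ K (minpoly ℚ x)] : Complex.exp x ≠ -1 := by
  intro hexpx
  set P := minpoly ℚ x
  have hPirr : Irreducible P := minpoly.irreducible hxi
  have hsplit : (P.map (algebraMap ℚ K)).Splits := IsSplittingField.splits K P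
  have : FiniteDimensional ℚ K := IsSplittingField.finiteDimensional K P
  have : IsGalois ℚ K := IsGalois.of_separable_splitting_field (p := P) hPirr.separable
  let ψ : K →ₐ[ℚ] ℂ := IsAlgClosed.lift
  classical
  set S : Finset K := (P.aroots K).toFinset
  have hxS : ∃ r ∈ S, ψ r = x := by
    have h1 : x ∈ P.aroots ℂ := by
      rw [mem_aroots]; exact ⟨minpoly.ne_zero hxi, minpoly.aeval _ _⟩
    have h2 : P.aroots ℂ = (P.aroots K).map ψ := by
      have := hsplit.roots_map_of_injective (f := P.map (algebraMap ℚ K)) (i := (ψ : K →+* ℂ)) (ψ : K →+* ℂ).injective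
      rw [aroots_def, aroots_def, ← AlgHom.coe_toRingHom, ← this, Polynomial.map_map]
      congr 2
      exact (AlgHom.comp_algebraMap ψ).symm
    rw [h2, Multiset.mem_map] at h1
    obtain ⟨r, hr, hrx⟩ := h1
    exact ⟨r, Multiset.mem_toFinset.2 hr, hrx⟩
  obtain ⟨r, hrS, hrx⟩ := hxS
  have hprod : ∏ r ∈ S, (1 + Complex.exp (ψ r)) = 0 := by
    refine Finset.prod_eq_zero hrS ?_
    rw [hrx, hexpx]; norm_num
  rw [Finset.prod_one_add] at hprod
  have hexp : ∀ A : Finset K, ∏ r ∈ A, Complex.exp (ψ r) = Complex.exp (ψ (∑ r ∈ A, r)) := by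
    intro A; rw [map_sum, Complex.exp_sum]
  simp only [hexp] at hprod
  set s := S.powerset.filter fun A => ∑ r ∈ A, r ≠ 0 with hs
  set s0 := S.powerset.filter fun A => ¬ ∑ r ∈ A, r ≠ 0 with hs0
  rw [← Finset.sum_filter_add_sum_filter_not S.powerset (fun A => ∑ r ∈ A, r ≠ 0)] at hprod
  have h00 : ∑ A ∈ s0, Complex.exp (ψ (∑ r ∈ A, r)) = (s0.card : ℂ) := by
    rw [Finset.sum_congr rfl (g := fun _ => (1 : ℂ))]
    · simp
    · intro A hA
      have : ∑ r ∈ A, r = 0 := by simpa using (Finset.mem_filter.1 hA).2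
      rw [this]; simp
  rw [h00, add_comm] at hprod
  have hcard : 0 < s0.card := Finset.card_pos.2 ⟨∅, by simp [hs0]⟩
  refine natCast_add_sum_exp_ne_zero ψ s (fun A => ∑ r ∈ A, r) ?_ ?_ s0.card hcard hprod
  · intro σ
    have hσS : S.map (σ : K ≃ K).toEmbedding = S := by
      refine Finset.eq_of_subset_of_card_le ?_ (by simp)
      intro y hy
      obtain ⟨z, hz, rfl⟩ := Finset.mem_map.1 hy
      rw [Multiset.mem_toFinset, mem_aroots] at hz ⊢
      refine ⟨hz.1, ?_⟩
      have : aeval (σ z) P = σ (aeval z P) := aeval_algHom_apply (σ : K →ₐ[ℚ] K) z P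
      simpa [hz.2] using this
    have hσs : s.map ((σ : K ≃ K).finsetCongr).toEmbedding = s := by
      refine Finset.eq_of_subset_of_card_le ?_ (by simp)
      intro B hB
      obtain ⟨A, hA, rfl⟩ := Finset.mem_map.1 hB
      rw [hs, Finset.mem_filter, Finset.mem_powerset] at hA ⊢
      simp only [Equiv.coe_toEmbedding, Equiv.finsetCongr_apply]
      refine ⟨?_, ?_⟩
      · rw [← hσS]; exact Finset.map_subset_map.2 hA.1
      · simp only [Finset.sum_map]
        have : ∑ x ∈ A, σ x = σ (∑ x ∈ A, x) := (map_sum σ _ _).symm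
        simp only [Equiv.coe_toEmbedding]
        change ∑ x ∈ A, σ x ≠ 0
        rw [this]
        exact (map_ne_zero σ).2 hA.2
    conv_rhs => rw [← hσs]
    rw [Finset.map_val, Multiset.map_map]
    refine Multiset.map_congr rfl fun A _ => ?_
    simp [Finset.sum_map, map_sum]
  · intro A hA
    exact (Finset.mem_filter.1 hA).2

/-- `π` is transcendental. -/
theorem transcendental_pi : Transcendental ℚ (Real.pi : ℂ) := by
  intro hπ
  have hI : IsAlgebraic ℚ Complex.I := Complex.isIntegral_rat_I.isAlgebraic
  exact @exp_ne_neg_one_of_splits _ inferInstance _ _ (hπ.mul hI).isIntegral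
    (IsSplittingField.splittingField _) Complex.exp_pi_mul_I

end

section

/-- Jacobi's formula for the derivative of the determinant of a polynomial matrix. -/
theorem derivative_det_eq_trace {R n : Type*} [CommRing R] [Fintype n] [DecidableEq n]
    (M : Matrix n n (Polynomial R)) :
    Polynomial.derivative M.det =
      (M.adjugate * M.map Polynomial.derivative).trace := by
  have h1 : (M.adjugate * M.map Polynomial.derivative).trace =
      ∑ i, (M.updateCol i fun k => Polynomial.derivative (M k i)).det := by
    rw [Matrix.trace]
    refine Finset.sum_congr rfl fun i _ => ?_
    rw [← Matrix.cramer_apply, Matrix.cramer_eq_adjugate_mulVec]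
    rfl
  rw [h1]
  simp only [Matrix.det_apply]
  rw [Finset.sum_comm, Polynomial.derivative_sum]
  refine Finset.sum_congr rfl fun σ _ => ?_
  rw [Units.smul_def, Polynomial.derivative_smul, Polynomial.derivative_prod_finset, Finset.smul_sum]
  refine Finset.sum_congr rfl fun i hi => ?_
  rw [Units.smul_def]
  congr 1
  rw [← Finset.mul_prod_erase _ _ hi, mul_comm]
  congr 1
  · simp
  · refine Finset.prod_congr rfl fun j hj => ?_
    rw [Matrix.updateCol_ne (Finset.ne_of_mem_erase hj)]

/-- The sequence determined by Newton's recursion `k f_k = -∑ s_i f_{k-i}`, `f_0 = 1`. -/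
noncomputable def newtonSeq {F : Type*} [Field F] (s : ℕ → F) : ℕ → F
  | 0 => 1
  | k + 1 => -(∑ i : Fin (k + 1), s (k + 1 - i) * newtonSeq s i) / ((k : F) + 1)

theorem newtonSeq_succ {F : Type*} [Field F] (s : ℕ → F) (k : ℕ) :
    newtonSeq s (k + 1) =
      -(∑ i ∈ Finset.range (k + 1), s (k + 1 - i) * newtonSeq s i) / ((k : F) + 1) := by
  rw [newtonSeq, Finset.sum_range]

theorem coeff_charpolyRev_eq_newtonSeq {F n : Type*} [Field F] [CharZero F] [Fintype n]
    [DecidableEq n] (A : Matrix n n F) (k : ℕ) :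
    A.charpolyRev.coeff k = newtonSeq (fun l => (A ^ l).trace) k := by
  set M : Matrix n n (Polynomial F) := 1 - (Polynomial.X : Polynomial F) • A.map Polynomial.C
    with hM
  set B : ℕ → Matrix n n F := fun k => M.adjugate.map fun p => p.coeff k with hB
  have hf : A.charpolyRev = M.det := rfl
  have hadj : M.adjugate = M.det • 1 +
      (Polynomial.X : Polynomial F) • (M.adjugate * A.map Polynomial.C) := by
    have := Matrix.adjugate_mul M
    rw [hM, mul_sub, ← hM, mul_one, Matrix.mul_smul] at this
    rw [← this]; abel
  have hAB : ∀ (k : ℕ) (i j : n),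
      ((M.adjugate * A.map Polynomial.C) i j).coeff k = (B k * A) i j := by
    intro k i j
    simp [Matrix.mul_apply, hB]
  have hB0 : B 0 = A.charpolyRev.coeff 0 • 1 := by
    ext i j
    have := congrArg (fun N : Matrix n n (Polynomial F) => (N i j).coeff 0) hadj
    simp only [Matrix.add_apply, Matrix.smul_apply, smul_eq_mul, Polynomial.coeff_add,
      Polynomial.coeff_X_mul_zero, add_zero] at this
    simp only [hB, Matrix.map_apply, this, hf, Matrix.smul_apply, smul_eq_mul]
    by_cases h : i = j <;> simp [h, Matrix.one_apply]
  have hBs : ∀ k, B (k + 1) = A.charpolyRev.coeff (k + 1) • 1 + B k * A := by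
    intro k
    ext i j
    have := congrArg (fun N : Matrix n n (Polynomial F) => (N i j).coeff (k + 1)) hadj
    simp only [Matrix.add_apply, Matrix.smul_apply, smul_eq_mul, Polynomial.coeff_add,
      Polynomial.coeff_X_mul, hAB] at this
    simp only [Matrix.add_apply, Matrix.smul_apply, smul_eq_mul]
    rw [← hf] at this
    change (M.adjugate i j).coeff (k + 1) = _
    rw [this]
    by_cases h : i = j <;> simp [h, Matrix.one_apply]
  have hBsum : ∀ k, B k = ∑ i ∈ Finset.range (k + 1), A.charpolyRev.coeff i • A ^ (k - i) := by
    intro k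
    induction k with
    | zero => simp [hB0]
    | succ k ih =>
      rw [hBs, ih, Finset.sum_range_succ _ (k + 1), Finset.sum_mul, add_comm]
      congr 1
      · refine Finset.sum_congr rfl fun i hi => ?_
        have : k + 1 - i = k - i + 1 := by have := Finset.mem_range.1 hi; omega
        rw [this, pow_succ, Matrix.smul_mul]
      · simp
  have hder : ∀ k : ℕ, ((k : F) + 1) * A.charpolyRev.coeff (k + 1) = -(B k * A).trace := by
    intro k
    have h1 := derivative_det_eq_trace M
    have h2 : M.map Polynomial.derivative = -A.map Polynomial.C := by
      ext i j : 2
      simp only [hM, Matrix.map_apply, Matrix.sub_apply, Matrix.smul_apply, smul_eq_mul,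
        Matrix.neg_apply]
      by_cases h : i = j <;> simp [h, Matrix.one_apply]
    rw [h2, Matrix.mul_neg, Matrix.trace_neg, ← hf] at h1
    have h3 := congrArg (fun p => Polynomial.coeff p k) h1
    simp only [Polynomial.coeff_derivative, Polynomial.coeff_neg] at h3
    rw [mul_comm, h3, Matrix.trace, Matrix.trace, Polynomial.finsetSum_coeff]
    simp only [Matrix.diag_apply, hAB]
  induction k using Nat.strong_induction_on with
  | _ k ih =>
    rcases k with _ | k
    · rw [Polynomial.coeff_zero_eq_eval_zero, Matrix.eval_charpolyRev, newtonSeq]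
    · have hk : (k : F) + 1 ≠ 0 := by exact_mod_cast Nat.succ_ne_zero k
      rw [newtonSeq_succ, eq_div_iff hk, mul_comm, hder, hBsum, Finset.sum_mul, Matrix.trace_sum]
      congr 1
      refine Finset.sum_congr rfl fun i hi => ?_
      have hi' := Finset.mem_range.1 hi
      have : k + 1 - i = k - i + 1 := by omega
      rw [Matrix.smul_mul, Matrix.trace_smul, ← pow_succ, this, ih i hi', smul_eq_mul, mul_comm]

end

section

open Filter Topology

variable {ι : Type*}

/-- Row sums of absolute values. -/
noncomputable def rowNorm (G : ι → ι → ℂ) (n : ι) : ℝ := ∑' m, ‖G n m‖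

/-- Entries of the powers of an infinite matrix. -/
noncomputable def powEntry [DecidableEq ι] (G : ι → ι → ℂ) : ℕ → ι → ι → ℂ
  | 0, n, m => if n = m then 1 else 0
  | l + 1, n, m => ∑' k, G n k * powEntry G l k m

/-- Traces of the powers of an infinite matrix. -/
noncomputable def trPow [DecidableEq ι] (G : ι → ι → ℂ) (l : ℕ) : ℂ := ∑' n, powEntry G l n n

/-- A finite section of an infinite matrix. -/
def trunc (G : ι → ι → ℂ) (R : Finset ι) : Matrix R R ℂ := Matrix.of fun i j => G i j

/-- An infinite matrix whose entries form an absolutely summable family. -/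
def AbsSummable (G : ι → ι → ℂ) : Prop := Summable fun p : ι × ι => ‖G p.1 p.2‖

theorem AbsSummable.row {G : ι → ι → ℂ} (hG : AbsSummable G) (n : ι) :
    Summable fun m => ‖G n m‖ := hG.prod_factor n

theorem AbsSummable.rowNorm {G : ι → ι → ℂ} (hG : AbsSummable G) :
    Summable (rowNorm G) := Summable.prod hG

theorem rowNorm_nonneg (G : ι → ι → ℂ) (n : ι) : 0 ≤ rowNorm G n :=
  tsum_nonneg fun _ => norm_nonneg _

theorem AbsSummable.rowNorm_le {G : ι → ι → ℂ} (hG : AbsSummable G) (n : ι) :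
    TBG.rowNorm G n ≤ ∑' k, TBG.rowNorm G k :=
  hG.rowNorm.le_tsum n fun _ _ => rowNorm_nonneg G _

theorem AbsSummable.of_norm_le {G H : ι → ι → ℂ} (hG : AbsSummable G)
    (h : ∀ n m, ‖H n m‖ ≤ ‖G n m‖) : AbsSummable H :=
  Summable.of_nonneg_of_le (fun _ => norm_nonneg _) (fun p => h p.1 p.2) hG

section
variable [DecidableEq ι]

theorem norm_powEntry_le {G H : ι → ι → ℂ} (hG : AbsSummable G)
    (h : ∀ n m, ‖H n m‖ ≤ ‖G n m‖) (l : ℕ) (n m : ι) :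
    ‖powEntry H (l + 1) n m‖ ≤ rowNorm G n * (∑' k, rowNorm G k) ^ l := by
  induction l generalizing n with
  | zero =>
    have : powEntry H 1 n m = H n m := by
      rw [powEntry, tsum_eq_single m]
      · simp [powEntry]
      · intro k hk; simp [powEntry, hk]
    rw [this, pow_zero, mul_one]
    exact (h n m).trans ((hG.row n).le_tsum m fun _ _ => norm_nonneg _)
  | succ l ih =>
    rw [powEntry]
    have hb : ∀ k, ‖H n k * powEntry H (l + 1) k m‖ ≤
        ‖G n k‖ * (∑' k, rowNorm G k) ^ (l + 1) := by
      intro k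
      rw [norm_mul]
      refine mul_le_mul (h n k) ((ih k).trans ?_) (norm_nonneg _) (norm_nonneg _)
      rw [pow_succ']
      exact mul_le_mul_of_nonneg_right (hG.rowNorm_le k)
        (pow_nonneg (tsum_nonneg fun _ => rowNorm_nonneg G _) _)
    have hs := (hG.row n).mul_right ((∑' k, rowNorm G k) ^ (l + 1))
    refine (tsum_of_norm_bounded hs.hasSum hb).trans (le_of_eq ?_)
    rw [tsum_mul_right]; rfl

/-- Convergence of entries implies convergence of the entries of powers. -/
theorem tendsto_powEntry {A : Type*} {f : Filter A} {G : ι → ι → ℂ} (hG : AbsSummable G)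
    {H : A → ι → ι → ℂ} {H0 : ι → ι → ℂ} (h : ∀ a n m, ‖H a n m‖ ≤ ‖G n m‖)
    (hH : ∀ n m, Tendsto (fun a => H a n m) f (𝓝 (H0 n m))) (l : ℕ) (n m : ι) :
    Tendsto (fun a => powEntry (H a) l n m) f (𝓝 (powEntry H0 l n m)) := by
  induction l generalizing n with
  | zero => exact tendsto_const_nhds
  | succ l ih =>
    simp only [powEntry]
    rcases l with _ | l
    · have : ∀ H : ι → ι → ℂ, ∑' k, H n k * powEntry H 0 k m = H n m := by
        intro H
        rw [tsum_eq_single m]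
        · simp [powEntry]
        · intro k hk; simp [powEntry, hk]
      simp only [this]
      exact hH n m
    · refine tendsto_tsum_of_dominated_convergence
        ((hG.row n).mul_right ((∑' k, rowNorm G k) ^ (l + 1)))
        (fun k => (hH n k).mul (ih k)) (Eventually.of_forall fun a k => ?_)
      rw [norm_mul]
      refine mul_le_mul (h a n k) ((norm_powEntry_le hG (h a) l k m).trans ?_) (norm_nonneg _)
        (norm_nonneg _)
      rw [pow_succ']
      exact mul_le_mul_of_nonneg_right (hG.rowNorm_le k)
        (pow_nonneg (tsum_nonneg fun _ => rowNorm_nonneg G _) _)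

theorem tendsto_trPow {A : Type*} {f : Filter A} {G : ι → ι → ℂ} (hG : AbsSummable G)
    {H : A → ι → ι → ℂ} {H0 : ι → ι → ℂ} (h : ∀ a n m, ‖H a n m‖ ≤ ‖G n m‖)
    (hH : ∀ n m, Tendsto (fun a => H a n m) f (𝓝 (H0 n m))) (l : ℕ) :
    Tendsto (fun a => trPow (H a) (l + 1)) f (𝓝 (trPow H0 (l + 1))) :=
  tendsto_tsum_of_dominated_convergence
    (hG.rowNorm.mul_right ((∑' k, rowNorm G k) ^ l))
    (fun n => tendsto_powEntry hG h hH (l + 1) n n)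
    (Eventually.of_forall fun a n => norm_powEntry_le hG (h a) l n n)

theorem trace_trunc_pow (G : ι → ι → ℂ) (R : Finset ι) (l : ℕ) :
    (trunc G R ^ (l + 1)).trace =
      trPow (fun n m => if n ∈ R ∧ m ∈ R then G n m else 0) (l + 1) := by
  set H : ι → ι → ℂ := fun n m => if n ∈ R ∧ m ∈ R then G n m else 0 with hH
  have h1 : ∀ (l : ℕ) (i j : R), (trunc G R ^ l) i j = powEntry H l i j := by
    intro l
    induction l with
    | zero => intro i j; rw [pow_zero, Matrix.one_apply, powEntry]; simp only [Subtype.ext_iff]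
    | succ l ih =>
      intro i j
      rw [pow_succ', Matrix.mul_apply, powEntry, tsum_eq_sum (s := R)]
      · rw [← Finset.sum_coe_sort R]
        refine Finset.sum_congr rfl fun k _ => ?_
        rw [ih]
        simp [trunc, hH]
      · intro k hk; simp [hH, hk]
  have h2 : ∀ n ∉ R, powEntry H (l + 1) n n = 0 := by
    intro n hn
    rw [powEntry]
    have : ∀ k, H n k = 0 := fun k => if_neg fun h => hn h.1
    simp only [this, zero_mul, tsum_zero]
  rw [trPow, tsum_eq_sum (s := R) (fun n hn => h2 n hn), Matrix.trace, ← Finset.sum_coe_sort R]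
  exact Finset.sum_congr rfl fun i _ => h1 _ i i

theorem tendsto_trace_trunc_pow {G : ι → ι → ℂ} (hG : AbsSummable G) (l : ℕ) :
    Tendsto (fun R : Finset ι => (trunc G R ^ (l + 1)).trace) atTop (𝓝 (trPow G (l + 1))) := by
  simp only [trace_trunc_pow]
  refine tendsto_trPow hG (fun R n m => ?_) (fun n m => ?_) l
  · split_ifs <;> simp
  · refine tendsto_const_nhds.congr' ?_
    filter_upwards [eventually_ge_atTop ({n, m} : Finset ι)] with R hR
    have hn : n ∈ R := hR (by simp)
    have hm : m ∈ R := hR (by simp)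
    simp [hn, hm]

end

theorem tendsto_newtonSeq {A : Type*} {f : Filter A} {s : A → ℕ → ℂ} {s0 : ℕ → ℂ}
    (h : ∀ l, Tendsto (fun a => s a (l + 1)) f (𝓝 (s0 (l + 1)))) (k : ℕ) :
    Tendsto (fun a => newtonSeq (s a) k) f (𝓝 (newtonSeq s0 k)) := by
  induction k using Nat.strong_induction_on with
  | _ k ih =>
    rcases k with _ | k
    · simp only [newtonSeq]; exact tendsto_const_nhds
    · simp only [newtonSeq_succ]
      refine Tendsto.div_const (tendsto_finsetSum _ fun i hi => ?_).neg _
      have hi := Finset.mem_range.1 hi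
      have : k + 1 - i = k - i + 1 := by omega
      rw [this]
      exact (h _).mul (ih i hi)

theorem norm_det_le_prod {n : Type*} [Fintype n] [DecidableEq n] (M : Matrix n n ℂ) :
    ‖M.det‖ ≤ ∏ i, ∑ j, ‖M i j‖ := by
  rw [← Matrix.det_transpose, Matrix.det_apply, Finset.prod_univ_sum]
  refine (norm_sum_le _ _).trans ?_
  have : ∀ σ : Equiv.Perm n, ‖Equiv.Perm.sign σ • ∏ i, M.transpose (σ i) i‖ = ∏ i, ‖M i (σ i)‖ := by
    intro σ
    rcases Int.units_eq_one_or (Equiv.Perm.sign σ) with h | h <;> simp [h]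
  simp only [this]
  rw [← Finset.sum_image (s := Finset.univ) (g := fun σ : Equiv.Perm n => (σ : n → n))
    (f := fun p => ∏ i, ‖M i (p i)‖) (fun a _ b _ h => DFunLike.coe_injective h)]
  refine Finset.sum_le_sum_of_subset_of_nonneg ?_ fun _ _ _ =>
    Finset.prod_nonneg fun _ _ => norm_nonneg _
  intro p _
  simp

theorem eval_charpolyRev_eq {n : Type*} [Fintype n] [DecidableEq n] (M : Matrix n n ℂ) (x : ℂ) :
    M.charpolyRev.eval x = (1 - x • M).det := by
  rw [Matrix.charpolyRev, ← Polynomial.coe_evalRingHom, RingHom.map_det]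
  congr 1
  ext i j
  rcases eq_or_ne i j with rfl | h
  · simp [mul_comm x]
  · simp [h, mul_comm x]

theorem sum_norm_one_sub_trunc_le {G : ι → ι → ℂ} (hG : AbsSummable G) [DecidableEq ι]
    (R : Finset ι) (x : ℂ) (i : R) :
    ∑ j, ‖(1 - x • trunc G R) i j‖ ≤ 1 + ‖x‖ * rowNorm G i := by
  calc ∑ j, ‖(1 - x • trunc G R) i j‖
      ≤ ∑ j, (‖(1 : Matrix R R ℂ) i j‖ + ‖x‖ * ‖G i j‖) := by
        refine Finset.sum_le_sum fun j _ => ?_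
        rw [Matrix.sub_apply, Matrix.smul_apply, smul_eq_mul, ← norm_mul]
        exact norm_sub_le _ _
    _ ≤ _ := by
        rw [Finset.sum_add_distrib, ← Finset.mul_sum]
        refine add_le_add ?_ (mul_le_mul_of_nonneg_left ?_ (norm_nonneg _))
        · rw [Finset.sum_eq_single i] <;> simp +contextual [eq_comm]
        · rw [Finset.sum_coe_sort R fun j => ‖G i j‖]
          exact (hG.row i).sum_le_tsum _ fun _ _ => norm_nonneg _

theorem norm_det_one_sub_trunc_le {G : ι → ι → ℂ} (hG : AbsSummable G) [DecidableEq ι]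
    (R : Finset ι) (x : ℂ) :
    ‖(1 - x • trunc G R).det‖ ≤ ∏ i ∈ R, (1 + ‖x‖ * rowNorm G i) := by
  refine (norm_det_le_prod _).trans ?_
  rw [← Finset.prod_coe_sort R]
  exact Finset.prod_le_prod (fun _ _ => Finset.sum_nonneg fun _ _ => norm_nonneg _)
    fun i _ => sum_norm_one_sub_trunc_le hG R x i

theorem prod_one_add_rowNorm_le {G : ι → ι → ℂ} (hG : AbsSummable G) (R : Finset ι) {t : ℝ}
    (ht : 0 ≤ t) :
    ∏ i ∈ R, (1 + t * rowNorm G i) ≤ Real.exp (t * ∑' k, rowNorm G k) := by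
  calc ∏ i ∈ R, (1 + t * rowNorm G i) ≤ ∏ i ∈ R, Real.exp (t * rowNorm G i) :=
        Finset.prod_le_prod (fun i _ => by have := rowNorm_nonneg G i; positivity)
          fun i _ => by rw [add_comm]; exact Real.add_one_le_exp _
    _ = Real.exp (t * ∑ i ∈ R, rowNorm G i) := by rw [← Real.exp_sum, Finset.mul_sum]
    _ ≤ _ := by
        gcongr
        exact hG.rowNorm.sum_le_tsum _ fun _ _ => rowNorm_nonneg G _

/-- Cauchy's estimate for the coefficients of a polynomial. -/
theorem norm_polynomial_coeff_le_of_sphere (p : Polynomial ℂ) {r C : ℝ} (hr : 0 < r)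
    (h : ∀ x : ℂ, ‖x‖ = r → ‖p.eval x‖ ≤ C) (k : ℕ) : ‖p.coeff k‖ ≤ C / r ^ k := by
  have h1 := Complex.norm_iteratedDeriv_le_of_forall_mem_sphere_norm_le (c := 0) (F := ℂ) k hr
    (f := fun x => p.eval x) p.differentiable.diffContOnCl (C := C)
    fun z hz => h z (by simpa using hz)
  have h2 : iteratedDeriv k (fun x => p.eval x) 0 = (k.factorial : ℂ) * p.coeff k := by
    have h3 : ∀ k, iteratedDeriv k (fun x => p.eval x) =
        fun x => (Polynomial.derivative^[k] p).eval x := by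
      intro k
      induction k with
      | zero => simp
      | succ k ih =>
        rw [iteratedDeriv_succ, ih]
        ext x
        rw [Polynomial.deriv, Function.iterate_succ_apply']
    rw [h3]
    simp only
    rw [← Polynomial.coeff_zero_eq_eval_zero,
      Polynomial.coeff_iterate_derivative]
    simp [Nat.descFactorial_self]
  rw [h2, norm_mul, Complex.norm_natCast, mul_div_assoc] at h1
  exact le_of_mul_le_mul_left h1 (by positivity)

end

section

open Filter Topology

/-- An entire function with finitely many zeros is a polynomial times a nonvanishing entire
function. -/
theorem exists_polynomial_mul_of_zeros_subset (S : Finset ℂ) :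
    ∀ F : ℂ → ℂ, Differentiable ℂ F → F ≠ 0 → (∀ x, F x = 0 → x ∈ S) →
      ∃ P : Polynomial ℂ, ∃ H : ℂ → ℂ, P ≠ 0 ∧ Differentiable ℂ H ∧ (∀ x, H x ≠ 0) ∧
        ∀ x, F x = P.eval x * H x := by
  classical
  induction S using Finset.induction_on with
  | empty =>
    intro F hF _ hz
    exact ⟨1, F, one_ne_zero, hF, fun x hx => by simpa using hz x hx, fun x => by simp⟩
  | insert z₀ S _ ih =>
    intro F hF hF0 hz
    have hFa : AnalyticOnNhd ℂ F Set.univ := hF.differentiableOn.analyticOnNhd isOpen_univ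
    obtain ⟨p, hp⟩ := hFa z₀ (Set.mem_univ _)
    set H : ℂ → ℂ := (Function.swap dslope z₀)^[p.order] F with hH
    have hHd : Differentiable ℂ H := by
      rw [hH]
      generalize p.order = k
      induction k with
      | zero => exact hF
      | succ k ihk =>
        rw [Function.iterate_succ_apply', Function.swap, ← differentiableOn_univ,
          Complex.differentiableOn_dslope univ_mem]
        exact ihk.differentiableOn
    have hp0 : p ≠ 0 := by
      intro h
      rw [h] at hp
      exact hF0 (hFa.eq_of_eventuallyEq (g := 0) (z₀ := z₀) (fun _ _ => analyticAt_const)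
        (hp.eventually_eq_zero))
    have hHz : H z₀ ≠ 0 := hp.iterate_dslope_fslope_ne_zero hp0
    have hFH : F = fun z => (z - z₀) ^ p.order * H z :=
      funext hp.eq_pow_order_mul_iterate_dslope
    obtain ⟨P, H', hP, hH'd, hH'0, hPH⟩ := ih H hHd (fun h => hHz (by rw [h]; rfl)) (by
      intro x hx
      have h1 : F x = 0 := by rw [hFH]; simp [hx]
      rcases Finset.mem_insert.1 (hz x h1) with rfl | h
      · exact absurd hx hHz
      · exact h)
    refine ⟨(Polynomial.X - Polynomial.C z₀) ^ p.order * P, H',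
      mul_ne_zero (pow_ne_zero _ (Polynomial.X_sub_C_ne_zero _)) hP, hH'd, hH'0, fun x => ?_⟩
    rw [hFH]
    simp only [hPH, Polynomial.eval_mul, Polynomial.eval_pow, Polynomial.eval_sub,
      Polynomial.eval_X, Polynomial.eval_C, mul_assoc]

theorem exists_exp_eq_of_ne_zero {H : ℂ → ℂ} (hH : Differentiable ℂ H) (h0 : ∀ x, H x ≠ 0) :
    ∃ g : ℂ → ℂ, Differentiable ℂ g ∧ ∀ x, H x = Complex.exp (g x) := by
  have hd : Differentiable ℂ (deriv H) := by
    have := (hH.differentiableOn (s := Set.univ)).deriv isOpen_univ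
    exact differentiableOn_univ.1 this
  obtain ⟨g, hg⟩ := (hd.div hH h0).isExactOn_univ
  have hg' : ∀ x, HasDerivAt g (deriv H x / H x) x := fun x => hg x (Set.mem_univ x)
  have hconst : ∀ x y, H x * Complex.exp (-g x) = H y * Complex.exp (-g y) := by
    refine is_const_of_deriv_eq_zero (𝕜 := ℂ) (fun x => ?_) fun x => ?_
    · exact (hH x).mul (hg' x).differentiableAt.neg.cexp
    · have : HasDerivAt (fun x => H x * Complex.exp (-g x)) _ x :=
        (hH x).hasDerivAt.mul (hg' x).neg.cexp
      rw [this.deriv]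
      have := h0 x
      simp only [Pi.neg_apply]
      field_simp
      ring
  refine ⟨fun x => g x - g 0 + Complex.log (H 0), fun x =>
    (((hg' x).differentiableAt.sub_const _).add_const _), fun x => ?_⟩
  have h1 := hconst x 0
  rw [Complex.exp_add, Complex.exp_sub, Complex.exp_log (h0 0)]
  rw [Complex.exp_neg, Complex.exp_neg] at h1
  have e1 := Complex.exp_ne_zero (g x)
  have e2 := Complex.exp_ne_zero (g 0)
  field_simp at h1 ⊢
  linear_combination h1

/-- A nonvanishing entire function of order at most one and minimal type is constant. -/
theorem eq_const_of_growth {H : ℂ → ℂ} (hH : Differentiable ℂ H) (h0 : ∀ x, H x ≠ 0)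
    (hgrow : ∀ ε > 0, ∃ C : ℝ, ∀ x, ‖H x‖ ≤ C * Real.exp (ε * ‖x‖)) (x y : ℂ) : H x = H y := by
  obtain ⟨g, hg, hgH⟩ := exists_exp_eq_of_ne_zero hH h0
  suffices hd : ∀ z, deriv g z = 0 by
    rw [hgH, hgH, is_const_of_deriv_eq_zero hg hd x y]
  have key : ∀ ε > 0, ∃ C : ℝ, 0 ≤ C ∧ ∀ x, ‖g x‖ ≤ 4 * ε * ‖x‖ + C := by
    intro ε hε
    obtain ⟨C, hC⟩ := hgrow ε hε
    set D : ℝ := max C 1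
    have hD : 1 ≤ D := le_max_right _ _
    have hlog : 0 ≤ Real.log D := Real.log_nonneg hD
    refine ⟨2 * (4 * ε + Real.log D + 1) + 3 * ‖g 0‖, by positivity, fun x => ?_⟩
    have hre : ∀ z, (g z).re ≤ ε * ‖z‖ + Real.log D := by
      intro z
      have h1 := hC z
      rw [hgH, Complex.norm_exp] at h1
      have h2 : Real.exp (g z).re ≤ D * Real.exp (ε * ‖z‖) :=
        h1.trans (mul_le_mul_of_nonneg_right (le_max_left _ _) (Real.exp_pos _).le)
      have h3 := Real.log_le_log (Real.exp_pos _) h2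
      rw [Real.log_exp, Real.log_mul (by positivity) (Real.exp_pos _).ne', Real.log_exp] at h3
      linarith
    set M : ℝ := ε * (2 * ‖x‖ + 1) + Real.log D + 1
    have hb := Complex.borelCaratheodory (f := g) (M := M) (R := 2 * ‖x‖ + 1) (z := x)
      (by positivity) hg.differentiableOn (by
        intro z hz
        have hz' : ‖z‖ < 2 * ‖x‖ + 1 := by simpa using hz
        have := hre z
        have h2 : ε * ‖z‖ ≤ ε * (2 * ‖x‖ + 1) := by gcongr
        change (g z).re ≤ M
        simp only [M]; linarith) (by positivity) (by
        simp only [Metric.mem_ball, dist_zero_right]; linarith [norm_nonneg x])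
    have hx := norm_nonneg x
    have e1 : 2 * M * ‖x‖ / (2 * ‖x‖ + 1 - ‖x‖) ≤ 2 * M := by
      rw [div_le_iff₀ (by linarith)]
      have : 0 ≤ M := by positivity
      nlinarith
    have e2 : ‖g 0‖ * (2 * ‖x‖ + 1 + ‖x‖) / (2 * ‖x‖ + 1 - ‖x‖) ≤ 3 * ‖g 0‖ := by
      rw [div_le_iff₀ (by linarith)]
      nlinarith [norm_nonneg (g 0)]
    refine hb.trans ((add_le_add e1 e2).trans ?_)
    simp only [M]
    nlinarith
  intro z
  by_contra hne
  have hpos : 0 < ‖deriv g z‖ := norm_pos_iff.2 hne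
  set d := ‖deriv g z‖
  obtain ⟨C, hC0, hC⟩ := key (d / 16) (by positivity)
  set R : ℝ := 4 * (d / 4 * ‖z‖ + C) / d + 1 with hR
  have hRpos : 0 < R := by positivity
  have hb := Complex.norm_deriv_le_of_forall_mem_sphere_norm_le (c := z) hRpos
    hg.diffContOnCl (C := d / 4 * (‖z‖ + R) + C) (by
      intro w hw
      have hw' : ‖w - z‖ = R := by simpa [dist_eq_norm] using hw
      have : ‖w‖ ≤ ‖z‖ + R := by
        calc ‖w‖ = ‖z + (w - z)‖ := by ring_nf
          _ ≤ _ := (norm_add_le _ _).trans (by rw [hw'])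
      refine (hC w).trans ?_
      have : 4 * (d / 16) * ‖w‖ ≤ d / 4 * (‖z‖ + R) := by
        rw [show 4 * (d / 16) = d / 4 by ring]; gcongr
      linarith)
  rw [le_div_iff₀ hRpos] at hb
  have h2 : d * R = 4 * (d / 4 * ‖z‖ + C) + d := by
    rw [hR]; field_simp
  change d * R ≤ _ at hb
  have h3 : 0 ≤ d / 4 * ‖z‖ := by positivity
  nlinarith

/-- An entire function of order at most one and minimal type with finitely many zeros is a
polynomial. -/
theorem exists_polynomial_of_growth {F : ℂ → ℂ} (hF : Differentiable ℂ F) (hF0 : F ≠ 0)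
    (hz : {x | F x = 0}.Finite)
    (hgrow : ∀ ε > 0, ∃ C : ℝ, ∀ x, ‖F x‖ ≤ C * Real.exp (ε * ‖x‖)) :
    ∃ P : Polynomial ℂ, ∀ x, F x = P.eval x := by
  obtain ⟨P, H, hP, hH, hH0, hPH⟩ := exists_polynomial_mul_of_zeros_subset hz.toFinset F hF hF0
    fun x hx => by simpa using hx
  have hPlow : ∃ c > 0, ∀ᶠ x in cocompact ℂ, c ≤ ‖P.eval x‖ := by
    by_cases hd : 0 < P.degree
    · exact ⟨1, one_pos, (P.tendsto_norm_atTop hd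
        tendsto_norm_cocompact_atTop).eventually_ge_atTop 1⟩
    · have h1 := Polynomial.eq_C_of_degree_le_zero (not_lt.1 hd)
      refine ⟨‖P.coeff 0‖, norm_pos_iff.2 fun h => hP ?_, Eventually.of_forall fun x => ?_⟩
      · rw [h1, h, map_zero]
      · conv_rhs => rw [h1, Polynomial.eval_C]
  obtain ⟨c, hc, hev⟩ := hPlow
  rw [← Metric.cobounded_eq_cocompact] at hev
  obtain ⟨ρ, -, hρ⟩ := (Metric.hasBasis_cobounded_compl_closedBall (0 : ℂ)).eventually_iff.1 hev
  have hHgrow : ∀ ε > 0, ∃ C : ℝ, ∀ x, ‖H x‖ ≤ C * Real.exp (ε * ‖x‖) := by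
    intro ε hε
    obtain ⟨C, hC⟩ := hgrow ε hε
    obtain ⟨B, hB⟩ := (isCompact_closedBall (0 : ℂ) ρ).exists_bound_of_continuousOn
      hH.continuous.continuousOn
    refine ⟨max (C / c) B, fun x => ?_⟩
    by_cases hx : x ∈ Metric.closedBall (0 : ℂ) ρ
    · have h1 := hB x hx
      have h2 : 1 ≤ Real.exp (ε * ‖x‖) := Real.one_le_exp (by positivity)
      have h3 : 0 ≤ max (C / c) B := ((norm_nonneg _).trans h1).trans (le_max_right _ _)
      nlinarith [le_max_right (C / c) B]
    · have h1 := hρ (x := x) hx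
      have h2 := hC x
      rw [hPH, norm_mul] at h2
      have h3 : c * ‖H x‖ ≤ C * Real.exp (ε * ‖x‖) :=
        (mul_le_mul_of_nonneg_right h1 (norm_nonneg _)).trans h2
      have h4 : ‖H x‖ ≤ C / c * Real.exp (ε * ‖x‖) := by
        rw [div_mul_eq_mul_div, le_div_iff₀ hc]; linarith
      exact h4.trans (mul_le_mul_of_nonneg_right (le_max_left _ _) (Real.exp_pos _).le)
  refine ⟨P * Polynomial.C (H 0), fun x => ?_⟩
  rw [hPH, Polynomial.eval_mul, Polynomial.eval_C, eq_const_of_growth hH hH0 hHgrow x 0]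

end

section

open Filter Topology

variable {ι : Type*} [DecidableEq ι]

/-- The Fredholm determinant `det (1 - x G)` of an infinite matrix, as a power series in `x`. -/
noncomputable def fredF (G : ι → ι → ℂ) (x : ℂ) : ℂ := ∑' k, newtonSeq (trPow G) k * x ^ k

/-- The reciprocals of the eigenvalues of an infinite matrix with bounded eigenvectors. -/
def IsEig (G : ι → ι → ℂ) (x : ℂ) : Prop :=
  ∃ v : ι → ℂ, v ≠ 0 ∧ (∃ B : ℝ, ∀ n, ‖v n‖ ≤ B) ∧ ∀ n, v n = x * ∑' m, G n m * v m

variable {G : ι → ι → ℂ}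

theorem norm_coeff_charpolyRev_trunc_le (hG : AbsSummable G) (R : Finset ι) {r : ℝ} (hr : 0 < r)
    (k : ℕ) :
    ‖(trunc G R).charpolyRev.coeff k‖ ≤ Real.exp (r * ∑' n, rowNorm G n) / r ^ k := by
  refine norm_polynomial_coeff_le_of_sphere _ hr (fun x hx => ?_) k
  rw [eval_charpolyRev_eq]
  refine (norm_det_one_sub_trunc_le hG R x).trans ?_
  rw [hx]
  exact prod_one_add_rowNorm_le hG R hr.le

theorem tendsto_coeff_charpolyRev_trunc (hG : AbsSummable G) (k : ℕ) :
    Tendsto (fun R : Finset ι => (trunc G R).charpolyRev.coeff k) atTop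
      (𝓝 (newtonSeq (trPow G) k)) := by
  simp only [coeff_charpolyRev_eq_newtonSeq]
  exact tendsto_newtonSeq (fun l => tendsto_trace_trunc_pow hG l) k

theorem norm_newtonSeq_trPow_le (hG : AbsSummable G) {r : ℝ} (hr : 0 < r) (k : ℕ) :
    ‖newtonSeq (trPow G) k‖ ≤ Real.exp (r * ∑' n, rowNorm G n) / r ^ k :=
  le_of_tendsto (tendsto_coeff_charpolyRev_trunc hG k).norm
    (Eventually.of_forall fun R => norm_coeff_charpolyRev_trunc_le hG R hr k)

theorem div_pow_mul_pow_le {C ρ t : ℝ} (hC : 0 ≤ C) (hρ : 0 < ρ) (ht : 0 ≤ t) (htρ : t ≤ ρ)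
    (k : ℕ) : C / (2 * ρ) ^ k * t ^ k ≤ C * (1 / 2) ^ k := by
  have h1 : t ^ k ≤ ρ ^ k := pow_le_pow_left₀ ht htρ k
  have h2 : C / (2 * ρ) ^ k * ρ ^ k = C * (1 / 2) ^ k := by
    rw [mul_pow, div_pow, one_pow]; field_simp
  rw [← h2]
  gcongr

theorem det_one_sub_trunc_eq_tsum (R : Finset ι) (x : ℂ) :
    (1 - x • trunc G R).det = ∑' k, (trunc G R).charpolyRev.coeff k * x ^ k := by
  rw [← eval_charpolyRev_eq, Polynomial.eval_eq_sum_range, tsum_eq_sum]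
  intro k hk
  rw [Polynomial.coeff_eq_zero_of_natDegree_lt, zero_mul]
  simpa [Nat.lt_succ_iff] using hk

theorem summable_newtonSeq_mul_pow (hG : AbsSummable G) (x : ℂ) :
    Summable fun k => newtonSeq (trPow G) k * x ^ k := by
  have hρ : 0 < ‖x‖ + 1 := by positivity
  refine Summable.of_norm_bounded
    (g := fun k => Real.exp (2 * (‖x‖ + 1) * ∑' n, rowNorm G n) * (1 / 2) ^ k)
    ((summable_geometric_of_lt_one (by norm_num) (by norm_num)).mul_left _) fun k => ?_
  rw [norm_mul, norm_pow]
  refine le_trans ?_ (div_pow_mul_pow_le (by positivity) hρ (norm_nonneg x) (by linarith) k)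
  exact mul_le_mul_of_nonneg_right (norm_newtonSeq_trPow_le hG (by positivity) k) (by positivity)

/-- The Fredholm determinant is the locally uniform limit of finite determinants. -/
theorem eventually_norm_det_sub_fredF_le (hG : AbsSummable G) {ρ ε : ℝ} (hρ : 0 < ρ)
    (hε : 0 < ε) :
    ∀ᶠ R : Finset ι in atTop, ∀ x : ℂ, ‖x‖ ≤ ρ →
      ‖(1 - x • trunc G R).det - fredF G x‖ ≤ ε := by
  set C := Real.exp (2 * ρ * ∑' n, rowNorm G n) with hC
  have hgeo : Summable fun k : ℕ => 2 * C * (1 / 2 : ℝ) ^ k :=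
    (summable_geometric_of_lt_one (by norm_num) (by norm_num)).mul_left _
  have hb : ∀ (R : Finset ι) (k : ℕ), ‖(trunc G R).charpolyRev.coeff k -
      newtonSeq (trPow G) k‖ * ρ ^ k ≤ 2 * C * (1 / 2) ^ k := by
    intro R k
    have h1 := norm_coeff_charpolyRev_trunc_le hG R (r := 2 * ρ) (by positivity) k
    have h2 := norm_newtonSeq_trPow_le hG (r := 2 * ρ) (by positivity) k
    have h3 := div_pow_mul_pow_le (C := 2 * C) (by positivity) hρ hρ.le le_rfl k
    refine le_trans ?_ h3
    refine mul_le_mul_of_nonneg_right ((norm_sub_le _ _).trans ((add_le_add h1 h2).trans ?_))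
      (by positivity)
    rw [← hC]; apply le_of_eq; ring
  have hlim : Tendsto (fun R : Finset ι => ∑' k, ‖(trunc G R).charpolyRev.coeff k -
      newtonSeq (trPow G) k‖ * ρ ^ k) atTop (𝓝 0) := by
    have := tendsto_tsum_of_dominated_convergence (𝓕 := (atTop : Filter (Finset ι)))
      (f := fun R k => ‖(trunc G R).charpolyRev.coeff k - newtonSeq (trPow G) k‖ * ρ ^ k)
      (g := fun _ => (0 : ℝ)) hgeo (fun k => ?_)
      (Eventually.of_forall fun R k => ?_)
    · simpa using this
    · have := ((tendsto_coeff_charpolyRev_trunc hG k).sub_const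
        (newtonSeq (trPow G) k)).norm.mul_const (ρ ^ k)
      simpa using this
    · rw [Real.norm_of_nonneg (by positivity)]; exact hb R k
  filter_upwards [hlim.eventually_le_const hε] with R hR x hx
  refine le_trans ?_ hR
  have hs2 := summable_newtonSeq_mul_pow hG x
  have hs1 : Summable fun k => (trunc G R).charpolyRev.coeff k * x ^ k := by
    refine summable_of_ne_finset_zero (s := Finset.range ((trunc G R).charpolyRev.natDegree + 1))
      fun k hk => ?_
    rw [Polynomial.coeff_eq_zero_of_natDegree_lt, zero_mul]
    simpa [Nat.lt_succ_iff] using hk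
  rw [det_one_sub_trunc_eq_tsum, fredF, ← hs1.tsum_sub hs2]
  refine tsum_of_norm_bounded
    (hgeo.of_nonneg_of_le (fun k => by positivity) (hb R)).hasSum fun k => ?_
  rw [← sub_mul, norm_mul, norm_pow]
  gcongr

theorem tendsto_det_fredF (hG : AbsSummable G) (x : ℂ) :
    Tendsto (fun R : Finset ι => (1 - x • trunc G R).det) atTop (𝓝 (fredF G x)) := by
  rw [Metric.tendsto_nhds]
  intro ε hε
  filter_upwards [eventually_norm_det_sub_fredF_le hG (ρ := ‖x‖ + 1) (by positivity)
    (half_pos hε)] with R hR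
  rw [dist_eq_norm]
  linarith [hR x (by linarith)]

theorem differentiable_det_one_sub_trunc (R : Finset ι) :
    Differentiable ℂ fun x : ℂ => (1 - x • trunc G R).det := by
  simp only [← eval_charpolyRev_eq]
  exact Polynomial.differentiable _

theorem differentiable_fredF (hG : AbsSummable G) : Differentiable ℂ (fredF G) := by
  rw [← differentiableOn_univ]
  refine TendstoLocallyUniformlyOn.differentiableOn (φ := (atTop : Filter (Finset ι)))
    (F := fun R x => (1 - x • trunc G R).det) ?_
    (Eventually.of_forall fun R => (differentiable_det_one_sub_trunc R).differentiableOn)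
    isOpen_univ
  rw [Metric.tendstoLocallyUniformlyOn_iff]
  intro ε hε x _
  refine ⟨Metric.ball 0 (‖x‖ + 1), mem_nhdsWithin_of_mem_nhds
    (Metric.isOpen_ball.mem_nhds (by simp)), ?_⟩
  filter_upwards [eventually_norm_det_sub_fredF_le hG (ρ := ‖x‖ + 1) (by positivity)
    (half_pos hε)] with R hR y hy
  rw [dist_comm, dist_eq_norm]
  have := hR y (by simpa using (Metric.mem_ball.1 hy).le)
  linarith

theorem newtonSeq_zero_eq_one (s : ℕ → ℂ) : newtonSeq s 0 = 1 := by
  rw [newtonSeq]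

theorem fredF_zero (G : ι → ι → ℂ) : fredF G 0 = 1 := by
  rw [fredF, tsum_eq_single 0]
  · simp [newtonSeq_zero_eq_one]
  · intro k hk; simp [hk]

theorem newtonSeq_eq_zero_of_forall {s : ℕ → ℂ} (h : ∀ l, s (l + 1) = 0) (k : ℕ) :
    newtonSeq s (k + 1) = 0 := by
  rw [newtonSeq_succ, Finset.sum_eq_zero, neg_zero, zero_div]
  intro i hi
  have hi := Finset.mem_range.1 hi
  rw [show k + 1 - i = k - i + 1 by omega, h, zero_mul]

theorem fredF_eq_one_of_trPow_eq_zero (h : ∀ l, trPow G (l + 1) = 0) (x : ℂ) :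
    fredF G x = 1 := by
  rw [fredF, tsum_eq_single 0]
  · simp [newtonSeq_zero_eq_one]
  · intro k hk
    obtain ⟨k, rfl⟩ := Nat.exists_eq_succ_of_ne_zero hk
    simp [newtonSeq_eq_zero_of_forall h]

theorem newtonSeq_eq_coeff_of_fredF_eq (hG : AbsSummable G) {P : Polynomial ℂ}
    (hP : ∀ x, fredF G x = P.eval x) (k : ℕ) : newtonSeq (trPow G) k = P.coeff k := by
  have h1 := (tendsto_coeff_charpolyRev_trunc hG k).sub_const (P.coeff k)
  have h2 : Tendsto (fun R : Finset ι => (trunc G R).charpolyRev.coeff k - P.coeff k) atTop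
      (𝓝 0) := by
    rw [Metric.tendsto_nhds]
    intro ε hε
    filter_upwards [eventually_norm_det_sub_fredF_le hG (ρ := 1) one_pos (half_pos hε)] with R hR
    rw [dist_zero_right, ← Polynomial.coeff_sub]
    have := norm_polynomial_coeff_le_of_sphere ((trunc G R).charpolyRev - P) one_pos
      (C := ε / 2) (fun x hx => ?_) k
    · rw [one_pow, div_one] at this; linarith
    · rw [Polynomial.eval_sub, ← hP, eval_charpolyRev_eq]
      exact hR x hx.le
  exact sub_eq_zero.1 (tendsto_nhds_unique h1 h2)

theorem tendsto_finset_product_atTop :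
    Tendsto (fun R : Finset ι => R ×ˢ R) atTop atTop := by
  refine tendsto_atTop.2 fun S => ?_
  filter_upwards [eventually_ge_atTop (S.image Prod.fst ∪ S.image Prod.snd)] with R hR p hp
  rw [Finset.mem_product]
  exact ⟨hR (Finset.mem_union_left _ (Finset.mem_image_of_mem _ hp)),
    hR (Finset.mem_union_right _ (Finset.mem_image_of_mem _ hp))⟩

theorem norm_adjugate_one_sub_trunc_le (hG : AbsSummable G) (R : Finset ι) (x : ℂ) (i j : R) :
    ‖(1 - x • trunc G R).adjugate i j‖ ≤ Real.exp (‖x‖ * ∑' n, rowNorm G n) := by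
  rw [Matrix.adjugate_apply]
  refine (norm_det_le_prod _).trans (le_trans ?_ (prod_one_add_rowNorm_le hG R (norm_nonneg x)))
  rw [← Finset.prod_coe_sort R]
  refine Finset.prod_le_prod (fun _ _ => Finset.sum_nonneg fun _ _ => norm_nonneg _)
    fun k _ => ?_
  rcases eq_or_ne k j with rfl | hk
  · simp only [Matrix.updateRow_self]
    rw [Finset.sum_eq_single i]
    · have := rowNorm_nonneg G k
      simp only [Pi.single_eq_same, norm_one, le_add_iff_nonneg_right]
      positivity
    · intro m _ hm; simp [hm]
    · simp
  · simp only [Matrix.updateRow_ne hk]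
    exact sum_norm_one_sub_trunc_le hG R x k

/-- The Fredholm determinant vanishes at reciprocal eigenvalues. -/
theorem fredF_eq_zero_of_isEig (hG : AbsSummable G) {x : ℂ} (hx : IsEig G x) :
    fredF G x = 0 := by
  obtain ⟨v, hv0, ⟨B, hB⟩, hv⟩ := hx
  obtain ⟨n, hn⟩ := Function.ne_iff.1 hv0
  have hB0 : 0 ≤ B := (norm_nonneg _).trans (hB n)
  have hsum : ∀ j, Summable fun m => G j m * v m := fun j =>
    Summable.of_norm_bounded ((hG.row j).mul_right B) fun m => by
      rw [norm_mul]; exact mul_le_mul_of_nonneg_left (hB m) (norm_nonneg _)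
  set C := Real.exp (‖x‖ * ∑' n, rowNorm G n) with hC
  have hW : ∑' n, rowNorm G n = ∑' p : ι × ι, ‖G p.1 p.2‖ :=
    (Summable.tsum_prod hG).symm
  have hbound : ∀ R : Finset ι, n ∈ R → ‖(1 - x • trunc G R).det * v n‖ ≤
      C * (‖x‖ * B * (∑' p : ι × ι, ‖G p.1 p.2‖ - ∑ p ∈ R ×ˢ R, ‖G p.1 p.2‖)) := by
    intro R hnR
    set M := 1 - x • trunc G R with hM
    set w : R → ℂ := fun i => v i with hw
    have hr : ∀ j : R, ‖(M.mulVec w) j‖ ≤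
        ‖x‖ * B * (rowNorm G j - ∑ m ∈ R, ‖G j m‖) := by
      intro j
      have e1 : (M.mulVec w) j = x * (∑' m, G j m * v m - ∑ m ∈ R, G j m * v m) := by
        rw [mul_sub, ← hv j, hM, Matrix.sub_mulVec, Matrix.one_mulVec, Matrix.smul_mulVec,
          Pi.sub_apply, Pi.smul_apply, Matrix.mulVec, dotProduct, smul_eq_mul,
          ← Finset.sum_coe_sort R]
        rfl
      have e2 := (hsum j).sum_add_tsum_subtype_compl R
      have e3 := (hG.row j).sum_add_tsum_subtype_compl R
      rw [e1, ← e2, add_sub_cancel_left, rowNorm, ← e3, add_sub_cancel_left, norm_mul, mul_assoc]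
      refine mul_le_mul_of_nonneg_left ?_ (norm_nonneg _)
      rw [mul_comm, ← tsum_mul_right]
      refine tsum_of_norm_bounded (((hG.row j).subtype _).mul_right B).hasSum fun m => ?_
      rw [norm_mul]; exact mul_le_mul_of_nonneg_left (hB m) (norm_nonneg _)
    have e4 : M.det * v n = ∑ j, M.adjugate ⟨n, hnR⟩ j * (M.mulVec w) j := by
      have : (M.adjugate.mulVec (M.mulVec w)) ⟨n, hnR⟩ = M.det * v n := by
        rw [Matrix.mulVec_mulVec, Matrix.adjugate_mul, Matrix.smul_mulVec, Matrix.one_mulVec]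
        rfl
      rw [← this]; rfl
    rw [e4]
    calc _ ≤ ∑ j : R, C * (‖x‖ * B * (rowNorm G j - ∑ m ∈ R, ‖G j m‖)) := by
          refine (norm_sum_le _ _).trans (Finset.sum_le_sum fun j _ => ?_)
          rw [norm_mul]
          exact mul_le_mul (norm_adjugate_one_sub_trunc_le hG R x _ _) (hr j) (norm_nonneg _)
            (Real.exp_pos _).le
      _ = C * (‖x‖ * B * (∑ j ∈ R, rowNorm G j - ∑ p ∈ R ×ˢ R, ‖G p.1 p.2‖)) := by
          rw [Finset.sum_product, ← Finset.sum_sub_distrib, Finset.mul_sum, Finset.mul_sum,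
            ← Finset.sum_coe_sort R]
      _ ≤ _ := by
          have : ∑ j ∈ R, rowNorm G j ≤ ∑' p : ι × ι, ‖G p.1 p.2‖ := by
            rw [← hW]; exact hG.rowNorm.sum_le_tsum _ fun _ _ => rowNorm_nonneg G _
          gcongr
  have hlim : Tendsto (fun R : Finset ι =>
      C * (‖x‖ * B * (∑' p : ι × ι, ‖G p.1 p.2‖ - ∑ p ∈ R ×ˢ R, ‖G p.1 p.2‖))) atTop (𝓝 0) := by
    have h1 : Tendsto (fun R : Finset ι => ∑ p ∈ R ×ˢ R, ‖G p.1 p.2‖) atTop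
        (𝓝 (∑' p : ι × ι, ‖G p.1 p.2‖)) :=
      (show Summable fun p : ι × ι => ‖G p.1 p.2‖ from hG).hasSum.comp
        tendsto_finset_product_atTop
    have := ((h1.const_sub (∑' p : ι × ι, ‖G p.1 p.2‖)).const_mul (‖x‖ * B)).const_mul C
    simpa using this
  have h0 : Tendsto (fun R : Finset ι => (1 - x • trunc G R).det * v n) atTop (𝓝 0) := by
    refine squeeze_zero_norm' ?_ hlim
    filter_upwards [eventually_ge_atTop {n}] with R hR
    exact hbound R (hR (Finset.mem_singleton_self n))
  have := tendsto_nhds_unique ((tendsto_det_fredF hG x).mul_const (v n)) h0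
  exact (mul_eq_zero.1 this).resolve_right hn

end

section

open Filter Topology

variable {ι : Type*} [DecidableEq ι] {G : ι → ι → ℂ}

theorem apply_eq_of_mulVec_eq_zero {G : ι → ι → ℂ} (R : Finset ι) {x : ℂ}
    {w : R → ℂ} (hw : (1 - x • trunc G R).mulVec w = 0) (i : R) :
    w i = x * ∑ m : R, G i m * w m := by
  have := congrFun hw i
  rw [Matrix.sub_mulVec, Matrix.one_mulVec, Matrix.smul_mulVec, Pi.sub_apply, Pi.smul_apply,
    Matrix.mulVec, dotProduct, smul_eq_mul, Pi.zero_apply, sub_eq_zero] at this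
  exact this

/-- A singular finite section has a normalized null vector, extended by zero. -/
theorem exists_null_vector (hG : AbsSummable G) (R : Finset ι) {x : ℂ} {X : ℝ} (hX : ‖x‖ ≤ X)
    (hdet : (1 - x • trunc G R).det = 0) :
    ∃ v : ι → ℂ, (∀ n, ‖v n‖ ≤ 1) ∧ (∀ n ∉ R, v n = 0) ∧
      (∀ n ∈ R, v n = x * ∑' m, G n m * v m) ∧ ∃ n, 1 ≤ X * rowNorm G n ∧ ‖v n‖ = 1 := by
  obtain ⟨w, hw0, hw⟩ := Matrix.exists_mulVec_eq_zero_iff.2 hdet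
  obtain ⟨j, hj⟩ := Function.ne_iff.1 hw0
  have : Nonempty R := ⟨j⟩
  obtain ⟨i, hi⟩ := Finite.exists_max fun i => ‖w i‖
  have hi0 : 0 < ‖w i‖ := (norm_pos_iff.2 hj).trans_le (hi j)
  set v : ι → ℂ := fun n => if h : n ∈ R then w ⟨n, h⟩ / ‖w i‖ else 0 with hv
  have hv1 : ∀ n, ‖v n‖ ≤ 1 := by
    intro n
    by_cases h : n ∈ R
    · simp only [hv, h, dite_true, norm_div, Complex.norm_real, norm_norm]
      exact (div_le_one hi0).2 (hi _)
    · simp [hv, h]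
  have hveq : ∀ n ∈ R, v n = x * ∑' m, G n m * v m := by
    intro n hn
    rw [tsum_eq_sum (s := R) fun m hm => by simp [hv, hm], ← Finset.sum_coe_sort R]
    simp only [hv, hn, dite_true, Finset.coe_mem]
    rw [apply_eq_of_mulVec_eq_zero R hw ⟨n, hn⟩, mul_div_assoc, Finset.sum_div]
    simp only [mul_div_assoc]
  have hvi : ‖v i‖ = 1 := by
    simp only [hv, Finset.coe_mem, dite_true, norm_div, Complex.norm_real, norm_norm]
    exact div_self hi0.ne'
  refine ⟨v, hv1, fun n hn => by simp [hv, hn], hveq, i, ?_, hvi⟩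
  rw [← hvi, hveq i i.2, norm_mul]
  refine mul_le_mul hX ?_ (norm_nonneg _) ((norm_nonneg _).trans hX)
  refine tsum_of_norm_bounded (hG.row i).hasSum fun m => ?_
  rw [norm_mul]
  exact mul_le_of_le_one_right (norm_nonneg _) (hv1 m)

theorem exists_sphere_ne_zero {F : ℂ → ℂ} (hF : Differentiable ℂ F) (hF0 : F ≠ 0) (x₀ : ℂ) {r : ℝ}
    (hr : 0 < r) : ∃ s, 0 < s ∧ s ≤ r ∧ ∀ x ∈ Metric.sphere x₀ s, F x ≠ 0 := by
  have ha : AnalyticOnNhd ℂ F Set.univ := fun x _ => hF.analyticAt x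
  rcases (hF.analyticAt x₀).eventually_eq_zero_or_eventually_ne_zero with h | h
  · refine absurd ?_ hF0
    have := ha.eqOn_zero_of_preconnected_of_eventuallyEq_zero isPreconnected_univ
      (Set.mem_univ x₀) h
    funext x; exact this (Set.mem_univ x)
  · rw [eventually_nhdsWithin_iff, Metric.eventually_nhds_iff] at h
    obtain ⟨ε, hε, h⟩ := h
    refine ⟨min r (ε / 2), by positivity, min_le_left _ _, fun x hx => ?_⟩
    have hx' : dist x x₀ = min r (ε / 2) := hx
    refine h (by rw [hx']; exact (min_le_right _ _).trans_lt (by linarith)) ?_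
    intro hxx
    rw [Set.mem_singleton_iff.1 hxx, dist_self] at hx'
    have : 0 < min r (ε / 2) := by positivity
    linarith

/-- Zeros of the Fredholm determinant are approximated by zeros of finite determinants. -/
theorem eventually_exists_det_eq_zero (hG : AbsSummable G) {x₀ : ℂ} (h0 : fredF G x₀ = 0) {r : ℝ}
    (hr : 0 < r) :
    ∀ᶠ R : Finset ι in atTop, ∃ x ∈ Metric.closedBall x₀ r, (1 - x • trunc G R).det = 0 := by
  have hF0 : fredF G ≠ 0 := fun h => by
    have := congrFun h 0; rw [fredF_zero] at this; exact one_ne_zero this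
  obtain ⟨s, hs, hsr, hne⟩ := exists_sphere_ne_zero (differentiable_fredF hG) hF0 x₀ hr
  have hcont : Continuous fun x => ‖fredF G x‖ := (differentiable_fredF hG).continuous.norm
  obtain ⟨y, hy, hmin⟩ := (isCompact_sphere x₀ s).exists_isMinOn
    (NormedSpace.sphere_nonempty.2 hs.le) hcont.continuousOn
  have hm : 0 < ‖fredF G y‖ := norm_pos_iff.2 (hne y hy)
  filter_upwards [eventually_norm_det_sub_fredF_le hG (ρ := ‖x₀‖ + s) (by positivity)
    (ε := ‖fredF G y‖ / 3) (by positivity)] with R hR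
  by_contra! hcon
  have hball : ∀ x ∈ Metric.closedBall x₀ s, (1 - x • trunc G R).det ≠ 0 := fun x hx =>
    hcon x (Metric.closedBall_subset_closedBall hsr hx)
  have hball' : ∀ x ∈ Metric.closedBall x₀ s, ‖x‖ ≤ ‖x₀‖ + s := fun x hx => by
    have h1 : ‖x - x₀‖ ≤ s := by rw [← dist_eq_norm]; exact hx
    have h2 := norm_le_insert' x x₀
    linarith
  have hd : DiffContOnCl ℂ (fun x : ℂ => ((1 - x • trunc G R).det)⁻¹) (Metric.ball x₀ s) := by
    refine DifferentiableOn.diffContOnCl ?_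
    rw [closure_ball x₀ hs.ne']
    exact (differentiable_det_one_sub_trunc R).differentiableOn.inv hball
  have hmax := Complex.norm_le_of_forall_mem_frontier_norm_le Metric.isBounded_ball hd
    (C := (‖fredF G y‖ * (2 / 3))⁻¹) (fun x hx => ?_)
    (subset_closure (Metric.mem_ball_self hs))
  · have h1 := hR x₀ (by linarith)
    rw [h0, sub_zero] at h1
    rw [norm_inv] at hmax
    have h2 : 0 < ‖(1 - x₀ • trunc G R).det‖ :=
      norm_pos_iff.2 (hball x₀ (Metric.mem_closedBall_self hs.le))
    have h3 := (inv_le_inv₀ h2 (by positivity)).1 hmax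
    linarith
  · rw [frontier_ball x₀ hs.ne'] at hx
    rw [norm_inv]
    have h1 := hR x (hball' x (Metric.sphere_subset_closedBall hx))
    have h2 : ‖fredF G y‖ ≤ ‖fredF G x‖ := hmin hx
    have h3 := norm_sub_norm_le (fredF G x) ((1 - x • trunc G R).det)
    rw [norm_sub_rev] at h3
    exact inv_anti₀ (by positivity) (by linarith)

theorem exists_isEig_mem_closedBall (hG : AbsSummable G) {x₀ : ℂ} (h0 : fredF G x₀ = 0) {r : ℝ}
    (hr : 0 < r) : ∃ x ∈ Metric.closedBall x₀ r, IsEig G x := by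
  set X := ‖x₀‖ + r with hX
  have hX0 : 0 < X := by positivity
  have hfin : {n | 1 ≤ X * rowNorm G n}.Finite := by
    have h1 := (hG.rowNorm.mul_left X).tendsto_cofinite_zero.eventually_lt_const
      (show (0 : ℝ) < 1 by norm_num)
    rw [eventually_cofinite] at h1
    simpa using h1
  have hball : ∀ x ∈ Metric.closedBall x₀ r, ‖x‖ ≤ X := fun x hx => by
    have h1 : ‖x - x₀‖ ≤ r := by rw [← dist_eq_norm]; exact hx
    have h2 := norm_le_insert' x x₀
    linarith
  have hev : ∀ᶠ R : Finset ι in atTop, ∃ p : ℂ × (ι → ℂ),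
      p ∈ Metric.closedBall x₀ r ×ˢ Set.univ.pi (fun _ : ι => Metric.closedBall (0 : ℂ) 1) ∧
      (∀ n ∈ R, p.2 n = p.1 * ∑' m, G n m * p.2 m) ∧ 1 ≤ ∑ n ∈ hfin.toFinset, ‖p.2 n‖ := by
    filter_upwards [eventually_exists_det_eq_zero hG h0 hr] with R ⟨x, hx, hdet⟩
    obtain ⟨v, hv1, -, hv, n, hn, hvn⟩ := exists_null_vector hG R (hball x hx) hdet
    refine ⟨(x, v), ⟨hx, fun n _ => by simpa using hv1 n⟩, hv, ?_⟩
    exact hvn.symm.le.trans (Finset.single_le_sum (f := fun n => ‖v n‖)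
      (fun _ _ => norm_nonneg _) (hfin.mem_toFinset.2 hn))
  obtain ⟨p, hp⟩ := hev.choice
  set 𝒰 : Ultrafilter (Finset ι) := Ultrafilter.of atTop with h𝒰
  have hle : (𝒰 : Filter (Finset ι)) ≤ atTop := Ultrafilter.of_le _
  have hcpt : IsCompact (Metric.closedBall x₀ r ×ˢ
      Set.univ.pi (fun _ : ι => Metric.closedBall (0 : ℂ) 1)) :=
    (isCompact_closedBall _ _).prod (isCompact_univ_pi fun _ => isCompact_closedBall _ _)
  obtain ⟨⟨x, v⟩, ⟨hx, hv⟩, hlim⟩ := hcpt.ultrafilter_le_nhds (𝒰.map p)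
    (by
      rw [le_principal_iff]
      exact hle (hp.mono fun R hR => hR.1))
  have hlim' : Tendsto p 𝒰 (𝓝 (x, v)) := hlim
  have hlx : Tendsto (fun R => (p R).1) 𝒰 (𝓝 x) := (continuous_fst.tendsto _).comp hlim'
  have hlv : ∀ n, Tendsto (fun R => (p R).2 n) 𝒰 (𝓝 (v n)) := fun n =>
    (((continuous_apply n).comp continuous_snd).tendsto (x, v)).comp hlim'
  have hv1 : ∀ n, ‖v n‖ ≤ 1 := fun n => by simpa using hv n (Set.mem_univ n)
  refine ⟨x, hx, v, ?_, ⟨1, hv1⟩, fun n => ?_⟩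
  · rintro rfl
    have h1 : Tendsto (fun R => ∑ n ∈ hfin.toFinset, ‖(p R).2 n‖) 𝒰 (𝓝 0) := by
      have := tendsto_finsetSum (hfin.toFinset) fun n _ => (hlv n).norm
      simpa using this
    have h2 : (1 : ℝ) ≤ 0 := ge_of_tendsto h1 (hle (hp.mono fun R hR => hR.2.2))
    linarith
  · have h1 : Tendsto (fun R => (p R).1 * ∑' m, G n m * (p R).2 m) 𝒰
        (𝓝 (x * ∑' m, G n m * v m)) := by
      refine hlx.mul (tendsto_tsum_of_dominated_convergence (hG.row n)
        (fun m => (hlv m).const_mul _) (hle (hp.mono fun R hR m => ?_)))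
      rw [norm_mul]
      refine mul_le_of_le_one_right (norm_nonneg _) ?_
      simpa using hR.1.2 m (Set.mem_univ m)
    refine tendsto_nhds_unique_of_eventuallyEq (hlv n) h1 (hle ?_)
    filter_upwards [hp, eventually_ge_atTop {n}] with R hR hnR
    exact hR.2.1 n (hnR (Finset.mem_singleton_self n))

theorem zeros_fredF_subset (hG : AbsSummable G) (hfin : {x | IsEig G x}.Finite) :
    {x | fredF G x = 0} ⊆ {x | IsEig G x} := by
  intro x₀ hx₀
  rw [← hfin.isClosed.closure_eq, Metric.mem_closure_iff]
  intro ε hε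
  obtain ⟨x, hx, he⟩ := exists_isEig_mem_closedBall hG hx₀ (half_pos hε)
  refine ⟨x, he, ?_⟩
  rw [dist_comm]
  exact (Metric.mem_closedBall.1 hx).trans_lt (half_lt_self hε)

/-- The Fredholm determinant is of order one and minimal type. -/
theorem fredF_growth (hG : AbsSummable G) {ε : ℝ} (hε : 0 < ε) :
    ∃ C : ℝ, ∀ x, ‖fredF G x‖ ≤ C * Real.exp (ε * ‖x‖) := by
  obtain ⟨A, hA⟩ : ∃ A : Finset ι, ∀ B : Finset ι, Disjoint B A →
      ∑ i ∈ B, rowNorm G i < ε / 2 := by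
    obtain ⟨A, hA⟩ := (summable_iff_vanishing_norm.1 hG.rowNorm) (ε / 2) (half_pos hε)
    exact ⟨A, fun B hB => (le_abs_self _).trans_lt (by simpa using hA B hB)⟩
  set δ : ℝ := ε / (2 * (A.card + 1)) with hδ
  have hδ0 : 0 < δ := by positivity
  refine ⟨∏ i ∈ A, (1 + rowNorm G i / δ), fun x => ?_⟩
  refine le_of_tendsto (tendsto_det_fredF hG x).norm ?_
  filter_upwards [eventually_ge_atTop A] with R hR
  refine (norm_det_one_sub_trunc_le hG R x).trans ?_
  rw [← Finset.prod_sdiff hR, mul_comm]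
  have hn : ∀ i, 0 ≤ ‖x‖ * rowNorm G i := fun i =>
    mul_nonneg (norm_nonneg _) (rowNorm_nonneg G i)
  have hx := norm_nonneg x
  have h1 : ∏ i ∈ A, (1 + ‖x‖ * rowNorm G i) ≤
      (∏ i ∈ A, (1 + rowNorm G i / δ)) * Real.exp (ε / 2 * ‖x‖) := by
    calc _ ≤ ∏ i ∈ A, ((1 + rowNorm G i / δ) * Real.exp (δ * ‖x‖)) := by
          refine Finset.prod_le_prod (fun i _ => by linarith [hn i]) fun i _ => ?_
          have h2 := Real.add_one_le_exp (δ * ‖x‖)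
          have h3 := rowNorm_nonneg G i
          calc 1 + ‖x‖ * rowNorm G i ≤ (1 + rowNorm G i / δ) * (δ * ‖x‖ + 1) := by
                have : (1 + rowNorm G i / δ) * (δ * ‖x‖ + 1) =
                  1 + ‖x‖ * rowNorm G i + (δ * ‖x‖ + rowNorm G i / δ) := by
                    field_simp; ring
                rw [this]
                have : 0 ≤ δ * ‖x‖ + rowNorm G i / δ := by positivity
                linarith
            _ ≤ _ := by gcongr
      _ = (∏ i ∈ A, (1 + rowNorm G i / δ)) * Real.exp (A.card * (δ * ‖x‖)) := by
          rw [Finset.prod_mul_distrib, Finset.prod_const, ← Real.exp_nat_mul]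
      _ ≤ _ := by
          refine mul_le_mul_of_nonneg_left (Real.exp_le_exp.2 ?_)
            (Finset.prod_nonneg fun i _ => by have := rowNorm_nonneg G i; positivity)
          rw [← mul_assoc]
          refine mul_le_mul_of_nonneg_right ?_ hx
          rw [hδ, mul_div_assoc', div_le_div_iff₀ (by positivity) (by positivity)]
          nlinarith
  have h2 : ∏ i ∈ R \ A, (1 + ‖x‖ * rowNorm G i) ≤ Real.exp (ε / 2 * ‖x‖) := by
    calc _ ≤ ∏ i ∈ R \ A, Real.exp (‖x‖ * rowNorm G i) :=
          Finset.prod_le_prod (fun i _ => by linarith [hn i])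
            fun i _ => by rw [add_comm]; exact Real.add_one_le_exp _
      _ = Real.exp (‖x‖ * ∑ i ∈ R \ A, rowNorm G i) := by rw [← Real.exp_sum, Finset.mul_sum]
      _ ≤ _ := by
          rw [mul_comm]
          have := hA (R \ A) Finset.sdiff_disjoint
          gcongr
  calc _ ≤ ((∏ i ∈ A, (1 + rowNorm G i / δ)) * Real.exp (ε / 2 * ‖x‖)) *
        Real.exp (ε / 2 * ‖x‖) :=
        mul_le_mul h1 h2 (Finset.prod_nonneg fun i _ => by linarith [hn i])
          (mul_nonneg (Finset.prod_nonneg fun i _ => by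
            have := rowNorm_nonneg G i; positivity) (Real.exp_pos _).le)
    _ = _ := by
        rw [mul_assoc, ← Real.exp_add]; congr 2; ring

/-- With finitely many eigenvalues, the Fredholm determinant is a polynomial. -/
theorem newtonSeq_trPow_eventually_eq_zero (hG : AbsSummable G) (hfin : {x | IsEig G x}.Finite) :
    ∃ n, ∀ k, n < k → newtonSeq (trPow G) k = 0 := by
  have hF0 : fredF G ≠ 0 := fun h => by
    have := congrFun h 0; rw [fredF_zero] at this; exact one_ne_zero this
  obtain ⟨P, hP⟩ := exists_polynomial_of_growth (differentiable_fredF hG) hF0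
    (hfin.subset (zeros_fredF_subset hG hfin)) fun ε hε => fredF_growth hG hε
  exact ⟨P.natDegree, fun k hk => by
    rw [newtonSeq_eq_coeff_of_fredF_eq hG hP, Polynomial.coeff_eq_zero_of_natDegree_lt hk]⟩

/-- A matrix all of whose powers have trace zero has no eigenvalues. -/
theorem not_isEig_of_trPow_eq_zero (hG : AbsSummable G) (h : ∀ l, trPow G (l + 1) = 0) (x : ℂ) :
    ¬ IsEig G x := fun hx => by
  have := fredF_eq_zero_of_isEig hG hx
  rw [fredF_eq_one_of_trPow_eq_zero h] at this
  exact one_ne_zero this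

end

section

open Filter Topology

theorem omega_eq : ω = -1 / 2 + (Real.sqrt 3 / 2 : ℝ) * Complex.I := by
  have h : 2 * (Real.pi : ℂ) * Complex.I / 3 = ((2 * Real.pi / 3 : ℝ) : ℂ) * Complex.I := by
    push_cast; ring
  rw [ω, h, Complex.exp_mul_I, ← Complex.ofReal_cos, ← Complex.ofReal_sin]
  have h2 : 2 * Real.pi / 3 = Real.pi - Real.pi / 3 := by ring
  rw [h2, Real.cos_pi_sub, Real.sin_pi_sub, Real.cos_pi_div_three, Real.sin_pi_div_three]
  push_cast; ring

theorem omega_re : ω.re = -1 / 2 := by rw [omega_eq]; simp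

theorem omega_im : ω.im = Real.sqrt 3 / 2 := by rw [omega_eq]; simp

theorem omega_sq : ω ^ 2 = -1 - ω := by
  apply Complex.ext
  · rw [pow_two, Complex.mul_re, omega_re, omega_im]
    simp only [Complex.sub_re, Complex.neg_re, Complex.one_re, omega_re]
    have := Real.mul_self_sqrt (show (0 : ℝ) ≤ 3 by norm_num)
    linear_combination -this / 4
  · rw [pow_two, Complex.mul_im, omega_re, omega_im]
    simp only [Complex.sub_im, Complex.neg_im, Complex.one_im, omega_im]
    ring

theorem omega_cube : ω ^ 3 = 1 := by
  linear_combination (ω - 1) * omega_sq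

theorem omega_ne_zero : ω ≠ 0 := Complex.exp_ne_zero _

theorem omega_ne_one : ω ≠ 1 := fun h => by
  have := omega_re; rw [h] at this; norm_num at this

/-- The Eisenstein integer with coordinates `n` in the basis `1, ω`. -/
noncomputable def emb (n : ℤ × ℤ) : ℂ := n.1 + n.2 * ω

theorem emb_add (n m : ℤ × ℤ) : emb (n + m) = emb n + emb m := by
  simp only [emb, Prod.fst_add, Prod.snd_add]; push_cast; ring

theorem emb_sub (n m : ℤ × ℤ) : emb (n - m) = emb n - emb m := by
  simp only [emb, Prod.fst_sub, Prod.snd_sub]; push_cast; ring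

theorem emb_neg (n : ℤ × ℤ) : emb (-n) = -emb n := by
  simp only [emb, Prod.fst_neg, Prod.snd_neg]; push_cast; ring

theorem emb_zero : emb 0 = 0 := by simp [emb]

theorem norm_le_two_mul_norm_emb (n : ℤ × ℤ) : ‖n‖ ≤ 2 * ‖emb n‖ := by
  have h1 : ‖emb n‖ ^ 2 = (n.1 : ℝ) ^ 2 - n.1 * n.2 + (n.2 : ℝ) ^ 2 := by
    rw [← Complex.normSq_eq_norm_sq, Complex.normSq_apply]
    simp only [emb, Complex.add_re, Complex.mul_re, Complex.add_im, Complex.mul_im,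
      Complex.intCast_re, Complex.intCast_im, omega_re, omega_im]
    have := Real.mul_self_sqrt (show (0 : ℝ) ≤ 3 by norm_num)
    linear_combination (n.2 : ℝ) ^ 2 / 4 * this
  rw [Prod.norm_def, max_le_iff, Int.norm_eq_abs, Int.norm_eq_abs]
  constructor
  · refine abs_le_of_sq_le_sq ?_ (by positivity)
    rw [mul_pow, h1]
    nlinarith [sq_nonneg ((n.1 : ℝ) - 2 * n.2)]
  · refine abs_le_of_sq_le_sq ?_ (by positivity)
    rw [mul_pow, h1]
    nlinarith [sq_nonneg (2 * (n.1 : ℝ) - n.2)]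

theorem emb_injective : Function.Injective emb := by
  intro n m h
  have h1 := norm_le_two_mul_norm_emb (n - m)
  rw [emb_sub, h, sub_self, norm_zero, mul_zero] at h1
  exact sub_eq_zero.1 (norm_le_zero_iff.1 h1)

theorem emb_eq_zero {n : ℤ × ℤ} : emb n = 0 ↔ n = 0 := by
  rw [← emb_zero]; exact emb_injective.eq_iff

/-- Multiplication by `ω` in coordinates. -/
def rot : (ℤ × ℤ) ≃+ (ℤ × ℤ) where
  toFun n := (-n.2, n.1 - n.2)
  invFun n := (n.2 - n.1, -n.1)
  left_inv n := by ext <;> simp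
  right_inv n := by ext <;> simp
  map_add' n m := by ext <;> simp <;> ring

theorem emb_rot (n : ℤ × ℤ) : emb (rot n) = ω * emb n := by
  change (((-n.2 : ℤ) : ℂ)) + ((n.1 - n.2 : ℤ) : ℂ) * ω = ω * (n.1 + n.2 * ω)
  push_cast
  linear_combination -(n.2 : ℂ) * omega_sq

theorem rot_rot_rot (n : ℤ × ℤ) : rot (rot (rot n)) = n := by
  apply emb_injective
  rw [emb_rot, emb_rot, emb_rot]
  linear_combination emb n * omega_cube

theorem rot_eq_self {n : ℤ × ℤ} (h : rot n = n) : n = 0 := by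
  have h1 := emb_rot n
  rw [h] at h1
  have : (ω - 1) * emb n = 0 := by linear_combination -h1
  exact emb_eq_zero.1 ((mul_eq_zero.1 this).resolve_left (sub_ne_zero.2 omega_ne_one))

/-- The Eisenstein integers not divisible by `1 - ω`. -/
def Lset : Set (ℤ × ℤ) := {n | ¬ (3 : ℤ) ∣ n.1 + n.2}

theorem rot_mem_Lset {n : ℤ × ℤ} : rot n ∈ Lset ↔ n ∈ Lset := by
  change ¬ (3 : ℤ) ∣ -n.2 + (n.1 - n.2) ↔ ¬ (3 : ℤ) ∣ n.1 + n.2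
  omega

theorem zero_notMem_Lset : (0 : ℤ × ℤ) ∉ Lset := by simp [Lset]

/-- The points of sup norm at most `r`. -/
noncomputable def box (r : ℕ) : Finset (ℤ × ℤ) := Finset.Icc (-(r : ℤ), -(r : ℤ)) ((r : ℤ), (r : ℤ))

theorem mem_box {r : ℕ} {j : ℤ × ℤ} : j ∈ box r ↔ ‖j‖ ≤ r := by
  rw [box, Finset.mem_Icc, Prod.le_def, Prod.le_def, Prod.norm_def, max_le_iff, Int.norm_eq_abs,
    Int.norm_eq_abs, abs_le, abs_le]
  simp only [← Int.cast_natCast (R := ℝ), ← Int.cast_neg, Int.cast_le]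
  tauto

theorem finite_norm_le (r : ℝ) : {n : ℤ × ℤ | ‖n‖ ≤ r}.Finite := by
  refine (box ⌈r⌉₊).finite_toSet.subset fun n hn => ?_
  exact mem_box.2 (le_trans hn (Nat.le_ceil r))

/-- A matrix on the lattice of finite range. -/
def HasRange (M : ℤ × ℤ → ℤ × ℤ → ℂ) (r : ℕ) : Prop := ∀ n m, M n m ≠ 0 → ‖n - m‖ ≤ r

theorem HasRange.tsum_eq {M : ℤ × ℤ → ℤ × ℤ → ℂ} {r : ℕ} (hM : HasRange M r) (n : ℤ × ℤ)
    (f : ℤ × ℤ → ℂ) : ∑' k, M n k * f k = ∑ j ∈ box r, M n (n - j) * f (n - j) := by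
  rw [← (Equiv.subLeft n).tsum_eq, tsum_eq_sum (s := box r)]
  · rfl
  · intro j hj
    by_contra h
    refine hj (mem_box.2 ?_)
    have := hM n _ (left_ne_zero_of_mul h)
    simpa using this

theorem HasRange.powEntry_succ {M : ℤ × ℤ → ℤ × ℤ → ℂ} {r : ℕ} (hM : HasRange M r) (l : ℕ)
    (n m : ℤ × ℤ) : powEntry M (l + 1) n m = ∑ j ∈ box r, M n (n - j) * powEntry M l (n - j) m := by
  rw [powEntry, hM.tsum_eq n fun k => powEntry M l k m]

theorem HasRange.powEntry {M : ℤ × ℤ → ℤ × ℤ → ℂ} {r : ℕ} (hM : HasRange M r) (l : ℕ) :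
    HasRange (powEntry M l) (l * r) := by
  induction l with
  | zero =>
    intro n m h
    have : n = m := by by_contra h'; exact h (by simp [TBG.powEntry, h'])
    simp [this]
  | succ l ih =>
    intro n m h
    rw [hM.powEntry_succ] at h
    obtain ⟨j, hj, h⟩ := Finset.exists_ne_zero_of_sum_ne_zero h
    have h1 := ih _ _ (right_ne_zero_of_mul h)
    have h2 := mem_box.1 hj
    have : n - m = j + (n - j - m) := by abel
    rw [this]
    refine (norm_add_le _ _).trans ?_
    push_cast at h1 ⊢
    linarith

theorem HasRange.powEntry_add {M : ℤ × ℤ → ℤ × ℤ → ℂ} {r : ℕ} (hM : HasRange M r) (a b : ℕ)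
    (n m : ℤ × ℤ) :
    TBG.powEntry M (a + b) n m = ∑' k, TBG.powEntry M a n k * TBG.powEntry M b k m := by
  induction a generalizing n with
  | zero =>
    rw [zero_add, tsum_eq_single n]
    · simp [TBG.powEntry]
    · intro k hk; simp [TBG.powEntry, hk.symm]
  | succ a ih =>
    rw [Nat.succ_add, hM.powEntry_succ]
    simp only [ih]
    have hs : ∀ n', Summable fun k => TBG.powEntry M a n' k * TBG.powEntry M b k m := by
      intro n'
      refine summable_of_hasFiniteSupport (((finite_norm_le (a * r : ℕ)).image
        fun j => n' - j).subset fun k hk => ?_)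
      refine ⟨n' - k, hM.powEntry a _ _ (left_ne_zero_of_mul hk), by simp⟩
    simp only [← tsum_mul_left]
    rw [← Summable.tsum_finsetSum fun j _ => (hs _).mul_left _]
    refine tsum_congr fun k => ?_
    rw [hM.powEntry_succ, Finset.sum_mul]
    exact Finset.sum_congr rfl fun j _ => (mul_assoc _ _ _).symm

theorem HasRange.powEntry_powEntry {M : ℤ × ℤ → ℤ × ℤ → ℂ} {r : ℕ} (hM : HasRange M r) (a l : ℕ)
    (n m : ℤ × ℤ) : TBG.powEntry (TBG.powEntry M a) l n m = TBG.powEntry M (a * l) n m := by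
  induction l generalizing n with
  | zero => rfl
  | succ l ih =>
    rw [TBG.powEntry, mul_add, mul_one, add_comm, hM.powEntry_add]
    simp only [ih]

theorem exists_powEntry_bound (D : ℝ) (hD : 0 ≤ D) (r l : ℕ) :
    ∃ C, 0 ≤ C ∧ ∀ M : ℤ × ℤ → ℤ × ℤ → ℂ, HasRange M r →
      (∀ n m, ‖M n m‖ ≤ D / (1 + ‖n‖)) → ∀ n m, ‖powEntry M l n m‖ ≤ C / (1 + ‖n‖) ^ l := by
  induction l with
  | zero =>
    refine ⟨1, zero_le_one, fun M _ _ n m => ?_⟩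
    simp only [powEntry, pow_zero, div_one]
    split_ifs <;> simp
  | succ l ih =>
    obtain ⟨C, hC, h⟩ := ih
    refine ⟨(box r).card * (D * (C * (1 + r) ^ l)), by positivity, fun M hM hd n m => ?_⟩
    rw [hM.powEntry_succ]
    have : ∀ j ∈ box r, ‖M n (n - j) * powEntry M l (n - j) m‖ ≤
        D * (C * (1 + r) ^ l) / (1 + ‖n‖) ^ (l + 1) := by
      intro j hj
      have hj := mem_box.1 hj
      rw [norm_mul]
      have h1 : 1 + ‖n‖ ≤ (1 + r) * (1 + ‖n - j‖) := by
        have h2 : ‖n‖ ≤ ‖n - j‖ + ‖j‖ := by simpa using norm_add_le (n - j) j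
        nlinarith [norm_nonneg (n - j), Nat.cast_nonneg (α := ℝ) r]
      have h3 : C / (1 + ‖n - j‖) ^ l ≤ C * (1 + r) ^ l / (1 + ‖n‖) ^ l := by
        rw [div_le_div_iff₀ (by positivity) (by positivity), mul_assoc, ← mul_pow]
        gcongr
      calc ‖M n (n - j)‖ * ‖powEntry M l (n - j) m‖
          ≤ D / (1 + ‖n‖) * (C * (1 + r) ^ l / (1 + ‖n‖) ^ l) :=
            mul_le_mul (hd _ _) ((h M hM hd _ _).trans h3) (norm_nonneg _) (by positivity)
        _ = _ := by rw [pow_succ]; field_simp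
    refine (norm_sum_le_of_le _ this).trans (le_of_eq ?_)
    rw [Finset.sum_const, nsmul_eq_mul]
    ring

theorem summable_one_add_abs_sq : Summable fun n : ℤ => 1 / (1 + |(n : ℝ)|) ^ 2 := by
  have h := (Real.summable_one_div_int_pow (p := 2)).2 one_lt_two
  refine Summable.of_norm_bounded_eventually (g := fun n : ℤ => 1 / (n : ℝ) ^ 2) h ?_
  rw [eventually_cofinite]
  refine (Set.finite_singleton (0 : ℤ)).subset fun n hn => ?_
  by_contra h0
  refine hn ?_
  have : (0 : ℝ) < |(n : ℝ)| := abs_pos.2 (Int.cast_ne_zero.2 h0)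
  rw [Real.norm_of_nonneg (by positivity), ← sq_abs (n : ℝ)]
  gcongr
  linarith

theorem summable_one_add_norm_pow_four :
    Summable fun n : ℤ × ℤ => 1 / (1 + ‖n‖) ^ 4 := by
  refine Summable.of_nonneg_of_le (fun n => by positivity) (fun n => ?_)
    (summable_one_add_abs_sq.mul_of_nonneg summable_one_add_abs_sq
      (fun n => by positivity) fun n => by positivity)
  have h1 : |(n.1 : ℝ)| ≤ ‖n‖ := by rw [← Int.norm_eq_abs]; exact norm_fst_le n
  have h2 : |(n.2 : ℝ)| ≤ ‖n‖ := by rw [← Int.norm_eq_abs]; exact norm_snd_le n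
  rw [div_mul_div_comm, one_mul, show 4 = 2 + 2 from rfl, pow_add]
  gcongr

theorem summable_div_one_add_norm_pow (C : ℝ) {l : ℕ} (hl : 4 ≤ l) :
    Summable fun n : ℤ × ℤ => C / (1 + ‖n‖) ^ l := by
  have : Summable fun n : ℤ × ℤ => 1 / (1 + ‖n‖) ^ l := by
    refine Summable.of_nonneg_of_le (fun n => by positivity) (fun n => ?_)
      summable_one_add_norm_pow_four
    gcongr
    linarith [norm_nonneg n]
  simpa [div_eq_mul_inv] using this.mul_left C

theorem absSummable_majorant (C : ℝ) (r : ℕ) :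
    AbsSummable fun n m : ℤ × ℤ =>
      ((if ‖n - m‖ ≤ r then C / (1 + ‖n‖) ^ 4 else 0 : ℝ) : ℂ) := by
  have h0 : ∀ n : ℤ × ℤ, ∀ b ∉ (box r).image (fun j => n - j),
      ‖((if ‖n - b‖ ≤ r then C / (1 + ‖n‖) ^ 4 else 0 : ℝ) : ℂ)‖ = 0 := by
    intro n b hb
    rw [if_neg, Complex.ofReal_zero, norm_zero]
    intro h
    exact hb (Finset.mem_image.2 ⟨n - b, mem_box.2 h, by simp⟩)
  rw [AbsSummable, summable_prod_of_nonneg fun _ => norm_nonneg _]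
  refine ⟨fun n => summable_of_ne_finset_zero (h0 n), ?_⟩
  refine Summable.of_nonneg_of_le (fun n => tsum_nonneg fun _ => norm_nonneg _) (fun n => ?_)
    (summable_div_one_add_norm_pow ((box r).card * |C|) le_rfl)
  simp only
  rw [tsum_eq_sum (h0 n)]
  have h1 : ∀ b ∈ (box r).image (fun j => n - j),
      ‖((if ‖n - b‖ ≤ r then C / (1 + ‖n‖) ^ 4 else 0 : ℝ) : ℂ)‖ ≤ |C| / (1 + ‖n‖) ^ 4 := by
    intro b _
    rw [Complex.norm_real, Real.norm_eq_abs]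
    split_ifs
    · rw [abs_div, abs_of_nonneg (show (0 : ℝ) ≤ (1 + ‖n‖) ^ 4 by positivity)]
    · rw [abs_zero]; positivity
  refine (Finset.sum_le_card_nsmul _ _ _ h1).trans ?_
  rw [nsmul_eq_mul, mul_div_assoc]
  refine mul_le_mul_of_nonneg_right ?_ (by positivity)
  exact_mod_cast Finset.card_image_le (s := box r) (f := fun j => n - j)

open Classical in
/-- The matrix of the walk on `A` with step weights `h` at quasimomentum `κ`. -/
noncomputable def walkMat (h : ℤ × ℤ → ℂ) (A : Set (ℤ × ℤ)) (κ : ℂ) (n m : ℤ × ℤ) : ℂ :=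
  if n ∈ A ∧ m ∈ A then h (n - m) / (emb n + κ) else 0

theorem walkMat_hasRange {h : ℤ × ℤ → ℂ} {r : ℕ} (hr : ∀ j, h j ≠ 0 → ‖j‖ ≤ r)
    (A : Set (ℤ × ℤ)) (κ : ℂ) : HasRange (walkMat h A κ) r := by
  intro n m hnm
  refine hr _ fun h0 => hnm ?_
  simp [walkMat, h0]

theorem one_add_norm_le {κ : ℂ} {n : ℤ × ℤ} {δ ρ : ℝ} (hδ : 0 < δ) (hκ : ‖κ‖ ≤ ρ)
    (h : δ ≤ ‖emb n + κ‖) : 1 + ‖n‖ ≤ ((1 + 2 * ρ) / δ + 2) * ‖emb n + κ‖ := by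
  have h1 := norm_le_two_mul_norm_emb n
  have h2 : ‖emb n‖ ≤ ‖emb n + κ‖ + ‖κ‖ := by simpa using norm_sub_le (emb n + κ) κ
  have h3 : 1 + 2 * ρ ≤ (1 + 2 * ρ) / δ * ‖emb n + κ‖ := by
    rw [div_mul_eq_mul_div, le_div_iff₀ hδ]
    have := norm_nonneg κ
    gcongr
    linarith
  linarith

theorem norm_walkMat_le {h : ℤ × ℤ → ℂ} {H : ℝ} (hH : ∀ j, ‖h j‖ ≤ H) {A : Set (ℤ × ℤ)} {κ : ℂ}
    {δ ρ : ℝ} (hδ : 0 < δ) (hκ : ‖κ‖ ≤ ρ) (hA : ∀ n ∈ A, δ ≤ ‖emb n + κ‖) (n m : ℤ × ℤ) :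
    ‖walkMat h A κ n m‖ ≤ H * ((1 + 2 * ρ) / δ + 2) / (1 + ‖n‖) := by
  have hH0 : 0 ≤ H := (norm_nonneg _).trans (hH 0)
  have hρ : 0 ≤ ρ := (norm_nonneg _).trans hκ
  rw [walkMat]
  split_ifs with hnm
  · have h1 := one_add_norm_le hδ hκ (hA n hnm.1)
    have h2 := hδ.trans_le (hA n hnm.1)
    rw [norm_div, div_le_div_iff₀ h2 (by positivity), mul_assoc]
    exact mul_le_mul (hH _) h1 (by positivity) hH0
  · rw [norm_zero]; positivity

theorem exists_gap (A : Set (ℤ × ℤ)) {κ : ℂ} (hκ : ∀ n ∈ A, emb n + κ ≠ 0) :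
    ∃ δ > 0, ∀ n ∈ A, δ ≤ ‖emb n + κ‖ := by
  have hfin : {n : ℤ × ℤ | n ∈ A ∧ ‖emb n + κ‖ < 1}.Finite := by
    refine (finite_norm_le (2 * (1 + ‖κ‖))).subset fun n hn => ?_
    have h1 := norm_le_two_mul_norm_emb n
    have h2 : ‖emb n‖ ≤ ‖emb n + κ‖ + ‖κ‖ := by simpa using norm_sub_le (emb n + κ) κ
    have := hn.2
    simp only [Set.mem_ofPred_eq]
    linarith
  rcases hfin.toFinset.eq_empty_or_nonempty with he | hne
  · refine ⟨1, one_pos, fun n hn => ?_⟩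
    by_contra! hlt
    have : n ∈ hfin.toFinset := hfin.mem_toFinset.2 ⟨hn, hlt⟩
    rw [he] at this
    simp at this
  · obtain ⟨p, hp, hmin⟩ := hfin.toFinset.exists_min_image (fun n => ‖emb n + κ‖) hne
    have hp' := hfin.mem_toFinset.1 hp
    refine ⟨‖emb p + κ‖, norm_pos_iff.2 (hκ p hp'.1), fun n hn => ?_⟩
    rcases lt_or_ge ‖emb n + κ‖ 1 with h1 | h1
    · exact hmin n (hfin.mem_toFinset.2 ⟨hn, h1⟩)
    · exact hp'.2.le.trans h1

end

section

open Filter Topology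

variable {h : ℤ × ℤ → ℂ} {r : ℕ}

theorem exists_norm_le_of_support (hr : ∀ j, h j ≠ 0 → ‖j‖ ≤ r) : ∃ H, ∀ j, ‖h j‖ ≤ H := by
  refine ⟨∑ j ∈ box r, ‖h j‖, fun j => ?_⟩
  by_cases hj : h j = 0
  · rw [hj, norm_zero]; exact Finset.sum_nonneg fun _ _ => norm_nonneg _
  · exact Finset.single_le_sum (f := fun j => ‖h j‖) (fun _ _ => norm_nonneg _)
      (mem_box.2 (hr j hj))

/-- Uniform decay of the entries of powers of walk matrices. -/
theorem exists_walk_bound (hr : ∀ j, h j ≠ 0 → ‖j‖ ≤ r) {δ : ℝ} (hδ : 0 < δ) {ρ : ℝ}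
    (hρ : 0 ≤ ρ) (l : ℕ) :
    ∃ C, 0 ≤ C ∧ ∀ (A : Set (ℤ × ℤ)) (κ : ℂ), ‖κ‖ ≤ ρ → (∀ n ∈ A, δ ≤ ‖emb n + κ‖) →
      ∀ n m, ‖powEntry (walkMat h A κ) l n m‖ ≤ C / (1 + ‖n‖) ^ l := by
  obtain ⟨H, hH⟩ := exists_norm_le_of_support hr
  have hH0 : 0 ≤ H := (norm_nonneg _).trans (hH 0)
  obtain ⟨C, hC, hb⟩ := exists_powEntry_bound (H * ((1 + 2 * ρ) / δ + 2)) (by positivity) r l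
  exact ⟨C, hC, fun A κ hκ hA n m => hb _ (walkMat_hasRange hr A κ)
    (norm_walkMat_le hH hδ hκ hA) n m⟩

theorem exists_walkTr_bound (hr : ∀ j, h j ≠ 0 → ‖j‖ ≤ r) {δ : ℝ} (hδ : 0 < δ) {ρ : ℝ}
    (hρ : 0 ≤ ρ) {l : ℕ} (hl : 4 ≤ l) :
    ∃ C, ∀ (A : Set (ℤ × ℤ)) (κ : ℂ), ‖κ‖ ≤ ρ → (∀ n ∈ A, δ ≤ ‖emb n + κ‖) →
      ‖trPow (walkMat h A κ) l‖ ≤ C := by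
  obtain ⟨C, hC, hb⟩ := exists_walk_bound hr hδ hρ l
  exact ⟨_, fun A κ hκ hA => tsum_of_norm_bounded (summable_div_one_add_norm_pow C hl).hasSum
    fun n => hb A κ hκ hA n n⟩

theorem summable_walk (hr : ∀ j, h j ≠ 0 → ‖j‖ ≤ r) {A : Set (ℤ × ℤ)} {κ : ℂ}
    (hA : ∀ n ∈ A, emb n + κ ≠ 0) {l : ℕ} (hl : 4 ≤ l) :
    Summable fun n => powEntry (walkMat h A κ) l n n := by
  obtain ⟨δ, hδ, hδA⟩ := exists_gap A hA
  obtain ⟨C, hC, hb⟩ := exists_walk_bound hr hδ (norm_nonneg κ) l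
  exact Summable.of_norm_bounded (summable_div_one_add_norm_pow C hl)
    fun n => hb A κ le_rfl hδA n n

theorem differentiableAt_powEntry_walkMat (hr : ∀ j, h j ≠ 0 → ‖j‖ ≤ r) {A : Set (ℤ × ℤ)}
    {κ : ℂ} (hA : ∀ n ∈ A, emb n + κ ≠ 0) (l : ℕ) (n m : ℤ × ℤ) :
    DifferentiableAt ℂ (fun κ => powEntry (walkMat h A κ) l n m) κ := by
  induction l generalizing n with
  | zero => exact differentiableAt_const _
  | succ l ih =>
    simp only [(walkMat_hasRange hr A _).powEntry_succ]
    refine DifferentiableAt.fun_sum fun j _ => DifferentiableAt.mul ?_ (ih _)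
    by_cases hn : n ∈ A ∧ n - j ∈ A
    · simp only [walkMat, hn, and_self, if_true]
      exact (differentiableAt_const _).div
        ((differentiableAt_const _).add differentiableAt_id) (hA n hn.1)
    · simp only [walkMat, hn, if_false]
      exact differentiableAt_const _

theorem differentiableAt_walkTr (hr : ∀ j, h j ≠ 0 → ‖j‖ ≤ r) {A : Set (ℤ × ℤ)} {κ : ℂ}
    (hA : ∀ n ∈ A, emb n + κ ≠ 0) {l : ℕ} (hl : 4 ≤ l) :
    DifferentiableAt ℂ (fun κ => trPow (walkMat h A κ) l) κ := by
  obtain ⟨δ, hδ, hδA⟩ := exists_gap A hA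
  obtain ⟨C, hC, hb⟩ := exists_walk_bound hr (half_pos hδ)
    (show 0 ≤ ‖κ‖ + δ / 2 by positivity) l
  have hgap : ∀ κ' ∈ Metric.ball κ (δ / 2), ‖κ'‖ ≤ ‖κ‖ + δ / 2 ∧
      ∀ n ∈ A, δ / 2 ≤ ‖emb n + κ'‖ := by
    intro κ' hκ'
    rw [Metric.mem_ball, dist_eq_norm] at hκ'
    refine ⟨by linarith [norm_le_insert' κ' κ], fun n hn => ?_⟩
    have h1 := hδA n hn
    have h2 : ‖emb n + κ‖ ≤ ‖emb n + κ'‖ + ‖κ' - κ‖ := by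
      have := norm_sub_le (emb n + κ') (κ' - κ)
      rwa [show emb n + κ' - (κ' - κ) = emb n + κ by ring] at this
    linarith
  have := Complex.differentiableOn_tsum_of_summable_norm (E := ℂ)
    (F := fun n κ => powEntry (walkMat h A κ) l n n) (U := Metric.ball κ (δ / 2))
    (summable_div_one_add_norm_pow C hl) (fun n κ' hκ' =>
      (differentiableAt_powEntry_walkMat hr (fun p hp => ?_) l n n).differentiableWithinAt)
    Metric.isOpen_ball fun n κ' hκ' => hb A κ' (hgap κ' hκ').1 (hgap κ' hκ').2 n n
  · exact this.differentiableAt (Metric.isOpen_ball.mem_nhds (Metric.mem_ball_self (half_pos hδ)))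
  · exact norm_pos_iff.1 ((half_pos hδ).trans_le ((hgap κ' hκ').2 p hp))

open Classical in
theorem powEntry_walkMat_congr (hr : ∀ j, h j ≠ 0 → ‖j‖ ≤ r) {A A' : Set (ℤ × ℤ)} (κ : ℂ)
    (l : ℕ) (n m : ℤ × ℤ) (hA : ∀ p, ‖p - n‖ ≤ l * r → (p ∈ A ↔ p ∈ A')) :
    powEntry (walkMat h A κ) l n m = powEntry (walkMat h A' κ) l n m := by
  induction l generalizing n with
  | zero => rfl
  | succ l ih =>
    rw [(walkMat_hasRange hr A _).powEntry_succ, (walkMat_hasRange hr A' _).powEntry_succ]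
    refine Finset.sum_congr rfl fun j hj => ?_
    have hj := mem_box.1 hj
    have hpos : (0 : ℝ) ≤ l * r := by positivity
    rw [ih (n - j) fun p hp => hA p ?_]
    · congr 1
      have h1 := hA n (by simp; positivity)
      have h2 := hA (n - j) (by
        rw [sub_sub_cancel_left, norm_neg]; push_cast; linarith)
      exact if_congr (and_congr h1 h2) rfl rfl
    · have : p - n = p - (n - j) - j := by abel
      rw [this]
      refine (norm_sub_le _ _).trans ?_
      push_cast; linarith

open Classical in
theorem powEntry_walkMat_shift (hr : ∀ j, h j ≠ 0 → ‖j‖ ≤ r) {A : Set (ℤ × ℤ)} {q : ℤ × ℤ}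
    (hq : ∀ n, n + q ∈ A ↔ n ∈ A) (κ : ℂ) (l : ℕ) (n m : ℤ × ℤ) :
    powEntry (walkMat h A (κ + emb q)) l n m = powEntry (walkMat h A κ) l (n + q) (m + q) := by
  induction l generalizing n with
  | zero => simp [powEntry]
  | succ l ih =>
    rw [(walkMat_hasRange hr A _).powEntry_succ, (walkMat_hasRange hr A _).powEntry_succ]
    refine Finset.sum_congr rfl fun j _ => ?_
    rw [ih, show n + q - j = n - j + q by abel]
    congr 1
    rw [walkMat, walkMat, show n + q - (n - j + q) = n - (n - j) by abel, emb_add, add_assoc,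
      add_comm κ]
    exact if_congr (and_congr (hq _).symm (hq _).symm) rfl rfl

theorem walkTr_shift (hr : ∀ j, h j ≠ 0 → ‖j‖ ≤ r) {A : Set (ℤ × ℤ)} {q : ℤ × ℤ}
    (hq : ∀ n, n + q ∈ A ↔ n ∈ A) (κ : ℂ) (l : ℕ) :
    trPow (walkMat h A (κ + emb q)) l = trPow (walkMat h A κ) l := by
  simp only [trPow, powEntry_walkMat_shift hr hq]
  exact (Equiv.addRight q).tsum_eq fun n => powEntry (walkMat h A κ) l n n

theorem exists_norm_le_of_newtonSeq (C : ℝ) (l : ℕ) :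
    ∃ B, ∀ s : ℕ → ℂ, (∀ k, ‖newtonSeq s k‖ ≤ C) → ‖s (l + 1)‖ ≤ B := by
  induction l using Nat.strong_induction_on with
  | _ l ih =>
    choose! B hB using ih
    refine ⟨(l + 1) * C + ∑ i ∈ Finset.range l, |B (l - (i + 1))| * C, fun s hs => ?_⟩
    have h1 := newtonSeq_succ s l
    have hC : 0 ≤ C := (norm_nonneg _).trans (hs 0)
    have h2 : (l : ℂ) + 1 ≠ 0 := by exact_mod_cast Nat.succ_ne_zero l
    rw [Finset.sum_range_succ', newtonSeq, mul_one, Nat.sub_zero, eq_div_iff h2] at h1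
    have h3 : s (l + 1) = -(newtonSeq s (l + 1) * (l + 1)) -
        ∑ i ∈ Finset.range l, s (l + 1 - (i + 1)) * newtonSeq s (i + 1) := by
      linear_combination h1
    rw [h3]
    refine (norm_sub_le _ _).trans (add_le_add ?_ (norm_sum_le_of_le _ fun i hi => ?_))
    · rw [norm_neg, norm_mul, mul_comm]
      have : ‖(l : ℂ) + 1‖ = l + 1 := by
        rw [← Nat.cast_succ, Complex.norm_natCast, Nat.cast_succ]
      rw [this]
      exact mul_le_mul_of_nonneg_left (hs _) (by positivity)
    · have hi := Finset.mem_range.1 hi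
      rw [norm_mul, show l + 1 - (i + 1) = l - (i + 1) + 1 by omega]
      exact mul_le_mul ((hB _ (by omega) s hs).trans (le_abs_self _)) (hs _) (norm_nonneg _)
        (abs_nonneg _)

end

section

open Filter Topology

variable {h : ℤ × ℤ → ℂ} {r : ℕ}

/-- The lattice points of `Lset` in a Euclidean disc around `n₀`. -/
noncomputable def disc (n₀ : ℤ × ℤ) (q : ℝ) : Finset (ℤ × ℤ) :=
  Set.Finite.toFinset (s := {n | n ∈ Lset ∧ ‖emb (n - n₀)‖ ≤ q}) (by
    refine ((finite_norm_le (2 * q)).image fun j => j + n₀).subset fun n hn => ?_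
    refine ⟨n - n₀, ?_, by simp⟩
    have := norm_le_two_mul_norm_emb (n - n₀)
    simp only [Set.mem_ofPred_eq]
    linarith [hn.2])

theorem mem_disc {n₀ : ℤ × ℤ} {q : ℝ} {n : ℤ × ℤ} :
    n ∈ disc n₀ q ↔ n ∈ Lset ∧ ‖emb (n - n₀)‖ ≤ q := by simp [disc]

theorem norm_omega : ‖ω‖ = 1 := by
  have := congrArg norm omega_cube
  rw [norm_pow, norm_one] at this
  exact (pow_eq_one_iff_of_nonneg (norm_nonneg _) three_ne_zero).1 this

theorem norm_emb_le (n : ℤ × ℤ) : ‖emb n‖ ≤ 2 * ‖n‖ := by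
  rw [emb]
  refine (norm_add_le _ _).trans ?_
  rw [norm_mul, norm_omega, mul_one, Complex.norm_intCast, Complex.norm_intCast]
  have h1 : |(n.1 : ℝ)| ≤ ‖n‖ := by rw [← Int.norm_eq_abs]; exact norm_fst_le n
  have h2 : |(n.2 : ℝ)| ≤ ‖n‖ := by rw [← Int.norm_eq_abs]; exact norm_snd_le n
  linarith

/-- Rotation by `2π/3` around `n₀`. -/
def rotAt (n₀ n : ℤ × ℤ) : ℤ × ℤ := rot (n - n₀) + n₀

theorem rotAt_sub (n₀ n : ℤ × ℤ) : rotAt n₀ n - n₀ = rot (n - n₀) := by simp [rotAt]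

theorem rotAt_mem_disc {n₀ : ℤ × ℤ} {q : ℝ} {n : ℤ × ℤ} (hn : n ∈ disc n₀ q) :
    rotAt n₀ n ∈ disc n₀ q := by
  rw [mem_disc] at hn ⊢
  rw [rotAt_sub, emb_rot, norm_mul, norm_omega, one_mul]
  refine ⟨?_, hn.2⟩
  have := hn.1
  change ¬ (3 : ℤ) ∣ (-(n.2 - n₀.2) + n₀.1) + ((n.1 - n₀.1) - (n.2 - n₀.2) + n₀.2)
  change ¬ (3 : ℤ) ∣ n.1 + n.2 at this
  omega

theorem rotAt_iterate (n₀ n : ℤ × ℤ) : rotAt n₀ (rotAt n₀ (rotAt n₀ n)) = n := by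
  simp only [rotAt, add_sub_cancel_right, rot_rot_rot, sub_add_cancel]

/-- Rotation around the centre as a permutation of a disc. -/
noncomputable def rotDisc (n₀ : ℤ × ℤ) (q : ℝ) : disc n₀ q ≃ disc n₀ q where
  toFun n := ⟨rotAt n₀ n, rotAt_mem_disc n.2⟩
  invFun n := ⟨rotAt n₀ (rotAt n₀ n), rotAt_mem_disc (rotAt_mem_disc n.2)⟩
  left_inv n := Subtype.ext (rotAt_iterate n₀ n)
  right_inv n := Subtype.ext (rotAt_iterate n₀ n)

theorem card_disc_modEq {n₀ : ℤ × ℤ} (h0 : n₀ ∈ Lset) {q : ℝ} (hq : 0 ≤ q) :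
    (disc n₀ q).card ≡ 1 [MOD 3] := by
  set f : Function.End (disc n₀ q) := fun n => rotDisc n₀ q n with hf
  have : Fact (Nat.Prime 3) := ⟨Nat.prime_three⟩
  have hf3 : f ^ 3 ^ 1 = 1 := by
    funext n
    exact Subtype.ext (rotAt_iterate n₀ n)
  have h1 := Equiv.Perm.card_fixedPoints_modEq hf3
  rw [Fintype.card_coe] at h1
  have h2 : Fintype.card (Function.fixedPoints f) = 1 := by
    rw [Fintype.card_eq_one_iff]
    refine ⟨⟨⟨n₀, mem_disc.2 ⟨h0, by simpa [emb_zero] using hq⟩⟩, ?_⟩, ?_⟩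
    · refine Subtype.ext ?_
      change rotAt n₀ n₀ = n₀
      simp [rotAt]
    · rintro ⟨n, hn⟩
      have hn' : rotAt n₀ n = n := congrArg Subtype.val hn
      have : rot ((n : ℤ × ℤ) - n₀) = n - n₀ := by rw [← rotAt_sub, hn']
      exact Subtype.ext (Subtype.ext (sub_eq_zero.1 (rot_eq_self this)))
  rwa [h2] at h1

theorem pow_card_disc {n₀ : ℤ × ℤ} (h0 : n₀ ∈ Lset) {q : ℝ} (hq : 0 ≤ q) :
    ω ^ (disc n₀ q).card = ω := by
  have h1 := card_disc_modEq h0 hq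
  obtain ⟨k, hk⟩ : ∃ k, (disc n₀ q).card = 3 * k + 1 := by
    refine ⟨(disc n₀ q).card / 3, ?_⟩
    have : (disc n₀ q).card % 3 = 1 := h1
    omega
  rw [hk, pow_succ, pow_mul, omega_cube, one_pow, one_mul]

/-- The numerator matrix of `1 - x T` on a disc, near the pole at the centre. -/
noncomputable def discMat (h : ℤ × ℤ → ℂ) (n₀ : ℤ × ℤ) (q : ℝ) (p : ℂ × ℂ) :
    Matrix (disc n₀ q) (disc n₀ q) ℂ :=
  Matrix.diagonal (fun n : disc n₀ q => emb ((n : ℤ × ℤ) - n₀) + p.1) -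
    p.2 • Matrix.of fun n m : disc n₀ q => h ((n : ℤ × ℤ) - m)

theorem det_discMat_zero (hrot : ∀ j, h (rot j) = ω * h j) {n₀ : ℤ × ℤ} (h0 : n₀ ∈ Lset) {q : ℝ}
    (hq : 0 ≤ q) (x : ℂ) : (discMat h n₀ q (0, x)).det = 0 := by
  have h1 : (discMat h n₀ q (0, x)).submatrix (rotDisc n₀ q) (rotDisc n₀ q) =
      ω • discMat h n₀ q (0, x) := by
    ext n m
    have h2 : ((rotDisc n₀ q n : disc n₀ q) : ℤ × ℤ) - (rotDisc n₀ q m : disc n₀ q) =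
        rot ((n : ℤ × ℤ) - m) := by
      change rotAt n₀ n - rotAt n₀ m = _
      rw [rotAt, rotAt, add_sub_add_right_eq_sub, ← map_sub]; congr 1; abel
    have h3 : ((rotDisc n₀ q n : disc n₀ q) : ℤ × ℤ) - n₀ = rot ((n : ℤ × ℤ) - n₀) :=
      rotAt_sub _ _
    simp only [discMat, Matrix.submatrix_apply, Matrix.sub_apply, Matrix.smul_apply,
      Matrix.diagonal_apply, Matrix.of_apply, smul_eq_mul, add_zero, h2, h3, hrot,
      EmbeddingLike.apply_eq_iff_eq, emb_rot]
    split_ifs <;> ring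
  have h4 := Matrix.det_submatrix_equiv_self (rotDisc n₀ q) (discMat h n₀ q (0, x))
  rw [h1, Matrix.det_smul, Fintype.card_coe, pow_card_disc h0 hq] at h4
  have : (ω - 1) * (discMat h n₀ q (0, x)).det = 0 := by linear_combination h4
  exact (mul_eq_zero.1 this).resolve_left (sub_ne_zero.2 omega_ne_one)

theorem contDiff_det_discMat (n₀ : ℤ × ℤ) (q : ℝ) :
    ContDiff ℝ 1 fun p : ℂ × ℂ => (discMat h n₀ q p).det := by
  simp only [Matrix.det_apply']
  refine ContDiff.sum fun σ _ => contDiff_const.mul (contDiff_prod fun i _ => ?_)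
  simp only [discMat, Matrix.sub_apply, Matrix.smul_apply, Matrix.of_apply, smul_eq_mul]
  refine ContDiff.sub ?_ (contDiff_snd.mul contDiff_const)
  by_cases hi : σ i = i
  · simp only [hi, Matrix.diagonal_apply_eq]
    exact contDiff_const.add contDiff_fst
  · simp only [Matrix.diagonal_apply_ne _ hi]
    exact contDiff_const

theorem exists_norm_det_discMat_le (hrot : ∀ j, h (rot j) = ω * h j) {n₀ : ℤ × ℤ}
    (h0 : n₀ ∈ Lset) {q : ℝ} (hq : 0 ≤ q) :
    ∃ C : ℝ, 0 ≤ C ∧ ∀ ε x : ℂ, ‖ε‖ ≤ 1 → ‖x‖ ≤ 1 → ‖(discMat h n₀ q (ε, x)).det‖ ≤ C * ‖ε‖ := by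
  obtain ⟨C, hC⟩ := (contDiff_det_discMat (h := h) n₀ q).contDiffOn.exists_lipschitzOnWith
    one_ne_zero (convex_closedBall (0 : ℂ × ℂ) 1) (isCompact_closedBall _ _)
  refine ⟨C, C.2, fun ε x hε hx => ?_⟩
  have h1 := hC.dist_le_mul (ε, x) (by simp [Prod.norm_def, hε, hx]) (0, x)
    (by simp [Prod.norm_def, hx])
  rw [dist_eq_norm, det_discMat_zero hrot h0 hq, sub_zero, dist_eq_norm] at h1
  simpa [Prod.norm_def] using h1

theorem det_one_sub_walkMat_disc {n₀ : ℤ × ℤ} {q : ℝ} {ε : ℂ}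
    (hε : ∀ n ∈ Lset, emb n + (-emb n₀ + ε) ≠ 0) (x : ℂ) :
    (∏ n : disc n₀ q, (emb ((n : ℤ × ℤ) - n₀) + ε)) *
      (1 - x • trunc (walkMat h Lset (-emb n₀ + ε)) (disc n₀ q)).det =
      (discMat h n₀ q (ε, x)).det := by
  rw [← Matrix.det_diagonal, ← Matrix.det_mul]
  congr 1
  ext n m
  have hn := (mem_disc.1 n.2).1
  have hm := (mem_disc.1 m.2).1
  have hne := hε n hn
  have e1 : emb ((n : ℤ × ℤ) - n₀) + ε = emb n + (-emb n₀ + ε) := by rw [emb_sub]; ring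
  simp only [discMat, trunc, walkMat, Matrix.diagonal_mul, Matrix.sub_apply, Matrix.smul_apply,
    Matrix.of_apply, hn, hm, and_self, if_true, e1, smul_eq_mul]
  rcases eq_or_ne n m with rfl | hnm
  · simp only [Matrix.one_apply_eq, Matrix.diagonal_apply_eq]
    rw [e1]
    field_simp
  · simp only [Matrix.one_apply_ne hnm, Matrix.diagonal_apply_ne _ hnm]
    field_simp
    ring

theorem one_half_le_norm_emb {n : ℤ × ℤ} (hn : n ≠ 0) : 1 / 2 ≤ ‖emb n‖ := by
  have h1 := norm_le_two_mul_norm_emb n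
  have h2 : 1 ≤ ‖n‖ := by
    rw [Prod.norm_def, le_max_iff, Int.norm_eq_abs, Int.norm_eq_abs]
    rcases eq_or_ne n.1 0 with h | h
    · right
      have : n.2 ≠ 0 := fun h' => hn (Prod.ext h h')
      exact_mod_cast Int.one_le_abs this
    · left; exact_mod_cast Int.one_le_abs h
  linarith

theorem norm_emb_add_ge {n₀ n : ℤ × ℤ} (hn : n ≠ n₀) {ε : ℂ} (hε : ‖ε‖ ≤ 1 / 4) :
    1 / 4 ≤ ‖emb n + (-emb n₀ + ε)‖ := by
  have h1 := one_half_le_norm_emb (sub_ne_zero.2 hn)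
  have h2 : emb n + (-emb n₀ + ε) = emb (n - n₀) + ε := by rw [emb_sub]; ring
  have h3 := norm_sub_le (emb (n - n₀) + ε) ε
  rw [add_sub_cancel_right] at h3
  rw [h2]; linarith

theorem emb_add_ne_zero {n₀ : ℤ × ℤ} {ε : ℂ} (h0 : ε ≠ 0) (hε : ‖ε‖ ≤ 1 / 4) (n : ℤ × ℤ) :
    emb n + (-emb n₀ + ε) ≠ 0 := by
  rcases eq_or_ne n n₀ with rfl | hn
  · simpa using h0
  · exact norm_pos_iff.1 (lt_of_lt_of_le (by norm_num) (norm_emb_add_ge hn hε))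

/-- Traces of powers of finite sections centred at a pole stay bounded near the pole. -/
theorem exists_trace_disc_bound (hrot : ∀ j, h (rot j) = ω * h j) {n₀ : ℤ × ℤ} (h0 : n₀ ∈ Lset)
    {q : ℝ} (hq : 0 ≤ q) (l : ℕ) :
    ∃ B : ℝ, ∀ ε : ℂ, ε ≠ 0 → ‖ε‖ ≤ 1 / 4 →
      ‖(trunc (walkMat h Lset (-emb n₀ + ε)) (disc n₀ q) ^ (l + 1)).trace‖ ≤ B := by
  obtain ⟨C, hC, hdet⟩ := exists_norm_det_discMat_le hrot h0 hq
  set N := (disc n₀ q).card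
  obtain ⟨B, hB⟩ := exists_norm_le_of_newtonSeq (C * 4 ^ N) l
  refine ⟨B, fun ε hε0 hε => hB (fun l => (trunc (walkMat h Lset (-emb n₀ + ε))
    (disc n₀ q) ^ l).trace) fun k => ?_⟩
  rw [← coeff_charpolyRev_eq_newtonSeq]
  have h1 := norm_polynomial_coeff_le_of_sphere
    (trunc (walkMat h Lset (-emb n₀ + ε)) (disc n₀ q)).charpolyRev one_pos
    (C := C * 4 ^ N) (fun x hx => ?_) k
  · simpa using h1
  · rw [eval_charpolyRev_eq]
    have h2 := det_one_sub_walkMat_disc (h := h) (q := q)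
      (fun n _ => emb_add_ne_zero (n₀ := n₀) hε0 hε n) x
    have h3 := hdet ε x (by linarith) hx.le
    rw [← h2, norm_mul, norm_prod] at h3
    have hmem : n₀ ∈ disc n₀ q := mem_disc.2 ⟨h0, by simpa [emb_zero] using hq⟩
    have h4 : ‖ε‖ * (1 / 4) ^ N ≤ ∏ n : disc n₀ q, ‖emb ((n : ℤ × ℤ) - n₀) + ε‖ := by
      rw [Finset.prod_coe_sort (disc n₀ q) fun n => ‖emb (n - n₀) + ε‖,
        ← Finset.mul_prod_erase _ _ hmem, sub_self, emb_zero, zero_add]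
      refine mul_le_mul_of_nonneg_left ?_ (norm_nonneg _)
      calc (1 / 4 : ℝ) ^ N ≤ (1 / 4) ^ ((disc n₀ q).erase n₀).card :=
            pow_le_pow_of_le_one (by norm_num) (by norm_num) (Finset.card_erase_le)
        _ = ∏ n ∈ (disc n₀ q).erase n₀, (1 / 4 : ℝ) := by rw [Finset.prod_const]
        _ ≤ _ := Finset.prod_le_prod (fun _ _ => by norm_num) fun n hn => by
            have := norm_emb_add_ge (Finset.ne_of_mem_erase hn) hε
            rwa [show emb n + (-emb n₀ + ε) = emb (n - n₀) + ε by rw [emb_sub]; ring] at this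
    have h5 : 0 < ‖ε‖ := norm_pos_iff.2 hε0
    have h6 := (mul_le_mul_of_nonneg_right h4 (norm_nonneg _)).trans h3
    rw [mul_assoc, mul_comm C, mul_le_mul_iff_right₀ h5] at h6
    rw [one_div, inv_pow, inv_mul_le_iff₀ (by positivity)] at h6
    rw [mul_comm C]; exact h6

theorem trace_trunc_walkMat {κ : ℂ} {R : Finset (ℤ × ℤ)} (hR : ∀ n ∈ R, n ∈ Lset) (l : ℕ) :
    (trunc (walkMat h Lset κ) R ^ (l + 1)).trace = trPow (walkMat h (R : Set (ℤ × ℤ)) κ) (l + 1) := by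
  rw [trace_trunc_pow]
  congr 1
  ext n m
  by_cases hn : n ∈ R ∧ m ∈ R
  · rw [if_pos hn, walkMat, walkMat, if_pos ⟨hR n hn.1, hR m hn.2⟩, if_pos (by simpa using hn)]
  · rw [if_neg hn, walkMat, if_neg (by simpa using hn)]

/-- The trace of a power of the walk matrix is bounded near each pole. -/
theorem exists_walkTr_bound_near (hr : ∀ j, h j ≠ 0 → ‖j‖ ≤ r)
    (hrot : ∀ j, h (rot j) = ω * h j) {n₀ : ℤ × ℤ} (h0 : n₀ ∈ Lset) {l : ℕ} (hl : 4 ≤ l) :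
    ∃ B : ℝ, ∀ ε : ℂ, ε ≠ 0 → ‖ε‖ ≤ 1 / 4 →
      ‖trPow (walkMat h Lset (-emb n₀ + ε)) l‖ ≤ B := by
  obtain ⟨l, rfl⟩ : ∃ k, l = k + 1 := ⟨l - 1, by omega⟩
  set q : ℝ := 4 * ((l + 1 : ℕ) * r) with hq
  set R := disc n₀ q with hR
  obtain ⟨B, hB⟩ := exists_trace_disc_bound hrot h0 (show 0 ≤ q by positivity) l
  obtain ⟨C, hC⟩ := exists_walkTr_bound hr (show (0 : ℝ) < 1 / 4 by norm_num)
    (show 0 ≤ ‖emb n₀‖ + 1 / 4 by positivity) hl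
  refine ⟨B + C + C, fun ε hε0 hε => ?_⟩
  set κ := -emb n₀ + ε
  have hκ : ‖κ‖ ≤ ‖emb n₀‖ + 1 / 4 := by
    refine (norm_add_le _ _).trans ?_; rw [norm_neg]; linarith
  have hns : ∀ n, emb n + κ ≠ 0 := emb_add_ne_zero hε0 hε
  have hb := hB ε hε0 hε
  rw [trace_trunc_walkMat (fun n hn => (mem_disc.1 hn).1)] at hb
  have hc1 := hC (Lset \ {n₀}) κ hκ fun n hn => norm_emb_add_ge hn.2 hε
  have hc2 := hC ((R : Set (ℤ × ℤ)) \ {n₀}) κ hκ fun n hn => norm_emb_add_ge hn.2 hε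
  have hs : ∀ A : Set (ℤ × ℤ), Summable fun n => powEntry (walkMat h A κ) (l + 1) n n :=
    fun A => summable_walk hr (fun n _ => hns n) hl
  have key : trPow (walkMat h Lset κ) (l + 1) = trPow (walkMat h (R : Set (ℤ × ℤ)) κ) (l + 1) +
      (trPow (walkMat h (Lset \ {n₀}) κ) (l + 1) -
        trPow (walkMat h ((R : Set (ℤ × ℤ)) \ {n₀}) κ) (l + 1)) := by
    simp only [trPow]
    rw [← (hs _).tsum_sub (hs _), ← (hs _).tsum_add ((hs _).sub (hs _))]
    refine tsum_congr fun n => ?_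
    by_cases hn : ‖n - n₀‖ ≤ (l + 1 : ℕ) * r
    · have hiff : ∀ p, ‖p - n‖ ≤ (l + 1 : ℕ) * r → (p ∈ Lset ↔ p ∈ (R : Set (ℤ × ℤ))) := by
        intro p hp
        rw [Finset.mem_coe, mem_disc]
        refine ⟨fun h => ⟨h, ?_⟩, fun h => h.1⟩
        refine (norm_emb_le _).trans ?_
        have : ‖p - n₀‖ ≤ ‖p - n‖ + ‖n - n₀‖ := by
          rw [← sub_add_sub_cancel p n n₀]; exact norm_add_le _ _
        linarith
      rw [powEntry_walkMat_congr hr κ (l + 1) n n hiff,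
        powEntry_walkMat_congr hr (A := Lset \ {n₀}) (A' := (R : Set (ℤ × ℤ)) \ {n₀}) κ (l + 1) n n
          fun p hp => by
            rw [Set.mem_sdiff, Set.mem_sdiff, hiff p hp]]
      ring
    · have hne : ∀ p, ‖p - n‖ ≤ (l + 1 : ℕ) * r → p ≠ n₀ := by
        rintro p hp rfl
        exact hn (by rwa [norm_sub_rev])
      rw [powEntry_walkMat_congr hr (A := Lset) (A' := Lset \ {n₀}) κ (l + 1) n n fun p hp => by
          simp [hne p hp],
        powEntry_walkMat_congr hr (A := (R : Set (ℤ × ℤ))) (A' := (R : Set (ℤ × ℤ)) \ {n₀}) κ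
          (l + 1) n n fun p hp => by simp [hne p hp]]
      ring
  rw [key]
  refine (norm_add_le _ _).trans ?_
  have := norm_sub_le (trPow (walkMat h (Lset \ {n₀}) κ) (l + 1))
    (trPow (walkMat h ((R : Set (ℤ × ℤ)) \ {n₀}) κ) (l + 1))
  linarith

end

section

open Filter Topology

variable {h : ℤ × ℤ → ℂ} {r : ℕ}

/-- The spectral parameters at which the walk matrix has no pole. -/
def nonsing : Set ℂ := {κ | ∀ n ∈ Lset, emb n + κ ≠ 0}

theorem isOpen_nonsing : IsOpen nonsing := by
  rw [Metric.isOpen_iff]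
  intro κ hκ
  obtain ⟨δ, hδ, hgap⟩ := exists_gap Lset hκ
  refine ⟨δ, hδ, fun w hw n hn h0 => ?_⟩
  have h1 := hgap n hn
  rw [Metric.mem_ball, dist_eq_norm] at hw
  have h2 : emb n + κ = -(w - κ) := by linear_combination h0
  rw [h2, norm_neg] at h1
  linarith

theorem dense_nonsing : Dense nonsing := by
  have h1 : (nonsing)ᶜ ⊆ (fun n => -emb n) '' Set.univ := by
    intro κ hκ
    simp only [nonsing, Set.mem_compl_iff, Set.mem_ofPred_eq, not_forall, not_not] at hκ
    obtain ⟨n, -, hn⟩ := hκ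
    exact ⟨n, trivial, by linear_combination -hn⟩
  have h2 : (nonsing)ᶜ.Countable := (Set.countable_univ.image _).mono h1
  simpa using h2.dense_compl ℝ

theorem zero_mem_nonsing : (0 : ℂ) ∈ nonsing := by
  intro n hn h0
  rw [add_zero, emb_eq_zero] at h0
  exact zero_notMem_Lset (h0 ▸ hn)

theorem walkTr_eq_walkTr_zero (hr : ∀ j, h j ≠ 0 → ‖j‖ ≤ r)
    (hrot : ∀ j, h (rot j) = ω * h j) {l : ℕ} (hl : 4 ≤ l) {κ : ℂ} (hκ : κ ∈ nonsing) :
    trPow (walkMat h Lset κ) l = trPow (walkMat h Lset 0) l := by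
  set g : ℂ → ℂ := fun κ => trPow (walkMat h Lset κ) l with hg
  have hgd : ∀ κ ∈ nonsing, DifferentiableAt ℂ g κ := fun κ hκ => differentiableAt_walkTr hr hκ hl
  set G : ℂ → ℂ := fun κ => limUnder (𝓝[≠] κ) g with hG
  have hGg : ∀ κ ∈ nonsing, G κ = g κ := fun κ hκ =>
    ((hgd κ hκ).continuousAt.tendsto.mono_left nhdsWithin_le_nhds).limUnder_eq
  have hGd : Differentiable ℂ G := by
    intro κ
    by_cases hκ : κ ∈ nonsing
    · refine (hgd κ hκ).congr_of_eventuallyEq ?_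
      filter_upwards [isOpen_nonsing.mem_nhds hκ] with w hw using hGg w hw
    · simp only [nonsing, Set.mem_ofPred_eq, not_forall, not_not] at hκ
      obtain ⟨n₀, h0, hn₀⟩ := hκ
      obtain rfl : κ = -emb n₀ := by linear_combination hn₀
      obtain ⟨B, hB⟩ := exists_walkTr_bound_near hr hrot h0 hl
      have hball : Metric.closedBall (-emb n₀) (1 / 4) ∈ 𝓝 (-emb n₀) :=
        Metric.closedBall_mem_nhds _ (by norm_num)
      have hns : ∀ w ∈ Metric.closedBall (-emb n₀) (1 / 4) \ {-emb n₀}, w ∈ nonsing := by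
        rintro w ⟨hw, hw'⟩ n -
        rw [Metric.mem_closedBall, dist_eq_norm] at hw
        have := emb_add_ne_zero (n₀ := n₀) (ε := w - -emb n₀) (sub_ne_zero.2 hw') hw n
        simpa using this
      have h1 := Complex.differentiableOn_update_limUnder_of_bddAbove (f := g) hball
        (fun w hw => (hgd w (hns w hw)).differentiableWithinAt) ⟨B, by
          rintro _ ⟨w, hw, rfl⟩
          have hw1 := hw.1
          rw [Metric.mem_closedBall, dist_eq_norm] at hw1
          have := hB (w - -emb n₀) (sub_ne_zero.2 hw.2) hw1
          simpa using this⟩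
      refine (h1.differentiableAt hball).congr_of_eventuallyEq ?_
      filter_upwards [hball] with w hw
      rcases eq_or_ne w (-emb n₀) with rfl | hne
      · simp [hG]
      · rw [Function.update_of_ne hne]; exact hGg w (hns w ⟨hw, hne⟩)
  have hper : ∀ (q : ℤ × ℤ), (3 : ℤ) ∣ q.1 + q.2 → ∀ κ, G (κ + emb q) = G κ := by
    intro q hq
    have hq' : ∀ n, n + q ∈ Lset ↔ n ∈ Lset := by
      intro n
      change ¬ (3 : ℤ) ∣ n.1 + q.1 + (n.2 + q.2) ↔ ¬ (3 : ℤ) ∣ n.1 + n.2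
      omega
    have hcont : Continuous G := hGd.continuous
    have heq := Continuous.ext_on (f := fun κ => G (κ + emb q)) (g := G) dense_nonsing
      (by fun_prop) hcont fun κ hκ => by
        have h2 : κ + emb q ∈ nonsing := by
          intro n hn
          have := hκ (n + q) ((hq' n).2 hn)
          rwa [emb_add, add_assoc, add_comm (emb q)] at this
        change G (κ + emb q) = G κ
        rw [hGg _ hκ, hGg _ h2]
        exact walkTr_shift hr hq' κ l
    exact congrFun heq
  have hbdd : Bornology.IsBounded (Set.range G) := by
    have hK := (isCompact_closedBall (0 : ℂ) 6).image hGd.continuous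
    refine hK.isBounded.subset ?_
    rintro _ ⟨κ, rfl⟩
    set b : ℝ := κ.im / (Real.sqrt 3 / 2)
    set a : ℝ := κ.re + b / 2
    set q : ℤ × ℤ := (3 * -⌊a / 3⌋, 3 * -⌊b / 3⌋)
    refine ⟨κ + emb q, ?_, hper q (by simp only [q]; omega) κ⟩
    have hs : Real.sqrt 3 ≠ 0 := by positivity
    have hκ : κ = a + b * ω := by
      apply Complex.ext
      · simp [a, omega_re]; ring
      · have hb : b * (Real.sqrt 3 / 2) = κ.im := by simp only [b]; field_simp
        simp only [Complex.add_im, Complex.mul_im, Complex.ofReal_im, Complex.ofReal_re, omega_im]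
        linarith
    have h1 : κ + emb q = ((3 * Int.fract (a / 3) : ℝ) : ℂ) + ((3 * Int.fract (b / 3) : ℝ) : ℂ) * ω := by
      conv_lhs => rw [hκ]
      simp only [emb, q, Int.fract]
      push_cast
      ring
    rw [mem_closedBall_zero_iff, h1]
    refine (norm_add_le _ _).trans ?_
    rw [norm_mul, norm_omega, mul_one, Complex.norm_real, Complex.norm_real, Real.norm_eq_abs,
      Real.norm_eq_abs, abs_of_nonneg (by positivity), abs_of_nonneg (by positivity)]
    linarith [Int.fract_lt_one (a / 3), Int.fract_lt_one (b / 3)]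
  have := hGd.apply_eq_apply_of_bounded hbdd κ 0
  rwa [hGg _ hκ, hGg _ zero_mem_nonsing] at this

end

section

open Filter Topology

/-- The rational function `t ↦ ∏ 1 / (t + z)` over a multiset of `z`. -/
noncomputable def invProd (s : Multiset ℂ) (t : ℝ) : ℂ := (s.map fun z => ((t : ℂ) + z)⁻¹).prod

theorem invProd_cons (a : ℂ) (s : Multiset ℂ) (t : ℝ) :
    invProd (a ::ₘ s) t = ((t : ℂ) + a)⁻¹ * invProd s t := by simp [invProd]

theorem ofReal_add_ne_zero {z : ℂ} (hz : z.im ≠ 0) (t : ℝ) : (t : ℂ) + z ≠ 0 := by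
  intro h
  have := congrArg Complex.im h
  simp at this
  exact hz this

theorem continuous_invProd {s : Multiset ℂ} (hs : ∀ z ∈ s, z.im ≠ 0) : Continuous (invProd s) := by
  induction s using Multiset.induction_on with
  | empty =>
    have h1 : invProd 0 = fun _ : ℝ => (1 : ℂ) := by funext t; simp [invProd]
    rw [h1]; exact continuous_const
  | cons a s ih =>
    have h1 := ih fun z hz => hs z (Multiset.mem_cons_of_mem hz)
    have h2 : Continuous fun t : ℝ => ((t : ℂ) + a)⁻¹ :=
      (by fun_prop : Continuous fun t : ℝ => (t : ℂ) + a).inv₀ fun t =>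
        ofReal_add_ne_zero (hs a (Multiset.mem_cons_self a s)) t
    exact (h2.mul h1).congr fun t => (invProd_cons a s t).symm

/-- The symmetric improper integral of `f` over the real line is `π q`. -/
def SymmInt (f : ℝ → ℂ) (q : ℂ) : Prop :=
  Tendsto (fun M : ℕ => ∫ t in (-(M : ℝ))..M, f t) atTop (𝓝 (Real.pi * q))

theorem SymmInt.add {f g : ℝ → ℂ} {p q : ℂ} (hf : Continuous f) (hg : Continuous g)
    (h : SymmInt f p) (h' : SymmInt g q) : SymmInt (f + g) (p + q) := by
  have := Tendsto.add h h'
  rw [← mul_add] at this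
  refine this.congr fun M => ?_
  exact (intervalIntegral.integral_add (hf.intervalIntegrable _ _) (hg.intervalIntegrable _ _)).symm

theorem SymmInt.const_mul {f : ℝ → ℂ} {q : ℂ} (h : SymmInt f q) (c : ℂ) :
    SymmInt (fun t => c * f t) (c * q) := by
  have := Tendsto.const_mul c h
  rw [mul_left_comm] at this
  refine this.congr fun M => ?_
  exact (intervalIntegral.integral_const_mul _ _).symm

theorem symmInt_zero : SymmInt 0 0 := by
  simp [SymmInt]

theorem tendsto_div_natCast (z : ℂ) : Tendsto (fun M : ℕ => z / (M : ℂ)) atTop (𝓝 0) :=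
  tendsto_const_div_atTop_nhds_zero_nat z

theorem symmInt_inv_of_tendsto {z c : ℂ} (hz : z.im ≠ 0)
    (hc : Tendsto (fun M : ℕ => Complex.log (-1 + z / M)) atTop (𝓝 (-(Real.pi * c)))) :
    SymmInt (fun t => ((t : ℂ) + z)⁻¹) c := by
  have h1 : ∀ a b : ℝ, ∫ t in a..b, ((t : ℂ) + z)⁻¹ =
      Complex.log (b + z) - Complex.log (a + z) := by
    intro a b
    refine intervalIntegral.integral_eq_sub_of_hasDerivAt (f := fun t : ℝ => Complex.log (t + z))
      (fun t _ => ?_) ?_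
    · have h2 : HasDerivAt (fun t : ℝ => (t : ℂ) + z) 1 t := by
        simpa using (Complex.ofRealCLM.hasDerivAt (x := t)).add_const z
      have h3 : (t : ℂ) + z ∈ Complex.slitPlane := by
        right; simpa using hz
      simpa using h2.clog_real h3
    · refine Continuous.intervalIntegrable ?_ _ _
      exact (by fun_prop : Continuous fun t : ℝ => (t : ℂ) + z).inv₀ (ofReal_add_ne_zero hz)
  have h2 : Tendsto (fun M : ℕ => Complex.log (1 + z / M)) atTop (𝓝 0) := by
    have h3 : Tendsto (fun M : ℕ => 1 + z / (M : ℂ)) atTop (𝓝 1) := by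
      simpa using (tendsto_div_natCast z).const_add 1
    have h4 := h3.clog (by simp)
    simpa using h4
  have h3 := h2.sub hc
  rw [zero_sub, neg_neg] at h3
  refine h3.congr' ?_
  filter_upwards [eventually_gt_atTop 0] with M hM
  have hM0 : (M : ℂ) ≠ 0 := by exact_mod_cast hM.ne'
  have hMr : (0 : ℝ) < M := by exact_mod_cast hM
  have hne : ∀ a : ℝ, (a : ℂ) + z / M ≠ 0 := by
    intro a
    refine ofReal_add_ne_zero ?_ a
    rw [Complex.div_natCast_im]
    exact div_ne_zero hz hMr.ne'
  rw [h1]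
  have e1 : ((M : ℝ) : ℂ) + z = (M : ℝ) * (1 + z / M) := by push_cast; field_simp
  have e2 : ((-(M : ℝ) : ℝ) : ℂ) + z = (M : ℝ) * (-1 + z / M) := by push_cast; field_simp
  rw [e1, e2, Complex.log_ofReal_mul hMr (by simpa using hne 1),
    Complex.log_ofReal_mul hMr (by simpa using hne (-1))]
  ring

theorem symmInt_inv_of_im_pos {z : ℂ} (hz : 0 < z.im) :
    SymmInt (fun t => ((t : ℂ) + z)⁻¹) (-Complex.I) := by
  refine symmInt_inv_of_tendsto hz.ne' ?_
  have h1 := Complex.tendsto_log_nhdsWithin_im_nonneg_of_re_neg_of_im_zero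
    (z := -1) (by simp) (by simp)
  have h2 : Tendsto (fun M : ℕ => -1 + z / (M : ℂ)) atTop (𝓝[{z : ℂ | 0 ≤ z.im}] (-1)) := by
    refine tendsto_nhdsWithin_iff.2 ⟨by simpa using (tendsto_div_natCast z).const_add (-1), ?_⟩
    filter_upwards with M
    have : 0 ≤ z.im / M := by positivity
    simpa [Complex.div_natCast_im] using this
  have h3 := h1.comp h2
  simpa [Function.comp_def] using h3

theorem symmInt_inv_of_im_neg {z : ℂ} (hz : z.im < 0) :
    SymmInt (fun t => ((t : ℂ) + z)⁻¹) Complex.I := by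
  refine symmInt_inv_of_tendsto hz.ne ?_
  have h1 := Complex.tendsto_log_nhdsWithin_im_neg_of_re_neg_of_im_zero
    (z := -1) (by simp) (by simp)
  have h2 : Tendsto (fun M : ℕ => -1 + z / (M : ℂ)) atTop (𝓝[{z : ℂ | z.im < 0}] (-1)) := by
    refine tendsto_nhdsWithin_iff.2 ⟨by simpa using (tendsto_div_natCast z).const_add (-1), ?_⟩
    filter_upwards [eventually_gt_atTop 0] with M hM
    have : z.im / M < 0 := div_neg_of_neg_of_pos hz (by exact_mod_cast hM)
    simpa [Complex.div_natCast_im] using this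
  have h3 := h1.comp h2
  simpa [Function.comp_def] using h3

theorem symmInt_inv_pow {z : ℂ} (hz : z.im ≠ 0) (n : ℕ) :
    SymmInt (fun t => (((t : ℂ) + z)⁻¹) ^ (n + 2)) 0 := by
  have hn : ((n : ℂ) + 1) ≠ 0 := by exact_mod_cast Nat.succ_ne_zero n
  have h1 : ∀ a b : ℝ, ∫ t in a..b, (((t : ℂ) + z)⁻¹) ^ (n + 2) =
      -((b + z)⁻¹) ^ (n + 1) / (n + 1) - -((a + z)⁻¹) ^ (n + 1) / (n + 1) := by
    intro a b
    refine intervalIntegral.integral_eq_sub_of_hasDerivAt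
      (f := fun t : ℝ => -(((t : ℂ) + z)⁻¹) ^ (n + 1) / (n + 1)) (fun t _ => ?_) ?_
    · have h2 : HasDerivAt (fun t : ℝ => (t : ℂ) + z) 1 t := by
        simpa using (Complex.ofRealCLM.hasDerivAt (x := t)).add_const z
      have h3 := ofReal_add_ne_zero hz t
      have h4 := (((h2.inv h3).pow (n + 1)).neg.div_const ((n : ℂ) + 1))
      refine (h4.congr_deriv ?_)
      rw [Nat.add_sub_cancel]
      push_cast
      simp only [Pi.inv_apply, inv_pow]
      field_simp
      ring
    · refine Continuous.intervalIntegrable ?_ _ _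
      exact ((by fun_prop : Continuous fun t : ℝ => (t : ℂ) + z).inv₀
        (ofReal_add_ne_zero hz)).pow _
  have h2 : ∀ c : ℂ, c ≠ 0 → Tendsto (fun M : ℕ => (c * (M : ℂ) + z)⁻¹) atTop (𝓝 0) := by
    intro c hc
    have h3 : Tendsto (fun M : ℕ => (c + z / M)⁻¹ * (1 / (M : ℂ))) atTop (𝓝 (c⁻¹ * 0)) := by
      refine Tendsto.mul (Tendsto.inv₀ ?_ hc) (tendsto_div_natCast 1)
      simpa using (tendsto_div_natCast z).const_add c
    rw [mul_zero] at h3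
    refine h3.congr' ?_
    filter_upwards [eventually_gt_atTop 0] with M hM
    have hM0 : (M : ℂ) ≠ 0 := by exact_mod_cast hM.ne'
    rw [one_div, ← mul_inv]
    congr 1
    field_simp
  have h3 := ((((h2 1 one_ne_zero).pow (n + 1)).neg.div_const ((n : ℂ) + 1))).sub
    ((((h2 (-1) (by simp)).pow (n + 1)).neg.div_const ((n : ℂ) + 1)))
  rw [SymmInt]
  simp only [h1]
  simpa using h3

theorem exists_symmInt_invProd {F : Subfield ℂ} (hI : Complex.I ∈ F) (n : ℕ) :
    ∀ s : Multiset ℂ, s.card = n + 1 → (∀ z ∈ s, z ∈ F ∧ z.im ≠ 0) →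
      ∃ q ∈ F, SymmInt (invProd s) q ∧
        ((∀ z ∈ s, 0 < z.im) → q = if n = 0 then -Complex.I else 0) ∧
        ((∀ z ∈ s, z.im < 0) → q = if n = 0 then Complex.I else 0) := by
  induction n with
  | zero =>
    intro s hs hF
    obtain ⟨a, rfl⟩ := Multiset.card_eq_one.1 (by simpa using hs)
    have h1 : invProd {a} = fun t : ℝ => ((t : ℂ) + a)⁻¹ := by funext t; simp [invProd]
    rw [h1]
    have ha := hF a (by simp)
    rcases ha.2.lt_or_gt with h | h
    · refine ⟨Complex.I, hI, symmInt_inv_of_im_neg h, fun h' => ?_, by simp⟩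
      exact absurd (h' a (by simp)) h.not_gt
    · refine ⟨-Complex.I, neg_mem hI, symmInt_inv_of_im_pos h, by simp, fun h' => ?_⟩
      exact absurd (h' a (by simp)) h.not_gt
  | succ n ih =>
    intro s hs hF
    obtain ⟨a, ha⟩ := Multiset.card_pos_iff_exists_mem.1 (show 0 < s.card by omega)
    obtain ⟨s', rfl⟩ := Multiset.exists_cons_of_mem ha
    rw [Multiset.card_cons, add_left_inj] at hs
    rename' hs => hs'
    by_cases hall : ∀ b ∈ s', b = a
    · obtain rfl := Multiset.eq_replicate.2 ⟨hs', hall⟩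
      have h1 : invProd (a ::ₘ Multiset.replicate (n + 1) a) =
          fun t : ℝ => (((t : ℂ) + a)⁻¹) ^ (n + 2) := by
        funext t; simp [invProd, pow_succ']
      rw [h1]
      exact ⟨0, zero_mem F, symmInt_inv_pow (hF a (by simp)).2 n, by simp, by simp⟩
    · push Not at hall
      obtain ⟨b, hb, hba⟩ := hall
      obtain ⟨s'', rfl⟩ := Multiset.exists_cons_of_mem hb
      rw [Multiset.card_cons] at hs'
      have hFa := hF a (by simp)
      have hFb := hF b (by simp)
      have hF'' : ∀ z ∈ s'', z ∈ F ∧ z.im ≠ 0 := fun z hz => hF z (by simp [hz])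
      have hsa : ∀ z ∈ a ::ₘ s'', z ∈ F ∧ z.im ≠ 0 := by
        simpa using ⟨hFa, hF''⟩
      have hsb : ∀ z ∈ b ::ₘ s'', z ∈ F ∧ z.im ≠ 0 := by
        simpa using ⟨hFb, hF''⟩
      obtain ⟨p, hp, hpi, hp1, hp2⟩ := ih (a ::ₘ s'') (by simpa using hs') hsa
      obtain ⟨q, hq, hqi, hq1, hq2⟩ := ih (b ::ₘ s'') (by simpa using hs') hsb
      have hba' : b - a ≠ 0 := sub_ne_zero.2 hba
      refine ⟨(b - a)⁻¹ * (p + -1 * q), mul_mem (inv_mem (sub_mem hFb.1 hFa.1))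
        (add_mem hp (mul_mem (neg_mem (one_mem F)) hq)), ?_, fun h' => ?_, fun h' => ?_⟩
      · have h1 := (hpi.add (continuous_invProd fun z hz => (hsa z hz).2)
          ((continuous_invProd fun z hz => (hsb z hz).2).const_mul (-1))
          (hqi.const_mul (-1))).const_mul (b - a)⁻¹
        convert h1 using 1
        funext t
        simp only [Pi.add_apply, invProd_cons]
        have := ofReal_add_ne_zero hFa.2 t
        have := ofReal_add_ne_zero hFb.2 t
        field_simp
        ring
      · have h'' : ∀ z ∈ s'', 0 < z.im := fun z hz => h' z (by simp [hz])
        rw [hp1 (by simpa using ⟨h' a (by simp), h''⟩), hq1 (by simpa using ⟨h' b (by simp), h''⟩)]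
        rw [if_neg n.succ_ne_zero]
        ring
      · have h'' : ∀ z ∈ s'', z.im < 0 := fun z hz => h' z (by simp [hz])
        rw [hp2 (by simpa using ⟨h' a (by simp), h''⟩), hq2 (by simpa using ⟨h' b (by simp), h''⟩)]
        rw [if_neg n.succ_ne_zero]
        ring

/-- Combinations over `F` of the functions `∏ 1 / (t + z)` with `n` factors, all `z` in `S`. -/
noncomputable def invSpan (F : Subfield ℂ) (S : Set ℂ) (n : ℕ) : Submodule F (ℝ → ℂ) :=
  Submodule.span F {f | ∃ s : Multiset ℂ, s.card = n ∧ (∀ z ∈ s, z ∈ S) ∧ f = invProd s}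

theorem exists_symmInt_of_mem_invSpan {F : Subfield ℂ} (hI : Complex.I ∈ F) {S : Set ℂ}
    (hS : ∀ z ∈ S, z ∈ F ∧ z.im ≠ 0) {n : ℕ} {f : ℝ → ℂ} (hf : f ∈ invSpan F S (n + 2)) :
    Continuous f ∧ ∃ q ∈ F, SymmInt f q ∧
      ((∀ z ∈ S, 0 < z.im) → q = 0) ∧ ((∀ z ∈ S, z.im < 0) → q = 0) := by
  induction hf using Submodule.span_induction with
  | mem f hf =>
    obtain ⟨s, hs, hsS, rfl⟩ := hf
    obtain ⟨q, hq, h1, h2, h3⟩ := exists_symmInt_invProd hI (n + 1) s hs fun z hz => hS z (hsS z hz)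
    exact ⟨continuous_invProd fun z hz => (hS z (hsS z hz)).2, q, hq, h1,
      fun h => by simpa using h2 fun z hz => h z (hsS z hz),
      fun h => by simpa using h3 fun z hz => h z (hsS z hz)⟩
  | zero => exact ⟨continuous_const, 0, zero_mem F, symmInt_zero, fun _ => rfl, fun _ => rfl⟩
  | add f g _ _ ihf ihg =>
    obtain ⟨cf, p, hp, h1, h2, h3⟩ := ihf
    obtain ⟨cg, q, hq, h1', h2', h3'⟩ := ihg
    exact ⟨cf.add cg, p + q, add_mem hp hq, h1.add cf cg h1',
      fun h => by rw [h2 h, h2' h, add_zero], fun h => by rw [h3 h, h3' h, add_zero]⟩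
  | smul c f _ ih =>
    obtain ⟨cf, p, hp, h1, h2, h3⟩ := ih
    exact ⟨cf.const_mul (c : ℂ), c * p, mul_mem c.2 hp, h1.const_mul c,
      fun h => by rw [h2 h, mul_zero], fun h => by rw [h3 h, mul_zero]⟩

theorem inv_mul_mem_invSpan {F : Subfield ℂ} {S : Set ℂ} {n : ℕ} {f : ℝ → ℂ}
    (hf : f ∈ invSpan F S n) {c z : ℂ} (hc : c ∈ F) (hz : z ∈ S) :
    (fun t : ℝ => c * ((t : ℂ) + z)⁻¹ * f t) ∈ invSpan F S (n + 1) := by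
  induction hf using Submodule.span_induction with
  | mem f hf =>
    obtain ⟨s, hs, hsS, rfl⟩ := hf
    have h1 : invProd (z ::ₘ s) ∈ invSpan F S (n + 1) :=
      Submodule.subset_span ⟨z ::ₘ s, by simp [hs], by simpa using ⟨hz, hsS⟩, rfl⟩
    have h2 := Submodule.smul_mem _ (⟨c, hc⟩ : F) h1
    convert h2 using 1
    funext t
    simp only [Pi.smul_apply, invProd_cons, Subfield.smul_def, smul_eq_mul]
    ring
  | zero =>
    convert Submodule.zero_mem (invSpan F S (n + 1)) using 1
    funext t
    simp
  | add f g _ _ ihf ihg =>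
    convert Submodule.add_mem _ ihf ihg using 1
    funext t
    simp only [Pi.add_apply]
    ring
  | smul a f _ ih =>
    convert Submodule.smul_mem _ a ih using 1
    funext t
    simp only [Pi.smul_apply, Subfield.smul_def, smul_eq_mul]
    ring

end

section

open Filter Topology

variable {h : ℤ × ℤ → ℂ} {r : ℕ}

/-- The field `ℚ(ω/√3)`. -/
noncomputable def fieldQ : Subfield ℂ := Subfield.closure {ω / (Real.sqrt 3 : ℂ)}

theorem sqrt_three_sq : (Real.sqrt 3 : ℂ) ^ 2 = 3 := by
  rw [← Complex.ofReal_pow, Real.sq_sqrt (by norm_num)]; norm_num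

theorem sqrt_three_ne_zero : (Real.sqrt 3 : ℂ) ≠ 0 := by
  intro h; have := sqrt_three_sq; rw [h] at this; norm_num at this

theorem sqrt_three_mem : (Real.sqrt 3 : ℂ) ∈ fieldQ := by
  have hc : ω / (Real.sqrt 3 : ℂ) ∈ fieldQ := Subfield.subset_closure rfl
  have h1 : (Real.sqrt 3 : ℂ) = (3 * (ω / (Real.sqrt 3 : ℂ)) ^ 3)⁻¹ := by
    rw [div_pow, omega_cube, pow_succ, sqrt_three_sq]
    field_simp
  rw [h1]
  exact inv_mem (mul_mem (ofNat_mem fieldQ 3) (pow_mem hc 3))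

theorem omega_mem : ω ∈ fieldQ := by
  have hc : ω / (Real.sqrt 3 : ℂ) ∈ fieldQ := Subfield.subset_closure rfl
  have := mul_mem hc sqrt_three_mem
  rwa [div_mul_cancel₀ _ sqrt_three_ne_zero] at this

theorem I_mem : Complex.I ∈ fieldQ := by
  have h1 : Complex.I = (2 * ω + 1) / (Real.sqrt 3 : ℂ) := by
    rw [eq_div_iff sqrt_three_ne_zero, omega_eq]; push_cast; ring
  rw [h1]
  exact div_mem (add_mem (mul_mem (ofNat_mem fieldQ 2) omega_mem) (one_mem _)) sqrt_three_mem

theorem emb_mem (n : ℤ × ℤ) : emb n ∈ fieldQ :=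
  add_mem (intCast_mem fieldQ _) (mul_mem (intCast_mem fieldQ _) omega_mem)

/-- The Eisenstein integer `1 + 2ω = i√3`. -/
noncomputable def theta : ℂ := emb (1, 2)

theorem theta_eq : theta = Complex.I * Real.sqrt 3 := by
  rw [theta, emb, omega_eq]; push_cast; ring

theorem theta_ne_zero : theta ≠ 0 := by
  rw [theta_eq]; exact mul_ne_zero Complex.I_ne_zero sqrt_three_ne_zero

theorem im_emb_div_theta (n : ℤ × ℤ) :
    (emb n / theta).im = (n.2 - 2 * n.1 : ℤ) / (2 * Real.sqrt 3) := by
  have h3 : Real.sqrt 3 ≠ 0 := by positivity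
  have h1 : emb n / theta = -(Complex.I * emb n) * ((Real.sqrt 3)⁻¹ : ℝ) := by
    rw [theta_eq, div_eq_iff (mul_ne_zero Complex.I_ne_zero sqrt_three_ne_zero)]
    push_cast
    field_simp [sqrt_three_ne_zero]
    rw [Complex.I_sq]; ring
  rw [h1, Complex.im_mul_ofReal, Complex.neg_im, Complex.I_mul_im, emb]
  simp only [Complex.add_re, Complex.mul_re, Complex.intCast_re, Complex.intCast_im, omega_re]
  push_cast
  field_simp
  ring

theorem im_emb_div_theta_ne_zero {n : ℤ × ℤ} (hn : n ∈ Lset) : (emb n / theta).im ≠ 0 := by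
  rw [im_emb_div_theta]
  refine div_ne_zero ?_ (by positivity)
  rw [Int.cast_ne_zero]
  have : ¬ (3 : ℤ) ∣ n.1 + n.2 := hn
  omega

theorem one_half_le_norm_emb_add_theta {n : ℤ × ℤ} (hn : n ∈ Lset) (t : ℝ) :
    1 / 2 ≤ ‖emb n + theta * t‖ := by
  have h3 : 0 < Real.sqrt 3 := by positivity
  have h1 : emb n + theta * t = theta * (t + emb n / theta) := by
    field_simp [theta_ne_zero]; ring
  have h2 : ‖theta‖ = Real.sqrt 3 := by
    rw [theta_eq, norm_mul, Complex.norm_I, one_mul, Complex.norm_real, Real.norm_of_nonneg h3.le]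
  rw [h1, norm_mul, h2]
  have h4 := Complex.abs_im_le_norm (t + emb n / theta)
  rw [Complex.add_im, Complex.ofReal_im, zero_add, im_emb_div_theta, abs_div,
    abs_of_pos (show 0 < 2 * Real.sqrt 3 by positivity), ← Int.cast_abs] at h4
  have h5 : (1 : ℝ) ≤ (|n.2 - 2 * n.1| : ℤ) := by
    have : ¬ (3 : ℤ) ∣ n.1 + n.2 := hn
    exact_mod_cast Int.one_le_abs (by omega)
  have h6 : 1 / (2 * Real.sqrt 3) ≤ ‖t + emb n / theta‖ :=
    le_trans (by gcongr) h4
  calc 1 / 2 = Real.sqrt 3 * (1 / (2 * Real.sqrt 3)) := by field_simp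
    _ ≤ _ := by gcongr

theorem theta_mul_mem_nonsing (t : ℝ) : theta * t ∈ nonsing := fun n hn =>
  norm_pos_iff.1 (lt_of_lt_of_le (by norm_num) (one_half_le_norm_emb_add_theta hn t))

theorem powEntry_mem_invSpan (hr : ∀ j, h j ≠ 0 → ‖j‖ ≤ r) (hF : ∀ j, h j ∈ fieldQ)
    {A : Set (ℤ × ℤ)} (l : ℕ) (n m : ℤ × ℤ) :
    (fun t : ℝ => powEntry (walkMat h A (theta * t)) l n m) ∈
      invSpan fieldQ ((fun p => emb p / theta) '' A) l := by
  induction l generalizing n with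
  | zero =>
    by_cases hnm : n = m
    · refine Submodule.subset_span ⟨0, rfl, by simp, ?_⟩
      funext t
      simp [invProd, powEntry, hnm]
    · convert Submodule.zero_mem _ using 1
      funext t
      simp [powEntry, hnm]
  | succ l ih =>
    have h1 : (fun t : ℝ => powEntry (walkMat h A (theta * t)) (l + 1) n m) =
        ∑ j ∈ box r, fun t : ℝ => walkMat h A (theta * t) n (n - j) *
          powEntry (walkMat h A (theta * t)) l (n - j) m := by
      funext t
      rw [(walkMat_hasRange hr _ _).powEntry_succ, Finset.sum_apply]
    rw [h1]
    refine Submodule.sum_mem _ fun j _ => ?_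
    by_cases hA : n ∈ A ∧ n - j ∈ A
    · have h2 := inv_mul_mem_invSpan (ih (n - j)) (div_mem (hF (n - (n - j))) (emb_mem (1, 2)))
        (Set.mem_image_of_mem (fun p => emb p / theta) hA.1)
      convert h2 using 1
      funext t
      rw [walkMat, if_pos hA]
      congr 1
      change _ = _ / theta * _
      rw [div_mul_eq_mul_div, ← div_eq_mul_inv, div_div]
      congr 1
      field_simp [theta_ne_zero]
      ring
    · convert Submodule.zero_mem _ using 1
      funext t
      simp [walkMat, hA]

theorem exists_symmInt_powEntry (hr : ∀ j, h j ≠ 0 → ‖j‖ ≤ r) (hF : ∀ j, h j ∈ fieldQ) {l : ℕ}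
    (hl : 4 ≤ l) (s : ℤ) :
    Continuous (fun t : ℝ => powEntry (walkMat h Lset (theta * t)) l (0, s) (0, s)) ∧
    ∃ q ∈ fieldQ, SymmInt (fun t => powEntry (walkMat h Lset (theta * t)) l (0, s) (0, s)) q ∧
      (3 * (l * r : ℕ) < |s| → q = 0) := by
  set A : Set (ℤ × ℤ) := {p | p ∈ Lset ∧ ‖p - (0, s)‖ ≤ l * r} with hA
  obtain ⟨k, rfl⟩ : ∃ k, l = k + 2 := ⟨l - 2, by omega⟩
  have h1 : (fun t : ℝ => powEntry (walkMat h Lset (theta * t)) (k + 2) (0, s) (0, s)) =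
      fun t : ℝ => powEntry (walkMat h A (theta * t)) (k + 2) (0, s) (0, s) := by
    funext t
    refine powEntry_walkMat_congr hr _ _ _ _ fun p hp => ?_
    exact ⟨fun h => ⟨h, hp⟩, fun h => h.1⟩
  rw [h1]
  obtain ⟨hc, q, hq, h2, h3, h4⟩ := exists_symmInt_of_mem_invSpan I_mem (by
    rintro _ ⟨p, hp, rfl⟩
    exact ⟨div_mem (emb_mem p) (emb_mem (1, 2)), im_emb_div_theta_ne_zero hp.1⟩)
    (powEntry_mem_invSpan (A := A) hr hF (k + 2) (0, s) (0, s))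
  refine ⟨hc, q, hq, h2, fun hs => ?_⟩
  have hp' : ∀ p ∈ A, |p.1| ≤ ((k + 2) * r : ℕ) ∧ |p.2 - s| ≤ ((k + 2) * r : ℕ) := by
    intro p hp
    have h5 := hp.2
    rw [Prod.norm_def, max_le_iff, Int.norm_eq_abs, Int.norm_eq_abs] at h5
    simp only [Prod.fst_sub, Prod.snd_sub, sub_zero] at h5
    exact ⟨by exact_mod_cast h5.1, by exact_mod_cast h5.2⟩
  rcases le_or_gt 0 s with hs0 | hs0
  · refine h3 ?_
    rintro _ ⟨p, hp, rfl⟩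
    obtain ⟨h5, h6⟩ := hp' p hp
    dsimp only
    rw [im_emb_div_theta]
    refine div_pos ?_ (by positivity)
    rw [abs_of_nonneg hs0] at hs
    rw [abs_le] at h5 h6
    rw [Int.cast_pos]
    linarith
  · refine h4 ?_
    rintro _ ⟨p, hp, rfl⟩
    obtain ⟨h5, h6⟩ := hp' p hp
    dsimp only
    rw [im_emb_div_theta]
    refine div_neg_of_neg_of_pos ?_ (by positivity)
    rw [abs_of_neg hs0] at hs
    rw [abs_le] at h5 h6
    rw [Int.cast_lt_zero]
    linarith

/-- Coordinates adapted to the direction `theta`. -/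
def slab : ℤ × ℤ ≃ ℤ × ℤ where
  toFun p := (0, p.1) + (p.2, 2 * p.2)
  invFun n := (n.2 - 2 * n.1, n.1)
  left_inv p := by ext <;> simp
  right_inv p := by ext <;> simp

theorem sum_integral_Ico_neg {f : ℝ → ℂ} (hf : Continuous f) (M : ℕ) :
    ∑ k ∈ Finset.Ico (-(M : ℤ)) M, ∫ t in (k : ℝ)..(k + 1), f t = ∫ t in (-(M : ℝ))..M, f t := by
  induction M with
  | zero => simp
  | succ M ih =>
    have h1 : Finset.Ico (-((M + 1 : ℕ) : ℤ)) ((M + 1 : ℕ) : ℤ) =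
        insert (-((M : ℤ) + 1)) (insert (M : ℤ) (Finset.Ico (-(M : ℤ)) M)) := by
      ext k
      simp only [Finset.mem_Ico, Finset.mem_insert]
      push_cast
      omega
    rw [h1, Finset.sum_insert (by simp), Finset.sum_insert (by simp), ih,
      ← intervalIntegral.integral_add_adjacent_intervals (a := -((M + 1 : ℕ) : ℝ)) (b := -(M : ℝ))
        (hf.intervalIntegrable _ _) (hf.intervalIntegrable _ _),
      ← intervalIntegral.integral_add_adjacent_intervals (a := -(M : ℝ)) (b := (M : ℝ))
        (c := ((M + 1 : ℕ) : ℝ)) (hf.intervalIntegrable _ _) (hf.intervalIntegrable _ _)]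
    push_cast
    rw [show -((M : ℝ) + 1) + 1 = -M by ring]
    ring

/-- For coefficients in `ℚ(ω/√3)` the traces lie in `π ℚ(ω/√3)`. -/
theorem exists_walkTr_eq_pi_mul (hr : ∀ j, h j ≠ 0 → ‖j‖ ≤ r)
    (hrot : ∀ j, h (rot j) = ω * h j) (hF : ∀ j, h j ∈ fieldQ) {l : ℕ} (hl : 4 ≤ l) :
    ∃ q ∈ fieldQ, trPow (walkMat h Lset 0) l = Real.pi * q := by
  choose hcont q hq hInt hzero using exists_symmInt_powEntry hr hF hl
  set P : ℤ × ℤ → ℝ → ℂ := fun n t => powEntry (walkMat h Lset (theta * t)) l n n with hP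
  have hnorm : ∀ t ∈ Set.Icc (0 : ℝ) 1, ‖theta * t‖ ≤ ‖theta‖ := by
    intro t ht
    rw [norm_mul, Complex.norm_real, Real.norm_of_nonneg ht.1]
    exact mul_le_of_le_one_right (norm_nonneg _) ht.2
  obtain ⟨C, hC, hb⟩ := exists_walk_bound hr (show (0 : ℝ) < 1 / 2 by norm_num)
    (norm_nonneg theta) l
  have hPc : ∀ n, Continuous (P n) := by
    intro n
    rw [continuous_iff_continuousAt]
    intro t
    have h1 := (differentiableAt_powEntry_walkMat hr (theta_mul_mem_nonsing t) l n n).continuousAt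
    exact ContinuousAt.comp (f := fun t : ℝ => theta * (t : ℂ)) h1 (by fun_prop)
  have hbd : ∀ n, ∀ t ∈ Set.Icc (0 : ℝ) 1, ‖P n t‖ ≤ C / (1 + ‖n‖) ^ l := fun n t ht =>
    hb Lset _ (hnorm t ht) (fun p hp => one_half_le_norm_emb_add_theta hp t) n n
  have hsum := summable_div_one_add_norm_pow C hl
  have hIoc : ∀ t ∈ Set.uIoc (0 : ℝ) 1, t ∈ Set.Icc (0 : ℝ) 1 := by
    intro t ht
    rw [Set.uIoc_of_le zero_le_one] at ht
    exact ⟨ht.1.le, ht.2⟩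
  have h1 : HasSum (fun n => ∫ t in (0 : ℝ)..1, P n t) (trPow (walkMat h Lset 0) l) := by
    have h2 := intervalIntegral.hasSum_integral_of_dominated_convergence
      (μ := MeasureTheory.volume) (a := 0) (b := 1) (F := P)
      (f := fun _ => trPow (walkMat h Lset 0) l) (fun n _ => C / (1 + ‖n‖) ^ l)
      (fun n => (hPc n).aestronglyMeasurable)
      (fun n => Eventually.of_forall fun t ht => hbd n t (hIoc t ht))
      (Eventually.of_forall fun t _ => hsum) (by simp)
      (Eventually.of_forall fun t ht => ?_)
    · simpa using h2
    · rw [← walkTr_eq_walkTr_zero hr hrot hl (theta_mul_mem_nonsing t)]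
      exact (summable_walk hr (theta_mul_mem_nonsing t) hl).hasSum
  have h2 : ∀ s k : ℤ, ∫ t in (0 : ℝ)..1, P (slab (s, k)) t =
      ∫ t in (k : ℝ)..(k + 1), P (0, s) t := by
    intro s k
    have h3 := intervalIntegral.integral_comp_add_right (a := 0) (b := 1) (fun t => P (0, s) t) (k : ℝ)
    rw [zero_add, add_comm 1] at h3
    rw [← h3]
    congr 1
    funext t
    have h4 : theta * ((t + k : ℝ) : ℂ) = theta * t + emb (k, 2 * k) := by
      simp only [theta, emb]; push_cast; ring
    have hq' : ∀ n : ℤ × ℤ, n + (k, 2 * k) ∈ Lset ↔ n ∈ Lset := by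
      intro n
      change ¬ (3 : ℤ) ∣ n.1 + k + (n.2 + 2 * k) ↔ ¬ (3 : ℤ) ∣ n.1 + n.2
      omega
    simp only [hP]
    rw [h4, powEntry_walkMat_shift hr hq']
    rfl
  have h3 : HasSum (fun p : ℤ × ℤ => ∫ t in (p.2 : ℝ)..(p.2 + 1), P (0, p.1) t)
      (trPow (walkMat h Lset 0) l) := by
    have := (slab.hasSum_iff).2 h1
    simpa only [Function.comp_def, h2] using this
  have h4 : ∀ s : ℤ, HasSum (fun k : ℤ => ∫ t in (k : ℝ)..(k + 1), P (0, s) t) (Real.pi * q s) := by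
    intro s
    have h5 := (h3.summable.prod_factor s).hasSum
    have h6 := h5.comp Finset.tendsto_Ico_neg
    simp only [Function.comp_def, sum_integral_Ico_neg (hPc (0, s))] at h6
    rwa [← tendsto_nhds_unique h6 (hInt s)]
  have h5 := h3.prod_fiberwise h4
  refine ⟨∑ s ∈ Finset.Icc (-(3 * (l * r : ℕ) : ℤ)) (3 * (l * r : ℕ)), q s,
    sum_mem fun s _ => hq s, ?_⟩
  rw [Finset.mul_sum]
  refine h5.unique (hasSum_sum_of_ne_finset_zero fun s hs => ?_)
  rw [hzero s, mul_zero]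
  rw [Finset.mem_Icc, ← abs_le, not_le] at hs
  exact hs

end

section

open Polynomial

theorem isAlgebraic_of_mem_fieldQ {x : ℂ} (hx : x ∈ fieldQ) : IsAlgebraic ℚ x := by
  induction hx using Subfield.closure_induction with
  | mem x hx =>
    rw [Set.mem_singleton_iff.1 hx]
    refine ⟨C 27 * X ^ 6 - 1, ?_, ?_⟩
    · intro h0
      have := congrArg (Polynomial.eval 0) h0
      simp at this
    · have h1 : (ω / (Real.sqrt 3 : ℂ)) ^ 6 = 1 / 27 := by
        rw [div_pow, show (6 : ℕ) = 3 * 2 from rfl, pow_mul, omega_cube, one_pow, mul_comm 3 2,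
          pow_mul, sqrt_three_sq]
        norm_num
      simp [h1]
  | one => exact isAlgebraic_one
  | add x y _ _ hx hy => exact hx.add hy
  | neg x _ hx => exact hx.neg
  | inv x _ hx => exact hx.inv
  | mul x y _ _ hx hy => exact hx.mul hy

theorem transcendental_pi_fieldQ : Transcendental fieldQ (Real.pi : ℂ) := by
  have : Algebra.IsAlgebraic ℚ fieldQ := ⟨fun x =>
    (isAlgebraic_algebraMap_iff (A := ℂ) Subtype.val_injective).1
      (isAlgebraic_of_mem_fieldQ x.2)⟩
  exact transcendental_pi.extendScalars fieldQ

/-- Newton's recursion with power sums `q X + r`. -/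
noncomputable def newtonPoly {F : Type*} [Field F] (q r : ℕ → F) : ℕ → F[X]
  | 0 => 1
  | k + 1 => C (-1 / ((k : F) + 1)) *
      ∑ i : Fin (k + 1), (C (q (k + 1 - i)) * X + C (r (k + 1 - i))) * newtonPoly q r i

theorem newtonPoly_succ {F : Type*} [Field F] (q r : ℕ → F) (k : ℕ) :
    newtonPoly q r (k + 1) = C (-1 / ((k : F) + 1)) *
      ∑ i ∈ Finset.range (k + 1),
        (C (q (k + 1 - i)) * X + C (r (k + 1 - i))) * newtonPoly q r i := by
  rw [newtonPoly, Finset.sum_range]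

theorem newtonPoly_rigid {F : Type*} [Field F] [CharZero F] (q r : ℕ → F) {n : ℕ}
    (h : ∀ k, n < k → newtonPoly q r k = 0) (l : ℕ) : q (l + 1) = 0 := by
  set p := newtonPoly q r with hp
  set d := (Finset.range (n + 1)).sup fun k => (p k).natDegree with hd
  have hdeg : ∀ k, (p k).natDegree ≤ d := by
    intro k
    rcases lt_or_ge n k with hk | hk
    · rw [h k hk]; simp
    · exact Finset.le_sup (f := fun k => (p k).natDegree) (by simpa using Nat.lt_succ_of_le hk)
  obtain ⟨k₀, -, hk₀⟩ := Finset.exists_mem_eq_sup (Finset.range (n + 1)) ⟨0, by simp⟩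
    fun k => (p k).natDegree
  set c : PowerSeries F := PowerSeries.mk fun k => (p k).coeff d with hc
  have hc0 : c ≠ 0 := by
    intro h0
    by_cases hpk : d = 0
    · have h1 := congrArg (PowerSeries.coeff 0) h0
      rw [hc, PowerSeries.coeff_mk, hpk, hp, newtonPoly] at h1
      simp at h1
    · have h1 := congrArg (PowerSeries.coeff k₀) h0
      rw [hc, PowerSeries.coeff_mk, hd, hk₀, coeff_natDegree, map_zero, leadingCoeff_eq_zero] at h1
      rw [h1] at hk₀
      exact hpk (hd.trans (by simpa using hk₀))
  have hmul : c * (PowerSeries.mk fun k => q (k + 1)) = 0 := by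
    ext k
    rw [PowerSeries.coeff_mul, map_zero, Finset.Nat.sum_antidiagonal_eq_sum_range_succ_mk]
    simp only [hc, PowerSeries.coeff_mk]
    have h1 : (p (k + 1)).coeff (d + 1) = 0 :=
      coeff_eq_zero_of_natDegree_lt (Nat.lt_succ_of_le (hdeg _))
    have hk : ((k : F) + 1) ≠ 0 := by exact_mod_cast Nat.succ_ne_zero k
    rw [hp, newtonPoly_succ, coeff_C_mul, mul_eq_zero, finsetSum_coeff] at h1
    have h2 := h1.resolve_left (div_ne_zero (by simp) hk)
    rw [← h2]
    refine Finset.sum_congr rfl fun i hi => ?_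
    have hi' : i ≤ k := Nat.lt_succ_iff.1 (Finset.mem_range.1 hi)
    rw [add_mul, coeff_add, coeff_C_mul, mul_assoc, coeff_C_mul, coeff_X_mul,
      coeff_eq_zero_of_natDegree_lt (Nat.lt_succ_of_le (hdeg i)), mul_zero, add_zero, mul_comm,
      Nat.sub_add_comm hi']
  have h1 := (mul_eq_zero.1 hmul).resolve_left hc0
  have h2 := congrArg (PowerSeries.coeff l) h1
  simpa using h2

/-- Power sums `π q + r` over `ℚ(ω/√3)` with a terminating Newton sequence have `q = 0`. -/
theorem eq_zero_of_newtonSeq_eventually_zero {q r : ℕ → ℂ} (hq : ∀ l, q l ∈ fieldQ)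
    (hr : ∀ l, r l ∈ fieldQ) {s : ℕ → ℂ} (hs : ∀ l, s (l + 1) = Real.pi * q (l + 1) + r (l + 1))
    {n : ℕ} (h : ∀ k, n < k → newtonSeq s k = 0) (l : ℕ) : q (l + 1) = 0 := by
  set q' : ℕ → fieldQ := fun l => ⟨q l, hq l⟩
  set r' : ℕ → fieldQ := fun l => ⟨r l, hr l⟩
  have key : ∀ k, aeval (Real.pi : ℂ) (newtonPoly q' r' k) = newtonSeq s k := by
    intro k
    induction k using Nat.strong_induction_on with
    | _ k ih =>
      cases k with
      | zero => simp [newtonPoly, newtonSeq]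
      | succ k =>
        have e1 : ∀ x y : ℂ, -x / y = -1 / y * x := fun x y => by ring
        rw [newtonPoly_succ, newtonSeq_succ, map_mul, aeval_C, map_sum, e1]
        congr 1
        refine Finset.sum_congr rfl fun i hi => ?_
        rw [map_mul, ih i (Finset.mem_range.1 hi), map_add, map_mul, aeval_C, aeval_C, aeval_X]
        congr 1
        obtain ⟨j, hj⟩ : ∃ j, k + 1 - i = j + 1 :=
          ⟨k - i, Nat.sub_add_comm (Nat.lt_succ_iff.1 (Finset.mem_range.1 hi))⟩
        rw [hj, hs, mul_comm]
        rfl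
  have h1 := newtonPoly_rigid q' r' (n := n) (fun k hk => by
    by_contra hne
    exact transcendental_pi_fieldQ ⟨_, hne, (key k).trans (h k hk)⟩) l
  exact congrArg Subtype.val h1

end

section

open Filter Topology

variable {h : ℤ × ℤ → ℂ} {r : ℕ}

/-- The fourth power of the walk matrix on `Lset` at quasimomentum `0`. -/
noncomputable def fourMat (h : ℤ × ℤ → ℂ) : ℤ × ℤ → ℤ × ℤ → ℂ := powEntry (walkMat h Lset 0) 4

/-- Average of a matrix over the rotations acting from the left. -/
noncomputable def avg (M : ℤ × ℤ → ℤ × ℤ → ℂ) (n m : ℤ × ℤ) : ℂ :=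
  (M n m + M (rot n) m + M (rot (rot n)) m) / 3

/-- The part of `fourMat` acting on rotation invariant vectors. -/
noncomputable def secMat (h : ℤ × ℤ → ℂ) : ℤ × ℤ → ℤ × ℤ → ℂ := avg (fourMat h)

theorem powEntry_fourMat (hr : ∀ j, h j ≠ 0 → ‖j‖ ≤ r) (l : ℕ) (n m : ℤ × ℤ) :
    powEntry (fourMat h) l n m = powEntry (walkMat h Lset 0) (4 * l) n m :=
  (walkMat_hasRange hr _ _).powEntry_powEntry 4 l n m

theorem trPow_fourMat (hr : ∀ j, h j ≠ 0 → ‖j‖ ≤ r) (l : ℕ) :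
    trPow (fourMat h) l = trPow (walkMat h Lset 0) (4 * l) :=
  tsum_congr fun n => powEntry_fourMat hr l n n

theorem fourMat_hasRange (hr : ∀ j, h j ≠ 0 → ‖j‖ ≤ r) : HasRange (fourMat h) (4 * r) :=
  (walkMat_hasRange hr _ _).powEntry 4

open Classical in
theorem walkMat_rot (hrot : ∀ j, h (rot j) = ω * h j) (n m : ℤ × ℤ) :
    walkMat h Lset 0 (rot n) (rot m) = walkMat h Lset 0 n m := by
  rw [walkMat, walkMat, ← map_sub, hrot, emb_rot, add_zero, add_zero,
    mul_div_mul_left _ _ omega_ne_zero]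
  exact if_congr (and_congr rot_mem_Lset rot_mem_Lset) rfl rfl

theorem powEntry_rot {M : ℤ × ℤ → ℤ × ℤ → ℂ} (hM : ∀ n m, M (rot n) (rot m) = M n m) (l : ℕ)
    (n m : ℤ × ℤ) : powEntry M l (rot n) (rot m) = powEntry M l n m := by
  induction l generalizing n with
  | zero => simp [powEntry]
  | succ l ih =>
    rw [powEntry, powEntry, ← rot.toEquiv.tsum_eq]
    exact tsum_congr fun k => congrArg₂ _ (hM n k) (ih k)

theorem avg_rot (M : ℤ × ℤ → ℤ × ℤ → ℂ) (n m : ℤ × ℤ) : avg M (rot n) m = avg M n m := by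
  simp only [avg, rot_rot_rot]; ring

theorem powEntry_avg {M : ℤ × ℤ → ℤ × ℤ → ℂ} {s : ℕ} (hs : HasRange M s)
    (hM : ∀ n m, M (rot n) (rot m) = M n m) (l : ℕ) (n m : ℤ × ℤ) :
    powEntry (avg M) (l + 1) n m = avg (powEntry M (l + 1)) n m := by
  have hone : ∀ (A : ℤ × ℤ → ℤ × ℤ → ℂ) n m, powEntry A 1 n m = A n m := by
    intro A n m
    rw [powEntry, tsum_eq_single m]
    · simp [powEntry]
    · intro k hk; simp [powEntry, hk]
  have hsum : ∀ (n : ℤ × ℤ) (f : ℤ × ℤ → ℂ), Summable fun k => M n k * f k := by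
    intro n f
    refine summable_of_hasFiniteSupport ((finite_norm_le (s + ‖n‖)).subset fun k hk => ?_)
    have h1 := hs n k (left_ne_zero_of_mul hk)
    have h2 : ‖k‖ ≤ ‖n - k‖ + ‖n‖ := by
      rw [add_comm]; simpa using norm_sub_le n (n - k)
    simp only [Set.mem_ofPred_eq]
    linarith
  induction l generalizing n with
  | zero => simp only [zero_add, hone, avg]
  | succ l ih =>
    have hsa : ∀ (n : ℤ × ℤ) (f : ℤ × ℤ → ℂ) , ∑' k, avg M n k * f k =
        (∑' k, M n k * f k + ∑' k, M (rot n) k * f k + ∑' k, M (rot (rot n)) k * f k) / 3 := by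
      intro n f
      rw [← (hsum n f).tsum_add (hsum _ f), ← ((hsum n f).add (hsum _ f)).tsum_add (hsum _ f),
        ← tsum_div_const]
      exact tsum_congr fun k => by rw [avg]; ring
    have hsf : ∀ n, ∑' k, M n k * avg (powEntry M (l + 1)) k m =
        avg (powEntry M (l + 2)) n m := by
      intro n
      have e1 : ∀ n, ∑' k, M n k * powEntry M (l + 1) (rot k) m =
          powEntry M (l + 2) (rot n) m := by
        intro n
        rw [powEntry, ← rot.toEquiv.tsum_eq fun k => M (rot n) k * powEntry M (l + 1) k m]
        exact tsum_congr fun k => by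
          rw [← hM n k]; rfl
      have e2 : ∀ n, ∑' k, M n k * powEntry M (l + 1) (rot (rot k)) m =
          powEntry M (l + 2) (rot (rot n)) m := by
        intro n
        rw [← e1 (rot n),
          ← rot.toEquiv.tsum_eq fun k => M (rot n) k * powEntry M (l + 1) (rot k) m]
        exact tsum_congr fun k => by
          rw [← hM n k]; rfl
      rw [avg, ← e2, ← e1, powEntry, ← (hsum n _).tsum_add (hsum n _),
        ← ((hsum n _).add (hsum n _)).tsum_add (hsum n _), ← tsum_div_const]
      exact tsum_congr fun k => by rw [avg]; ring
    rw [powEntry]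
    simp only [ih]
    rw [hsa, hsf, hsf, hsf, avg_rot, avg_rot, avg_rot]
    ring

/-- A common majorant of the matrices `fourMat h` and `secMat h` for bounded `h` of given range. -/
theorem exists_absSummable_majorant (H : ℝ) (r : ℕ) : ∃ G : ℤ × ℤ → ℤ × ℤ → ℂ, AbsSummable G ∧
    ∀ h : ℤ × ℤ → ℂ, (∀ j, h j ≠ 0 → ‖j‖ ≤ r) → (∀ j, ‖h j‖ ≤ H) →
      (∀ n m, ‖fourMat h n m‖ ≤ ‖G n m‖) ∧ ∀ n m, ‖secMat h n m‖ ≤ ‖G n m‖ := by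
  by_cases hH : 0 ≤ H
  swap
  · exact ⟨_, absSummable_majorant 0 0, fun h _ hb =>
      absurd ((norm_nonneg _).trans (hb 0)) hH⟩
  obtain ⟨δ, hδ, hgap⟩ := exists_gap Lset zero_mem_nonsing
  obtain ⟨C, hC, hb⟩ := exists_powEntry_bound (H * ((1 + 2 * 0) / δ + 2)) (by positivity) r 4
  set E : ℤ × ℤ → ℤ × ℤ → ℝ :=
    fun n m => if ‖n - m‖ ≤ (4 * r : ℕ) then C / (1 + ‖n‖) ^ 4 else 0 with hE
  have hE0 : ∀ n m, 0 ≤ E n m := fun n m => by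
    simp only [hE]; split_ifs <;> positivity
  have hS : AbsSummable fun n m => (E n m : ℂ) := absSummable_majorant C (4 * r)
  have hrotS : ∀ {A : ℤ × ℤ → ℤ × ℤ → ℂ}, AbsSummable A → AbsSummable fun n m => A (rot n) m :=
    fun hA => (rot.toEquiv.prodCongr (Equiv.refl _)).summable_iff.2 hA
  have hfour : ∀ h : ℤ × ℤ → ℂ, (∀ j, h j ≠ 0 → ‖j‖ ≤ r) → (∀ j, ‖h j‖ ≤ H) →
      ∀ n m, ‖fourMat h n m‖ ≤ E n m := by
    intro h hr hh n m
    simp only [hE]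
    split_ifs with hnm
    · exact hb _ (walkMat_hasRange hr _ _)
        (norm_walkMat_le hh hδ (by simp) hgap) n m
    · rw [norm_le_zero_iff]
      by_contra hne
      exact hnm (fourMat_hasRange hr n m hne)
  refine ⟨fun n m => (E n m + E (rot n) m + E (rot (rot n)) m : ℝ), ?_, fun h hr hh => ⟨?_, ?_⟩⟩
  · have := ((hS.add (hrotS hS)).add (hrotS (hrotS hS)))
    refine this.congr fun p => ?_
    simp only [Complex.norm_real, Real.norm_eq_abs, abs_of_nonneg (hE0 _ _)]
    rw [abs_of_nonneg]
    exact add_nonneg (add_nonneg (hE0 _ _) (hE0 _ _)) (hE0 _ _)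
  · intro n m
    rw [Complex.norm_real]
    refine (hfour h hr hh n m).trans (le_trans ?_ (le_abs_self _))
    linarith [hE0 (rot n) m, hE0 (rot (rot n)) m]
  · intro n m
    rw [Complex.norm_real, secMat, avg, norm_div]
    refine le_trans ?_ (le_abs_self _)
    have h1 := hfour h hr hh n m
    have h2 := hfour h hr hh (rot n) m
    have h3 := hfour h hr hh (rot (rot n)) m
    have h4 := norm_add₃_le (a := fourMat h n m) (b := fourMat h (rot n) m)
      (c := fourMat h (rot (rot n)) m)
    rw [div_le_iff₀ (by norm_num)]
    norm_num
    linarith [hE0 n m, hE0 (rot n) m, hE0 (rot (rot n)) m]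

theorem absSummable_fourMat (hr : ∀ j, h j ≠ 0 → ‖j‖ ≤ r) : AbsSummable (fourMat h) := by
  obtain ⟨H, hH⟩ := exists_norm_le_of_support hr
  obtain ⟨G, hG, hb⟩ := exists_absSummable_majorant H r
  exact hG.of_norm_le (hb h hr hH).1

theorem absSummable_secMat (hr : ∀ j, h j ≠ 0 → ‖j‖ ≤ r) : AbsSummable (secMat h) := by
  obtain ⟨H, hH⟩ := exists_norm_le_of_support hr
  obtain ⟨G, hG, hb⟩ := exists_absSummable_majorant H r
  exact hG.of_norm_le (hb h hr hH).2

theorem tendsto_fourMat {h' : ℕ → ℤ × ℤ → ℂ} (hr : ∀ j, h j ≠ 0 → ‖j‖ ≤ r)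
    (hr' : ∀ i j, h' i j ≠ 0 → ‖j‖ ≤ r) (hh : ∀ j, Tendsto (fun i => h' i j) atTop (𝓝 (h j)))
    (n m : ℤ × ℤ) : Tendsto (fun i => fourMat (h' i) n m) atTop (𝓝 (fourMat h n m)) := by
  simp only [fourMat]
  generalize 4 = l
  induction l generalizing n with
  | zero => exact tendsto_const_nhds
  | succ l ih =>
    rw [(walkMat_hasRange hr _ _).powEntry_succ]
    simp only [fun i => (walkMat_hasRange (hr' i) Lset 0).powEntry_succ]
    refine tendsto_finsetSum _ fun j _ => Tendsto.mul ?_ (ih _)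
    by_cases hA : n ∈ Lset ∧ n - j ∈ Lset
    · simp only [walkMat, hA, and_self, if_true]
      exact (hh _).div_const _
    · simp only [walkMat, hA, if_false]
      exact tendsto_const_nhds

theorem exists_uniform_bound {h' : ℕ → ℤ × ℤ → ℂ} (hr' : ∀ i j, h' i j ≠ 0 → ‖j‖ ≤ r)
    (hh : ∀ j, Tendsto (fun i => h' i j) atTop (𝓝 (h j))) : ∃ H, ∀ i j, ‖h' i j‖ ≤ H := by
  choose H hH using fun j => (hh j).norm.bddAbove_range
  refine ⟨∑ j ∈ box r, |H j|, fun i j => ?_⟩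
  by_cases hj : h' i j = 0
  · rw [hj, norm_zero]; exact Finset.sum_nonneg fun _ _ => abs_nonneg _
  · refine le_trans ((hH j ⟨i, rfl⟩).trans (le_abs_self _)) ?_
    exact Finset.single_le_sum (f := fun j => |H j|) (fun _ _ => abs_nonneg _)
      (mem_box.2 (hr' i j hj))

theorem tendsto_trPow_fourMat {h' : ℕ → ℤ × ℤ → ℂ} (hr : ∀ j, h j ≠ 0 → ‖j‖ ≤ r)
    (hr' : ∀ i j, h' i j ≠ 0 → ‖j‖ ≤ r) (hh : ∀ j, Tendsto (fun i => h' i j) atTop (𝓝 (h j)))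
    (l : ℕ) :
    Tendsto (fun i => trPow (fourMat (h' i)) (l + 1)) atTop (𝓝 (trPow (fourMat h) (l + 1))) := by
  obtain ⟨H, hH⟩ := exists_uniform_bound hr' hh
  obtain ⟨G, hG, hb⟩ := exists_absSummable_majorant H r
  exact tendsto_trPow hG (fun i => (hb (h' i) (hr' i) (hH i)).1) (tendsto_fourMat hr hr' hh) l

theorem tendsto_newtonSeq_secMat {h' : ℕ → ℤ × ℤ → ℂ} (hr : ∀ j, h j ≠ 0 → ‖j‖ ≤ r)
    (hr' : ∀ i j, h' i j ≠ 0 → ‖j‖ ≤ r) (hh : ∀ j, Tendsto (fun i => h' i j) atTop (𝓝 (h j)))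
    (k : ℕ) : Tendsto (fun i => newtonSeq (trPow (secMat (h' i))) k) atTop
      (𝓝 (newtonSeq (trPow (secMat h)) k)) := by
  obtain ⟨H, hH⟩ := exists_uniform_bound hr' hh
  obtain ⟨G, hG, hb⟩ := exists_absSummable_majorant H r
  refine tendsto_newtonSeq (tendsto_trPow hG (fun i => (hb (h' i) (hr' i) (hH i)).2)
    fun n m => ?_) k
  have := tendsto_fourMat hr hr' hh
  exact (((this n m).add (this _ m)).add (this _ m)).div_const 3

theorem powEntry_walkMat_mem_fieldQ (hr : ∀ j, h j ≠ 0 → ‖j‖ ≤ r) (hF : ∀ j, h j ∈ fieldQ)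
    (l : ℕ) (n m : ℤ × ℤ) : powEntry (walkMat h Lset 0) l n m ∈ fieldQ := by
  induction l generalizing n with
  | zero => rw [powEntry]; split_ifs; exacts [one_mem _, zero_mem _]
  | succ l ih =>
    rw [(walkMat_hasRange hr _ _).powEntry_succ]
    refine sum_mem fun j _ => mul_mem ?_ (ih _)
    rw [walkMat]
    split_ifs
    · rw [add_zero]; exact div_mem (hF _) (emb_mem _)
    · exact zero_mem _

theorem tsum_mem_fieldQ {f : ℤ × ℤ → ℂ} (hf : ∀ n, f n ∈ fieldQ) (hs : f.support.Finite) :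
    ∑' n, f n ∈ fieldQ := by
  rw [tsum_eq_sum (s := hs.toFinset) fun n hn => by simpa using hn]
  exact sum_mem fun n _ => hf n

theorem norm_le_rot_sub (n : ℤ × ℤ) : ‖n‖ ≤ 4 * ‖rot n - n‖ := by
  have h1 := norm_le_two_mul_norm_emb n
  have h2 := norm_emb_le (rot n - n)
  have h3 : ‖emb (rot n - n)‖ = ‖ω - 1‖ * ‖emb n‖ := by
    rw [← norm_mul, emb_sub, emb_rot]; congr 1; ring
  have h4 : 1 ≤ ‖ω - 1‖ := by
    have := Complex.abs_re_le_norm (ω - 1)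
    rw [Complex.sub_re, omega_re, Complex.one_re] at this
    norm_num at this
    linarith
  nlinarith [norm_nonneg (emb n)]

/-- For weights in `ℚ(ω/√3)`, a terminating Fredholm expansion in the invariant sector forces all
traces to vanish. -/
theorem trPow_fourMat_eq_zero (hr : ∀ j, h j ≠ 0 → ‖j‖ ≤ r) (hrot : ∀ j, h (rot j) = ω * h j)
    (hF : ∀ j, h j ∈ fieldQ) {n : ℕ} (hn : ∀ k, n < k → newtonSeq (trPow (secMat h)) k = 0)
    (l : ℕ) : trPow (fourMat h) (l + 1) = 0 := by
  have hq : ∀ l, ∃ q ∈ fieldQ, trPow (fourMat h) (l + 1) = Real.pi * q := fun l => by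
    rw [trPow_fourMat hr]
    exact exists_walkTr_eq_pi_mul hr hrot hF (by omega)
  choose q hqF hq using hq
  set M := fun l => powEntry (fourMat h) (l + 1)
  have hMF : ∀ l n m, M l n m ∈ fieldQ := fun l n m => by
    simp only [M]
    rw [powEntry_fourMat hr]; exact powEntry_walkMat_mem_fieldQ hr hF _ _ _
  have hsupp : ∀ l, (fun n => M l (rot n) n).support.Finite := fun l => by
    refine (finite_norm_le (4 * ((l + 1) * (4 * r) : ℕ))).subset fun n hn => ?_
    have h1 := (fourMat_hasRange hr).powEntry (l + 1) (rot n) n hn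
    exact (norm_le_rot_sub n).trans (by gcongr)
  have hMrot : ∀ l n m, M l (rot n) (rot m) = M l n m := fun l n m =>
    powEntry_rot (powEntry_rot (walkMat_rot hrot) 4) (l + 1) n m
  have hsupp2 : ∀ l, (fun n => M l (rot (rot n)) n).support.Finite := fun l => by
    refine (finite_norm_le (4 * ((l + 1) * (4 * r) : ℕ))).subset fun n hn => ?_
    have hn' : M l (rot (rot n)) n ≠ 0 := hn
    rw [← hMrot, rot_rot_rot] at hn'
    have h1 := (fourMat_hasRange hr).powEntry (l + 1) n (rot n) hn'
    rw [norm_sub_rev] at h1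
    exact (norm_le_rot_sub n).trans (by gcongr)
  have hq3 : ∀ l, trPow (secMat h) (l + 1) = Real.pi * (q l / 3) +
      (∑' n, M l (rot n) n + ∑' n, M l (rot (rot n)) n) / 3 := fun l => by
    have hsum : Summable fun n => M l n n := by
      have := summable_walk hr (h := h) (A := Lset) zero_mem_nonsing
        (l := 4 * (l + 1)) (by omega)
      exact this.congr fun n => (powEntry_fourMat hr _ _ _).symm
    have e1 : trPow (secMat h) (l + 1) =
        ∑' n, (M l n n + M l (rot n) n + M l (rot (rot n)) n) / 3 :=
      tsum_congr fun n => powEntry_avg (fourMat_hasRange hr)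
        (powEntry_rot (walkMat_rot hrot) 4) l n n
    have s1 : Summable fun n => M l (rot n) n := summable_of_hasFiniteSupport (hsupp l)
    have s2 : Summable fun n => M l (rot (rot n)) n := summable_of_hasFiniteSupport (hsupp2 l)
    rw [e1, tsum_div_const, (hsum.add s1).tsum_add s2, hsum.tsum_add s1]
    have : ∑' n, M l n n = Real.pi * q l := hq l
    rw [this]; ring
  have key := eq_zero_of_newtonSeq_eventually_zero
    (q := fun l => q (l - 1) / 3)
    (r := fun l => (∑' n, M (l - 1) (rot n) n + ∑' n, M (l - 1) (rot (rot n)) n) / 3)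
    (fun l => div_mem (hqF _) (natCast_mem _ 3))
    (fun l => div_mem (add_mem (tsum_mem_fieldQ (fun n => hMF _ _ _) (hsupp _))
      (tsum_mem_fieldQ (fun n => hMF _ _ _) (hsupp2 _))) (natCast_mem _ 3)) hq3 hn l
  rw [hq]
  simp only [Nat.add_sub_cancel] at key
  rw [(div_eq_zero_iff.1 key).resolve_right (by norm_num), mul_zero]

end

section

open Filter Topology

variable {h : ℤ × ℤ → ℂ} {r : ℕ}

/-- A fourth root of an eigenvalue of a fourth power is, up to a root of unity, an eigenvalue. -/
theorem exists_fourth_root {V : Type*} [AddCommGroup V] [Module ℂ V] (f : Module.End ℂ V) {x : ℂ}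
    {v : V} (hv : v ≠ 0) (h : x • (f ^ 4) v = v) :
    ∃ μ : ℂ, μ ^ 4 = x ∧ ∃ w, w = v + μ • f v + μ ^ 2 • (f ^ 2) v + μ ^ 3 • (f ^ 3) v ∧ w ≠ 0 ∧
      μ • f w = w := by
  obtain ⟨ν, hν⟩ := IsAlgClosed.exists_pow_nat_eq x (n := 4) (by norm_num)
  set W : ℂ → V := fun μ => v + μ • f v + μ ^ 2 • (f ^ 2) v + μ ^ 3 • (f ^ 3) v with hW
  have hfix : ∀ μ : ℂ, μ ^ 4 = x → μ • f (W μ) = W μ := by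
    intro μ hμ
    have e2 : f (f v) = (f ^ 2) v := by rw [pow_two]; rfl
    have e3 : f ((f ^ 2) v) = (f ^ 3) v := by rw [pow_succ' f 2]; rfl
    have e4 : f ((f ^ 3) v) = (f ^ 4) v := by rw [pow_succ' f 3]; rfl
    simp only [hW, map_add, map_smul, smul_add, e2, e3, e4, smul_smul]
    have : (μ * μ ^ 3) • (f ^ 4) v = v := by
      rw [← pow_succ', hμ, h]
    rw [this]
    module
  by_contra! hcon
  have hzero : ∀ μ : ℂ, μ ^ 4 = x → W μ = 0 := fun μ hμ => by
    by_contra hne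
    exact hcon μ hμ (W μ) rfl hne (hfix μ hμ)
  have hI2 := Complex.I_sq
  have h0 := hzero ν hν
  have h1 := hzero (-ν) (by rw [← hν]; ring)
  have h2 := hzero (Complex.I * ν) (by rw [← hν, mul_pow, Complex.I_pow_four, one_mul])
  have h3 := hzero (-(Complex.I * ν)) (by rw [← hν, neg_pow, mul_pow, Complex.I_pow_four]; ring)
  have hs : W ν + W (-ν) + (W (Complex.I * ν) + W (-(Complex.I * ν))) = (4 : ℂ) • v := by
    simp only [hW, neg_pow ν, neg_pow (Complex.I * ν), mul_pow, Complex.I_sq]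
    module
  rw [h0, h1, h2, h3, add_zero, add_zero] at hs
  exact hv ((smul_eq_zero.1 hs.symm).resolve_left (by norm_num))

/-- The operator of the walk matrix at quasimomentum `0`. -/
noncomputable def walkOp (h : ℤ × ℤ → ℂ) (r : ℕ) : Module.End ℂ (ℤ × ℤ → ℂ) where
  toFun v n := ∑ j ∈ box r, walkMat h Lset 0 n (n - j) * v (n - j)
  map_add' v w := by
    funext n
    simp only [Pi.add_apply, mul_add, Finset.sum_add_distrib]
  map_smul' c v := by
    funext n
    simp only [Pi.smul_apply, smul_eq_mul, Finset.mul_sum, RingHom.id_apply]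
    exact Finset.sum_congr rfl fun j _ => by ring

theorem walkOp_apply (v : ℤ × ℤ → ℂ) (n : ℤ × ℤ) :
    walkOp h r v n = ∑ j ∈ box r, walkMat h Lset 0 n (n - j) * v (n - j) := rfl

theorem walkOp_pow (hr : ∀ j, h j ≠ 0 → ‖j‖ ≤ r) (l : ℕ) (v : ℤ × ℤ → ℂ) (n : ℤ × ℤ) :
    (walkOp h r ^ l) v n = ∑' m, powEntry (walkMat h Lset 0) l n m * v m := by
  have hR := walkMat_hasRange hr Lset 0
  induction l generalizing n with
  | zero =>
    rw [tsum_eq_single n]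
    · simp [powEntry]
    · intro k hk; simp [powEntry, hk.symm]
  | succ l ih =>
    rw [pow_succ', Module.End.mul_apply, walkOp_apply]
    simp only [ih, hR.powEntry_succ, Finset.sum_mul]
    rw [Summable.tsum_finsetSum]
    · refine Finset.sum_congr rfl fun j _ => ?_
      rw [← tsum_mul_left]
      exact tsum_congr fun m => by ring
    · intro j _
      refine summable_of_hasFiniteSupport
        ((finite_norm_le ((l * r : ℕ) + ‖n - j‖)).subset fun k hk => ?_)
      have h1 := hR.powEntry l (n - j) k (right_ne_zero_of_mul (left_ne_zero_of_mul hk))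
      have h2 : ‖k‖ ≤ ‖n - j - k‖ + ‖n - j‖ := by
        rw [add_comm]; simpa using norm_sub_le (n - j) (n - j - k)
      simp only [Set.mem_ofPred_eq]
      linarith

theorem walkOp_eq_tsum (hr : ∀ j, h j ≠ 0 → ‖j‖ ≤ r) (v : ℤ × ℤ → ℂ) (n : ℤ × ℤ) :
    walkOp h r v n = ∑' m, walkMat h Lset 0 n m * v m :=
  ((walkMat_hasRange hr Lset 0).tsum_eq n v).symm

theorem walkOp_bounded (hr : ∀ j, h j ≠ 0 → ‖j‖ ≤ r) (l : ℕ) {v : ℤ × ℤ → ℂ}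
    (hv : ∃ B : ℝ, ∀ n, ‖v n‖ ≤ B) :
    ∃ B : ℝ, ∀ n, ‖(walkOp h r ^ l) v n‖ ≤ B / (1 + ‖n‖) ^ l := by
  obtain ⟨B, hB⟩ := hv
  have hB0 : 0 ≤ B := (norm_nonneg _).trans (hB 0)
  obtain ⟨δ, hδ, hgap⟩ := exists_gap Lset zero_mem_nonsing
  obtain ⟨C, hC, hb⟩ := exists_walk_bound hr hδ (ρ := 0) le_rfl l
  refine ⟨(box (l * r)).card * (C * B), fun n => ?_⟩
  rw [walkOp_pow hr, ((walkMat_hasRange hr Lset 0).powEntry l).tsum_eq n v]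
  refine (norm_sum_le_of_le _ (f := fun j => _) (n := fun _ => C / (1 + ‖n‖) ^ l * B)
    fun j _ => ?_).trans (le_of_eq ?_)
  · rw [norm_mul]
    exact mul_le_mul (hb _ 0 (by simp) hgap _ _) (hB _) (norm_nonneg _) (by positivity)
  · rw [Finset.sum_const, nsmul_eq_mul]; ring

theorem walkOp_supported (v : ℤ × ℤ → ℂ) {n : ℤ × ℤ} (hn : n ∉ Lset) : walkOp h r v n = 0 :=
  Finset.sum_eq_zero fun j _ => by simp [walkMat, hn]

theorem walkOp_rot (hr : ∀ j, h j ≠ 0 → ‖j‖ ≤ r) (hrot : ∀ j, h (rot j) = ω * h j)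
    {v : ℤ × ℤ → ℂ} (hv : ∀ n, v (rot n) = v n) (n : ℤ × ℤ) :
    walkOp h r v (rot n) = walkOp h r v n := by
  rw [walkOp_eq_tsum hr, walkOp_eq_tsum hr, ← rot.toEquiv.tsum_eq]
  exact tsum_congr fun k => congrArg₂ _ (walkMat_rot hrot n k) (hv k)

theorem rapid_decay (hr : ∀ j, h j ≠ 0 → ‖j‖ ≤ r) {w : ℤ × ℤ → ℂ} {μ : ℂ}
    (hb : ∃ B : ℝ, ∀ n, ‖w n‖ ≤ B) (hw : μ • walkOp h r w = w) (l : ℕ) :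
    ∃ B : ℝ, ∀ n, ‖w n‖ ≤ B / (1 + ‖n‖) ^ l := by
  have hpow : ∀ l, μ ^ l • (walkOp h r ^ l) w = w := by
    intro l
    induction l with
    | zero => simp
    | succ l ih =>
      rw [pow_succ' (walkOp h r), Module.End.mul_apply, pow_succ', mul_smul, ← map_smul, ih, hw]
  obtain ⟨B, hB⟩ := walkOp_bounded hr l hb
  refine ⟨‖μ ^ l‖ * B, fun n => ?_⟩
  rw [← hpow l, Pi.smul_apply, smul_eq_mul, norm_mul, mul_div_assoc]
  exact mul_le_mul_of_nonneg_left (hB n) (norm_nonneg _)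

/-- Eigenvectors in the invariant sector give rotation invariant fixed vectors of the walk. -/
theorem exists_invariant_vector (hr : ∀ j, h j ≠ 0 → ‖j‖ ≤ r) (hrot : ∀ j, h (rot j) = ω * h j)
    {x : ℂ} (hx : IsEig (secMat h) x) : ∃ μ : ℂ, μ ^ 4 = x ∧ ∃ w : ℤ × ℤ → ℂ, w ≠ 0 ∧
      (∀ n ∉ Lset, w n = 0) ∧ (∀ n, w (rot n) = w n) ∧ μ • walkOp h r w = w ∧
      ∀ l : ℕ, ∃ B : ℝ, ∀ n, ‖w n‖ ≤ B / (1 + ‖n‖) ^ l := by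
  obtain ⟨v, hv, hb, hvx⟩ := hx
  have hvrot : ∀ n, v (rot n) = v n := fun n => by
    rw [hvx, hvx n]; simp only [secMat, avg_rot]
  have hS : ∀ n, Summable fun m => fourMat h n m * v m := by
    intro n
    refine summable_of_hasFiniteSupport
      ((finite_norm_le ((4 * r : ℕ) + ‖n‖)).subset fun k hk => ?_)
    have h1 := fourMat_hasRange hr n k (left_ne_zero_of_mul hk)
    have h2 : ‖k‖ ≤ ‖n - k‖ + ‖n‖ := by
      rw [add_comm]; simpa using norm_sub_le n (n - k)
    simp only [Set.mem_ofPred_eq]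
    linarith
  have hSrot : ∀ n, ∑' m, fourMat h (rot n) m * v m = ∑' m, fourMat h n m * v m := by
    intro n
    rw [← rot.toEquiv.tsum_eq]
    exact tsum_congr fun k => congrArg₂ _ (powEntry_rot (walkMat_rot hrot) 4 n k) (hvrot k)
  have hG : ∀ n, ∑' m, secMat h n m * v m = ∑' m, fourMat h n m * v m := by
    intro n
    have : ∑' m, secMat h n m * v m = (∑' m, fourMat h n m * v m +
        ∑' m, fourMat h (rot n) m * v m + ∑' m, fourMat h (rot (rot n)) m * v m) / 3 := by
      rw [← (hS n).tsum_add (hS _), ← ((hS n).add (hS _)).tsum_add (hS _), ← tsum_div_const]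
      exact tsum_congr fun k => by rw [secMat, avg]; ring
    rw [this, hSrot (rot n), hSrot]; ring
  have h4 : x • (walkOp h r ^ 4) v = v := by
    funext n
    rw [Pi.smul_apply, smul_eq_mul, walkOp_pow hr, hvx n, hG]
    rfl
  obtain ⟨μ, hμ, w, hwdef, hw0, hw⟩ := exists_fourth_root _ hv h4
  have hprot : ∀ l n, (walkOp h r ^ l) v (rot n) = (walkOp h r ^ l) v n := by
    intro l
    induction l with
    | zero => exact hvrot
    | succ l ih =>
      intro n
      rw [pow_succ', Module.End.mul_apply, walkOp_rot hr hrot ih]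
  have hpb : ∀ l, ∃ B : ℝ, ∀ n, ‖(walkOp h r ^ l) v n‖ ≤ B := by
    intro l
    obtain ⟨B, hB⟩ := walkOp_bounded hr l hb
    refine ⟨|B|, fun n => (hB n).trans ((div_le_div_of_nonneg_right (le_abs_self B)
      (by positivity)).trans (div_le_self (abs_nonneg _) (one_le_pow₀ ?_)))⟩
    linarith [norm_nonneg n]
  refine ⟨μ, hμ, w, hw0, fun n hn => ?_, fun n => ?_, hw, rapid_decay hr ?_ hw⟩
  · rw [← hw, Pi.smul_apply, walkOp_supported w hn, smul_zero]
  · have h1 := hprot 1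
    rw [pow_one] at h1
    simp only [hwdef, Pi.add_apply, Pi.smul_apply, hvrot, h1, hprot]
  · obtain ⟨B0, hB0⟩ := hb
    obtain ⟨B1, hB1⟩ := hpb 1
    obtain ⟨B2, hB2⟩ := hpb 2
    obtain ⟨B3, hB3⟩ := hpb 3
    rw [pow_one] at hB1
    refine ⟨B0 + ‖μ‖ * B1 + ‖μ ^ 2‖ * B2 + ‖μ ^ 3‖ * B3, fun n => ?_⟩
    rw [hwdef]
    refine norm_add_le_of_le (norm_add_le_of_le (norm_add_le_of_le (hB0 n) ?_) ?_) ?_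
    all_goals
      rw [Pi.smul_apply, smul_eq_mul, norm_mul]
      gcongr
    exacts [hB1 n, hB2 n, hB3 n]

theorem isEig_fourMat (hr : ∀ j, h j ≠ 0 → ‖j‖ ≤ r) {w : ℤ × ℤ → ℂ} {μ : ℂ} (hw0 : w ≠ 0)
    (hb : ∃ B : ℝ, ∀ n, ‖w n‖ ≤ B) (hw : μ • walkOp h r w = w) : IsEig (fourMat h) (μ ^ 4) := by
  refine ⟨w, hw0, hb, fun n => ?_⟩
  have hpow : ∀ l, μ ^ l • (walkOp h r ^ l) w = w := by
    intro l
    induction l with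
    | zero => simp
    | succ l ih =>
      rw [pow_succ' (walkOp h r), Module.End.mul_apply, pow_succ', mul_smul, ← map_smul, ih, hw]
  have := congrFun (hpow 4) n
  rw [Pi.smul_apply, smul_eq_mul, walkOp_pow hr] at this
  exact this.symm

end

section

open Filter Topology Complex

/-- The real linear phase `⟨K n, ·⟩`. -/
noncomputable def freq (n : ℤ × ℤ) : ℂ →L[ℝ] ℝ :=
  (K * emb n).re • Complex.reCLM + (K * emb n).im • Complex.imCLM

/-- The plane wave with frequency `K n`. -/
noncomputable def ee (n : ℤ × ℤ) (z : ℂ) : ℂ := Complex.exp (Complex.I * (freq n z : ℝ))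

theorem freq_apply (n : ℤ × ℤ) (z : ℂ) : freq n z = pair (K * emb n) z := by
  simp [freq, pair, Complex.mul_re]

theorem K_eq : K = ((4 * Real.pi / 3 : ℝ) : ℂ) := by simp [K]

theorem K_ne_zero : K ≠ 0 := by
  rw [K_eq]; exact_mod_cast (by positivity : (4 * Real.pi / 3 : ℝ) ≠ 0)

theorem freq_eq (n : ℤ × ℤ) (z : ℂ) :
    freq n z = 4 * Real.pi / 3 * ((emb n).re * z.re + (emb n).im * z.im) := by
  rw [freq_apply, pair, K_eq]
  simp only [Complex.mul_re, Complex.mul_im, Complex.conj_re, Complex.conj_im, Complex.ofReal_re,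
    Complex.ofReal_im]
  ring

theorem emb_re (n : ℤ × ℤ) : (emb n).re = n.1 - n.2 / 2 := by
  simp [emb, omega_re]; ring

theorem emb_im (n : ℤ × ℤ) : (emb n).im = n.2 * (Real.sqrt 3 / 2) := by
  simp [emb, omega_im]

theorem freq_add (n m : ℤ × ℤ) (z : ℂ) : freq (n + m) z = freq n z + freq m z := by
  simp only [freq_eq, emb_add, Complex.add_re, Complex.add_im]; ring

theorem freq_neg (n : ℤ × ℤ) (z : ℂ) : freq (-n) z = -freq n z := by
  simp only [freq_eq, emb_neg, Complex.neg_re, Complex.neg_im]; ring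

theorem ee_add (n m : ℤ × ℤ) (z : ℂ) : ee (n + m) z = ee n z * ee m z := by
  rw [ee, ee, ee, ← Complex.exp_add, freq_add]; push_cast; ring_nf

theorem ee_zero (z : ℂ) : ee 0 z = 1 := by simp [ee, freq_eq, emb_zero]

theorem ee_mul_neg (n : ℤ × ℤ) (z : ℂ) : ee n z * ee (-n) z = 1 := by
  rw [← ee_add, add_neg_cancel, ee_zero]

theorem norm_ee (n : ℤ × ℤ) (z : ℂ) : ‖ee n z‖ = 1 := by
  rw [ee, mul_comm]; exact Complex.norm_exp_ofReal_mul_I _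

theorem ee_add_arg (n : ℤ × ℤ) (z w : ℂ) : ee n (z + w) = ee n z * ee n w := by
  rw [ee, ee, ee, ← Complex.exp_add, map_add]; push_cast; ring_nf

theorem ee_neg_arg (n : ℤ × ℤ) (z : ℂ) : ee n (-z) = ee (-n) z := by
  rw [ee, ee, map_neg, freq_neg]

theorem ee_rot (n : ℤ × ℤ) (z : ℂ) : ee (rot n) (ω * z) = ee n z := by
  rw [ee, ee]
  congr 3
  rw [freq_eq, freq_eq, emb_rot]
  simp only [Complex.mul_re, Complex.mul_im, omega_re, omega_im]
  have h3 := Real.mul_self_sqrt (show (0 : ℝ) ≤ 3 by norm_num)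
  linear_combination (4 * Real.pi / 3) * ((emb n).re * z.re + (emb n).im * z.im) / 4 * h3

theorem freq_cell (n : ℤ × ℤ) (s t : ℝ) : freq n (s + t * ω) =
    2 * Real.pi * (s * (2 * n.1 - n.2) / 3 + t * (2 * n.2 - n.1) / 3) := by
  rw [freq_eq, emb_re, emb_im]
  have h3 := Real.mul_self_sqrt (show (0 : ℝ) ≤ 3 by norm_num)
  simp only [Complex.add_re, Complex.add_im, Complex.mul_re, Complex.mul_im, omega_re, omega_im,
    Complex.ofReal_re, Complex.ofReal_im]
  linear_combination (4 * Real.pi / 3) * (n.2 * t) / 4 * h3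

/-- The class of a frequency modulo the reciprocal lattice of the periodic functions. -/
def cls (n : ℤ × ℤ) : ZMod 3 := ((n.1 + n.2 : ℤ) : ZMod 3)

theorem cls_add (n m : ℤ × ℤ) : cls (n + m) = cls n + cls m := by
  simp [cls]; ring

theorem cls_neg (n : ℤ × ℤ) : cls (-n) = -cls n := by simp [cls]; ring

theorem cls_sub (n m : ℤ × ℤ) : cls (n - m) = cls n - cls m := by
  rw [sub_eq_add_neg, cls_add, cls_neg, sub_eq_add_neg]

theorem cls_eq_zero_iff {n : ℤ × ℤ} : cls n = 0 ↔ n ∉ Lset := by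
  rw [cls, ZMod.intCast_zmod_eq_zero_iff_dvd]
  simp [Lset]

theorem cls_rot (n : ℤ × ℤ) : cls (rot n) = cls n := by
  have h : (3 : ZMod 3) = 0 := rfl
  simp only [cls, rot, AddEquiv.coe_mk, Equiv.coe_fn_mk]
  push_cast
  linear_combination -(n.2 : ZMod 3) * h

theorem ee_lattice {n : ℤ × ℤ} (hn : cls n = 0) {γ : ℂ} (hγ : γ ∈ Λ) : ee n γ = 1 := by
  obtain ⟨m, l, rfl⟩ := hγ
  rw [cls, ZMod.intCast_zmod_eq_zero_iff_dvd] at hn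
  obtain ⟨c, hc⟩ := hn
  have h := freq_cell n l m
  rw [ee, show (m : ℂ) * ω + l = ((l : ℝ) : ℂ) + ((m : ℝ) : ℂ) * ω by push_cast; ring, h,
    Complex.exp_eq_one_iff]
  refine ⟨l * (n.1 - c) + m * (n.2 - c), ?_⟩
  have hc' : (n.1 : ℂ) + n.2 = 3 * c := by exact_mod_cast hc
  push_cast
  linear_combination (-2 * Real.pi * Complex.I * (l + m) / 3) * hc'

/-- Floquet boundary conditions of class `ε`. -/
def QP (ε : ℤ) (f : ℂ → ℂ) : Prop := ∀ γ ∈ Λ, ∀ z, f (z + γ) = ee (ε, 0) γ * f z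

theorem ee_eq_of_cls {n m : ℤ × ℤ} (h : cls n = cls m) {γ : ℂ} (hγ : γ ∈ Λ) : ee n γ = ee m γ := by
  have h1 : ee (n - m) γ = 1 := ee_lattice (by rw [cls_sub, h, sub_self]) hγ
  rw [show n = (n - m) + m by abel, ee_add, h1, one_mul]

theorem ee_qp {n : ℤ × ℤ} {ε : ℤ} (h : cls n = ε) : QP ε (ee n) := by
  intro γ hγ z
  rw [ee_add_arg, mul_comm, ee_eq_of_cls (m := (ε, 0)) (by rw [h]; simp [cls]) hγ]

theorem ee_one (γ : ℂ) : ee (1, 0) γ = Complex.exp (Complex.I * (pair γ K : ℂ)) := by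
  have h : freq (1, 0) γ = pair γ K := by
    rw [freq_eq, emb_re, emb_im, pair, K_eq, Complex.conj_ofReal, Complex.re_mul_ofReal]
    push_cast; ring
  rw [ee, h]

theorem ee_neg_one (γ : ℂ) : ee (-1, 0) γ = Complex.exp (-Complex.I * (pair γ K : ℂ)) := by
  have := ee_one (-γ)
  rw [ee_neg_arg] at this
  rw [show ((-1 : ℤ), (0 : ℤ)) = -((1 : ℤ), (0 : ℤ)) by simp, this]
  simp [pair]; ring_nf

/-- The derivative of a plane wave. -/
noncomputable def eeDeriv (n : ℤ × ℤ) (z : ℂ) : ℂ →L[ℝ] ℂ :=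
  ee n z • (Complex.I • (Complex.ofRealCLM.comp (freq n)))

theorem hasFDerivAt_ee (n : ℤ × ℤ) (z : ℂ) : HasFDerivAt (ee n) (eeDeriv n z) z := by
  have h : HasFDerivAt (fun z : ℂ => Complex.I * ((freq n z : ℝ) : ℂ))
      (Complex.I • (Complex.ofRealCLM.comp (freq n))) z :=
    ((Complex.ofRealCLM.comp (freq n)).hasFDerivAt).const_mul Complex.I
  exact h.cexp

theorem continuous_ee (n : ℤ × ℤ) : Continuous (ee n) :=
  continuous_iff_continuousAt.2 fun z => (hasFDerivAt_ee n z).continuousAt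

/-- The `∂̄` symbol as a functional on real derivatives. -/
noncomputable def dbarL : (ℂ →L[ℝ] ℂ) →L[ℝ] ℂ :=
  (1 / Complex.I) • (ContinuousLinearMap.apply ℝ ℂ (1 : ℂ) +
    Complex.I • ContinuousLinearMap.apply ℝ ℂ Complex.I)

theorem dbarL_apply (L : ℂ →L[ℝ] ℂ) : dbarL L = 1 / Complex.I * (L 1 + Complex.I * L Complex.I) := rfl

theorem dbarL_smul (c : ℂ) (L : ℂ →L[ℝ] ℂ) : dbarL (c • L) = c * dbarL L := by
  simp only [dbarL_apply, _root_.smul_apply, smul_eq_mul]; ring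

theorem Dbar_eq {f : ℂ → ℂ} {z : ℂ} {L : ℂ →L[ℝ] ℂ} (h : HasFDerivAt f L z) : Dbar f z = dbarL L := by
  rw [Dbar, h.fderiv, dbarL_apply]

theorem dbarL_eeDeriv (n : ℤ × ℤ) (z : ℂ) : dbarL (eeDeriv n z) = K * emb n * ee n z := by
  rw [eeDeriv, dbarL_smul, dbarL_smul, dbarL_apply]
  have h1 : freq n 1 = (K * emb n).re := by simp [freq]
  have h2 : freq n Complex.I = (K * emb n).im := by simp [freq]
  simp only [ContinuousLinearMap.comp_apply, h1, h2, Complex.ofRealCLM_apply]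
  rw [show ((K * emb n).re : ℂ) + Complex.I * ((K * emb n).im : ℂ) = K * emb n by
    rw [mul_comm Complex.I]; exact Complex.re_add_im _]
  field_simp

theorem contDiff_ee (n : ℤ × ℤ) {N : WithTop ℕ∞} : ContDiff ℝ N (ee n) :=
  Complex.contDiff_exp.comp
    (contDiff_const.mul (Complex.ofRealCLM.contDiff.comp (freq n).contDiff))

theorem norm_freq_le (n : ℤ × ℤ) : ‖freq n‖ ≤ 20 * (1 + ‖n‖) := by
  have h1 : ‖K * emb n‖ ≤ 10 * ‖n‖ := by
    have hK : ‖K‖ ≤ 5 := by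
      rw [K_eq, Complex.norm_real, Real.norm_of_nonneg (by positivity)]
      linarith [Real.pi_lt_d2]
    have he : ‖emb n‖ ≤ 2 * ‖n‖ := by
      have h2 : ‖ω‖ = 1 := by
        rw [ω, show 2 * (Real.pi : ℂ) * Complex.I / 3 = ((2 * Real.pi / 3 : ℝ) : ℂ) * Complex.I by
          push_cast; ring]
        exact Complex.norm_exp_ofReal_mul_I _
      calc ‖emb n‖ ≤ ‖(n.1 : ℂ)‖ + ‖(n.2 : ℂ) * ω‖ := norm_add_le _ _
        _ = ‖n.1‖ + ‖n.2‖ := by rw [norm_mul, h2, mul_one, Complex.norm_intCast, Complex.norm_intCast]; rfl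
        _ ≤ 2 * ‖n‖ := by linarith [norm_fst_le n, norm_snd_le n]
    rw [norm_mul]
    nlinarith [norm_nonneg (emb n), norm_nonneg n, norm_nonneg K]
  refine ContinuousLinearMap.opNorm_le_bound _ (by positivity) fun z => ?_
  have h2 := Complex.abs_re_le_norm (K * emb n)
  have h3 := Complex.abs_im_le_norm (K * emb n)
  calc ‖freq n z‖ ≤ |(K * emb n).re * z.re| + |(K * emb n).im * z.im| := by
        simpa [freq] using norm_add_le ((K * emb n).re * z.re) ((K * emb n).im * z.im)
    _ ≤ ‖K * emb n‖ * ‖z‖ + ‖K * emb n‖ * ‖z‖ := by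
        rw [abs_mul, abs_mul]
        have := Complex.abs_re_le_norm z
        have := Complex.abs_im_le_norm z
        gcongr
    _ ≤ _ := by nlinarith [norm_nonneg z, norm_nonneg n]

theorem norm_iteratedFDeriv_ee_le (n : ℤ × ℤ) (k : ℕ) (z : ℂ) :
    ‖iteratedFDeriv ℝ k (ee n) z‖ ≤ (20 * (1 + ‖n‖)) ^ k := by
  have hexp : ∀ (k : ℕ) (t : ℝ), ‖iteratedFDeriv ℝ k (fun t : ℝ => Complex.exp (Complex.I * t)) t‖
      = 1 := by
    intro k t
    have h : ∀ k : ℕ, iteratedDeriv k (fun t : ℝ => Complex.exp (Complex.I * t)) =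
        fun t : ℝ => Complex.I ^ k * Complex.exp (Complex.I * t) := by
      intro k
      induction k with
      | zero => simp
      | succ k ih =>
        rw [iteratedDeriv_succ, ih]
        ext t
        have h0 : HasDerivAt (fun t : ℝ => Complex.I * (t : ℂ)) Complex.I t := by
          simpa using (Complex.ofRealCLM.hasDerivAt (x := t)).const_mul Complex.I
        rw [((h0.cexp).const_mul _).deriv]
        ring
    rw [norm_iteratedFDeriv_eq_norm_iteratedDeriv, h, norm_mul, norm_pow, Complex.norm_I, one_pow,
      one_mul, mul_comm]
    exact Complex.norm_exp_ofReal_mul_I t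
  have hc : ContDiff ℝ k (fun t : ℝ => Complex.exp (Complex.I * t)) :=
    Complex.contDiff_exp.comp (contDiff_const.mul Complex.ofRealCLM.contDiff)
  have h := (freq n).iteratedFDeriv_comp_right hc z (i := k) le_rfl
  have h' : ee n = (fun t : ℝ => Complex.exp (Complex.I * t)) ∘ (freq n) := rfl
  rw [h', h]
  refine (ContinuousMultilinearMap.norm_compContinuousLinearMap_le _ _).trans ?_
  rw [hexp, one_mul, Finset.prod_const, Finset.card_univ, Fintype.card_fin]
  exact pow_le_pow_left₀ (norm_nonneg _) (norm_freq_le n) k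

/-- Rapid decay. -/
def Rapid (c : ℤ × ℤ → ℂ) : Prop := ∀ l : ℕ, ∃ B : ℝ, ∀ n, ‖c n‖ ≤ B / (1 + ‖n‖) ^ l

/-- The Fourier series with coefficients `c`. -/
noncomputable def fser (c : ℤ × ℤ → ℂ) (z : ℂ) : ℂ := ∑' n, c n * ee n z

theorem Rapid.summable_mul_pow {c : ℤ × ℤ → ℂ} (hc : Rapid c) (C : ℝ) (k : ℕ) :
    Summable fun n => ‖c n‖ * (C * (1 + ‖n‖)) ^ k := by
  obtain ⟨B, hB⟩ := hc (k + 4)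
  refine Summable.of_norm_bounded
    (summable_div_one_add_norm_pow (|C| ^ k * B) (le_refl 4)) fun n => ?_
  have hn : 0 < 1 + ‖n‖ := by positivity
  rw [norm_mul, norm_norm, norm_pow, norm_mul, Real.norm_of_nonneg hn.le, mul_pow]
  calc ‖c n‖ * (‖C‖ ^ k * (1 + ‖n‖) ^ k) ≤ B / (1 + ‖n‖) ^ (k + 4) * (‖C‖ ^ k * (1 + ‖n‖) ^ k) := by
        gcongr; exact hB n
    _ = |C| ^ k * B / (1 + ‖n‖) ^ 4 := by
        rw [Real.norm_eq_abs, pow_add]; field_simp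

theorem Rapid.summable_norm {c : ℤ × ℤ → ℂ} (hc : Rapid c) : Summable fun n => ‖c n‖ := by
  simpa using hc.summable_mul_pow 1 0

theorem Rapid.summable_ee {c : ℤ × ℤ → ℂ} (hc : Rapid c) (z : ℂ) :
    Summable fun n => c n * ee n z :=
  Summable.of_norm (by simpa [norm_ee] using hc.summable_norm)

theorem Rapid.contDiff_fser {c : ℤ × ℤ → ℂ} (hc : Rapid c) :
    ContDiff ℝ (⊤ : ℕ∞) (fser c) := by
  refine contDiff_tsum (v := fun k n => ‖c n‖ * (20 * (1 + ‖n‖)) ^ k)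
    (fun n => contDiff_const.mul (contDiff_ee n)) (fun k _ => hc.summable_mul_pow 20 k) ?_
  intro k n z _
  have : (fun z => c n * ee n z) = c n • ee n := rfl
  rw [this, iteratedFDeriv_const_smul_apply ((contDiff_ee n).contDiffAt), norm_smul]
  exact mul_le_mul_of_nonneg_left (norm_iteratedFDeriv_ee_le n k z) (norm_nonneg _)

theorem norm_eeDeriv_le (n : ℤ × ℤ) (z : ℂ) : ‖eeDeriv n z‖ ≤ 20 * (1 + ‖n‖) := by
  have h := norm_iteratedFDeriv_ee_le n 1 z
  rwa [norm_iteratedFDeriv_one, (hasFDerivAt_ee n z).fderiv, pow_one] at h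

theorem Rapid.hasFDerivAt_fser {c : ℤ × ℤ → ℂ} (hc : Rapid c) (z : ℂ) :
    HasFDerivAt (fser c) (∑' n, c n • eeDeriv n z) z :=
  hasFDerivAt_tsum (u := fun n => ‖c n‖ * (20 * (1 + ‖n‖)) ^ 1) (hc.summable_mul_pow 20 1)
    (fun n z => (hasFDerivAt_ee n z).const_mul (c n))
    (fun n z => by
      rw [norm_smul, pow_one]
      exact mul_le_mul_of_nonneg_left (norm_eeDeriv_le n z) (norm_nonneg _))
    (hc.summable_ee 0) z

theorem Rapid.Dbar_fser {c : ℤ × ℤ → ℂ} (hc : Rapid c) (z : ℂ) :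
    Dbar (fser c) z = fser (fun n => K * emb n * c n) z := by
  rw [Dbar_eq (hc.hasFDerivAt_fser z), ContinuousLinearMap.map_tsum, fser]
  · exact tsum_congr fun n => by rw [dbarL_smul, dbarL_eeDeriv]; ring
  · refine Summable.of_norm_bounded (hc.summable_mul_pow 20 1) fun n => ?_
    rw [norm_smul, pow_one]
    exact mul_le_mul_of_nonneg_left (norm_eeDeriv_le n z) (norm_nonneg _)

theorem Rapid.mono {c d : ℤ × ℤ → ℂ} (hc : Rapid c) (h : ∀ n, ‖d n‖ ≤ ‖c n‖) : Rapid d := fun l => by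
  obtain ⟨B, hB⟩ := hc l
  exact ⟨B, fun n => (h n).trans (hB n)⟩

theorem Rapid.fser_qp {c : ℤ × ℤ → ℂ} {ε : ℤ} (hs : ∀ n, c n ≠ 0 → cls n = ε) :
    QP ε (fser c) := by
  intro γ hγ z
  rw [fser, fser, ← tsum_mul_left]
  refine tsum_congr fun n => ?_
  by_cases h0 : c n = 0
  · simp [h0]
  · rw [ee_qp (hs n h0) γ hγ z]; ring

end

section

open Filter Topology Complex MeasureTheory

/-- The parametrization of the plane by lattice coordinates. -/
noncomputable def cell : ℝ × ℝ →L[ℝ] ℂ :=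
  (ContinuousLinearMap.fst ℝ ℝ ℝ).smulRight (1 : ℂ) + (ContinuousLinearMap.snd ℝ ℝ ℝ).smulRight ω

theorem cell_apply (p : ℝ × ℝ) : cell p = p.1 + p.2 * ω := by simp [cell]

theorem cell_injective : Function.Injective cell := by
  refine (injective_iff_map_eq_zero _).2 fun p hp => ?_
  rw [cell_apply] at hp
  have him := congrArg Complex.im hp
  have hre := congrArg Complex.re hp
  simp only [Complex.add_im, Complex.add_re, Complex.mul_im, Complex.mul_re, Complex.ofReal_im,
    Complex.ofReal_re, omega_re, omega_im, Complex.zero_im, Complex.zero_re] at him hre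
  have h2 : p.2 = 0 := by
    have h3 : (0 : ℝ) < Real.sqrt 3 := by positivity
    nlinarith
  rw [h2] at hre
  ext
  · simpa using hre
  · exact h2

theorem cell_surjective : Function.Surjective cell := by
  intro z
  have h3 : Real.sqrt 3 ≠ 0 := by positivity
  refine ⟨(z.re + z.im / Real.sqrt 3, 2 * z.im / Real.sqrt 3), ?_⟩
  rw [cell_apply]
  apply Complex.ext
  · simp only [Complex.add_re, Complex.mul_re, Complex.ofReal_im, Complex.ofReal_re, omega_re,
      omega_im]
    field_simp; ring
  · simp only [Complex.add_im, Complex.mul_im, Complex.ofReal_im, Complex.ofReal_re, omega_re,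
      omega_im]
    field_simp; ring

/-- The frequencies of lattice periodic functions. -/
def perFreq (k : ℤ × ℤ) : ℤ × ℤ := (2 * k.1 + k.2, k.1 + 2 * k.2)

theorem perFreq_injective : Function.Injective perFreq := by
  intro a b h
  simp only [perFreq, Prod.mk.injEq] at h
  ext <;> omega

theorem cls_perFreq (k : ℤ × ℤ) : cls (perFreq k) = 0 := by
  rw [cls, ZMod.intCast_zmod_eq_zero_iff_dvd]
  exact ⟨k.1 + k.2, by simp only [perFreq]; push_cast; ring⟩

theorem exists_perFreq {d : ℤ × ℤ} (hd : cls d = 0) : ∃ k, perFreq k = d := by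
  rw [cls, ZMod.intCast_zmod_eq_zero_iff_dvd] at hd
  obtain ⟨c, hc⟩ := hd
  push_cast at hc
  exact ⟨(d.1 - c, d.2 - c), by simp only [perFreq]; ext <;> simp <;> omega⟩

theorem ee_perFreq (k : ℤ × ℤ) (p : ℝ × ℝ) : ee (perFreq k) (cell p) =
    Complex.exp (2 * Real.pi * Complex.I * k.1 * p.1) *
      Complex.exp (2 * Real.pi * Complex.I * k.2 * p.2) := by
  rw [ee, cell_apply, freq_cell, ← Complex.exp_add]
  congr 1
  simp only [perFreq]; push_cast; ring

theorem integral_exp_Icc (k : ℤ) :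
    ∫ x in Set.Icc (0 : ℝ) 1, Complex.exp (2 * Real.pi * Complex.I * k * x) =
      if k = 0 then 1 else 0 := by
  rw [integral_Icc_eq_integral_Ioc, ← intervalIntegral.integral_of_le zero_le_one]
  split_ifs with hk
  · simp [hk]
  · have h0 : (2 * Real.pi * Complex.I * k : ℂ) ≠ 0 := by
      have := Complex.two_pi_I_ne_zero
      simp only [ne_eq, mul_eq_zero, not_or] at this ⊢
      exact ⟨this, by exact_mod_cast hk⟩
    rw [integral_exp_mul_complex h0]
    have h1 : Complex.exp (2 * Real.pi * Complex.I * k * ((1 : ℝ) : ℂ)) = 1 :=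
      Complex.exp_eq_one_iff.2 ⟨k, by push_cast; ring⟩
    rw [h1]; simp

/-- The Fourier coefficient over a fundamental cell. -/
noncomputable def coef (f : ℂ → ℂ) (n : ℤ × ℤ) : ℂ :=
  ∫ p in Set.Icc (0 : ℝ × ℝ) 1, f (cell p) * ee (-n) (cell p)

theorem Icc_cell : Set.Icc (0 : ℝ × ℝ) 1 = Set.Icc (0 : ℝ) 1 ×ˢ Set.Icc (0 : ℝ) 1 :=
  Set.Icc_prod_eq _ _

theorem integral_ee_cell (d : ℤ × ℤ) (hd : cls d = 0) :
    ∫ p in Set.Icc (0 : ℝ × ℝ) 1, ee d (cell p) = if d = 0 then 1 else 0 := by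
  obtain ⟨k, rfl⟩ := exists_perFreq hd
  simp_rw [ee_perFreq]
  rw [Icc_cell, Measure.volume_eq_prod,
    setIntegral_prod_mul (fun s : ℝ => Complex.exp (2 * Real.pi * Complex.I * k.1 * s))
      (fun s : ℝ => Complex.exp (2 * Real.pi * Complex.I * k.2 * s)),
    integral_exp_Icc, integral_exp_Icc]
  have : perFreq k = 0 ↔ k.1 = 0 ∧ k.2 = 0 := by
    rw [show (0 : ℤ × ℤ) = perFreq 0 by simp [perFreq]; rfl, perFreq_injective.eq_iff, Prod.ext_iff]; rfl
  simp only [this]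
  split_ifs <;> simp_all

theorem integrableOn_cell {f : ℂ → ℂ} (hf : Continuous f) :
    IntegrableOn (fun p : ℝ × ℝ => f (cell p)) (Set.Icc 0 1) :=
  (hf.comp cell.continuous).continuousOn.integrableOn_compact isCompact_Icc

theorem volume_Icc_cell : volume.real (Set.Icc (0 : ℝ × ℝ) 1) = 1 := by
  rw [Icc_cell, Measure.volume_eq_prod, measureReal_prod_prod]; simp

theorem coef_fser {c : ℤ × ℤ → ℂ} (hc : Summable fun n => ‖c n‖) {ε : ZMod 3}
    (hs : ∀ n, c n ≠ 0 → cls n = ε) {m : ℤ × ℤ} (hm : cls m = ε) : coef (fser c) m = c m := by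
  have h := hasSum_integral_of_summable_integral_norm
    (μ := (volume : Measure (ℝ × ℝ)).restrict (Set.Icc 0 1))
    (F := fun n p => c n * ee (n - m) (cell p))
    (fun n => (integrableOn_cell (continuous_const.mul (continuous_ee _)))) (by
      simp only [norm_mul, norm_ee, mul_one, integral_const, Measure.real,
        Measure.restrict_apply_univ]
      have := volume_Icc_cell
      rw [Measure.real] at this
      simpa [this] using hc)
  have h2 : coef (fser c) m = ∫ p in Set.Icc (0 : ℝ × ℝ) 1, ∑' n, c n * ee (n - m) (cell p) := by
    refine setIntegral_congr_fun measurableSet_Icc fun p _ => ?_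
    simp only [fser, ← tsum_mul_right]
    exact tsum_congr fun n => by rw [sub_eq_add_neg, ee_add, mul_assoc]
  rw [h2, ← h.tsum_eq, tsum_eq_single m]
  · rw [integral_const_mul, sub_self, integral_ee_cell 0 (by simp [cls])]; simp
  · intro n hn
    by_cases h0 : c n = 0
    · simp [h0]
    rw [integral_const_mul, integral_ee_cell _ (by rw [cls_sub, hs n h0, hm, sub_self]),
      if_neg (sub_ne_zero.2 hn), mul_zero]

theorem norm_coef_le {f : ℂ → ℂ} {C : ℝ} (hC : ∀ p ∈ Set.Icc (0 : ℝ × ℝ) 1, ‖f (cell p)‖ ≤ C)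
    (n : ℤ × ℤ) : ‖coef f n‖ ≤ C := by
  have h := norm_setIntegral_le_of_norm_le_const (μ := (volume : Measure (ℝ × ℝ)))
    (s := Set.Icc 0 1) (f := fun p => f (cell p) * ee (-n) (cell p)) (C := C)
    isCompact_Icc.measure_lt_top (fun p hp => by rw [norm_mul, norm_ee, mul_one]; exact hC p hp)
  rwa [volume_Icc_cell, mul_one] at h

theorem exists_coef_bound {f : ℂ → ℂ} (hf : Continuous f) : ∃ C : ℝ, ∀ n, ‖coef f n‖ ≤ C := by
  obtain ⟨C, hC⟩ := (isCompact_Icc (a := (0 : ℝ × ℝ)) (b := 1)).exists_bound_of_continuousOn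
    (hf.comp cell.continuous).continuousOn
  exact ⟨C, norm_coef_le hC⟩

theorem one_mem_lattice : (1 : ℂ) ∈ Λ := ⟨0, 1, by simp⟩

theorem omega_mem_lattice : ω ∈ Λ := ⟨1, 0, by simp⟩

/-- The divergence theorem on the torus, with countably many exceptional points. -/
theorem integral_dbar_eq_zero {g ψ : ℂ → ℂ} (hg : Continuous g) (hψ : Continuous ψ)
    (hper : ∀ γ ∈ Λ, ∀ z, g (z + γ) = g z) {S : Set ℂ} (hS : S.Countable)
    (hd : ∀ z ∉ S, ∃ L : ℂ →L[ℝ] ℂ, HasFDerivAt g L z ∧ dbarL L = ψ z) :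
    ∫ p in Set.Icc (0 : ℝ × ℝ) 1, ψ (cell p) = 0 := by
  set S' : Set (ℝ × ℝ) := cell ⁻¹' S
  have hS' : S'.Countable := hS.preimage cell_injective
  set a : ℂ := 1 + Complex.I / Real.sqrt 3
  set b : ℂ := 2 * Complex.I / Real.sqrt 3
  have hG : Continuous fun p : ℝ × ℝ => g (cell p) := hg.comp cell.continuous
  have hdiff : ∀ p ∉ S', HasFDerivAt (fun p : ℝ × ℝ => g (cell p))
      ((fderiv ℝ g (cell p)).comp cell) p := by
    intro p hp
    obtain ⟨L, hL, -⟩ := hd (cell p) hp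
    rw [hL.fderiv]
    exact hL.comp p cell.hasFDerivAt
  have hae : ∀ p ∉ S', (a • (fderiv ℝ g (cell p)).comp cell) (1, 0) +
      (b • (fderiv ℝ g (cell p)).comp cell) (0, 1) = Complex.I * ψ (cell p) := by
    intro p hp
    obtain ⟨L, hL, hL'⟩ := hd (cell p) hp
    rw [hL.fderiv, ← hL', dbarL_apply]
    have h1 : cell (1, 0) = 1 := by rw [cell_apply]; simp
    have h2 : cell (0, 1) = ω := by rw [cell_apply]; simp
    have h3 : L ω = ω.re * L 1 + ω.im * L Complex.I := by
      conv_lhs => rw [show ω = ω.re • (1 : ℂ) + ω.im • Complex.I by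
        simp only [Complex.real_smul, mul_one]; exact (Complex.re_add_im _).symm]
      rw [map_add, map_smul, map_smul, Complex.real_smul, Complex.real_smul]
    simp only [_root_.smul_apply, ContinuousLinearMap.comp_apply, h1, h2, h3, smul_eq_mul,
      omega_re, omega_im, a, b]
    have hs : (Real.sqrt 3 : ℂ) ≠ 0 := by
      exact_mod_cast (by positivity : Real.sqrt 3 ≠ 0)
    push_cast
    field_simp
    ring
  have hae' : (fun p => Complex.I * ψ (cell p)) =ᵐ[(volume : Measure (ℝ × ℝ)).restrict (Set.Icc 0 1)]
      fun p => (a • (fderiv ℝ g (cell p)).comp cell) (1, 0) +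
        (b • (fderiv ℝ g (cell p)).comp cell) (0, 1) := by
    refine ae_restrict_of_ae ?_
    have : ∀ᵐ p : ℝ × ℝ, p ∉ S' := by
      exact measure_eq_zero_iff_ae_notMem.1 (hS'.measure_zero _)
    filter_upwards [this] with p hp
    exact (hae p hp).symm
  have hInt : IntegrableOn (fun p => Complex.I * ψ (cell p)) (Set.Icc (0 : ℝ × ℝ) 1) :=
    integrableOn_cell (continuous_const.mul hψ)
  have key := integral_divergence_prod_Icc_of_hasFDerivAt_off_countable_of_le
    (fun p => a • g (cell p)) (fun p => b • g (cell p))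
    (fun p => a • (fderiv ℝ g (cell p)).comp cell) (fun p => b • (fderiv ℝ g (cell p)).comp cell)
    0 1 (Prod.mk_le_mk.2 ⟨zero_le_one, zero_le_one⟩) S' hS'
    (hG.const_smul a).continuousOn (hG.const_smul b).continuousOn
    (fun p hp => (hdiff p hp.2).const_smul a) (fun p hp => (hdiff p hp.2).const_smul b)
    (hInt.congr hae')
  rw [← integral_congr_ae hae'] at key
  have e1 : ∀ x : ℝ, g (cell (x, (1 : ℝ × ℝ).2)) = g (cell (x, (0 : ℝ × ℝ).2)) := by
    intro x
    rw [← hper ω omega_mem_lattice (cell (x, (0 : ℝ × ℝ).2))]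
    simp [cell_apply]
  have e2 : ∀ x : ℝ, g (cell ((1 : ℝ × ℝ).1, x)) = g (cell ((0 : ℝ × ℝ).1, x)) := by
    intro x
    rw [← hper 1 one_mem_lattice (cell ((0 : ℝ × ℝ).1, x))]
    simp [cell_apply, add_comm]
  simp only [e1, e2, sub_self, zero_add] at key
  rw [integral_const_mul] at key
  exact (mul_eq_zero.1 key).resolve_left Complex.I_ne_zero

/-- The coefficients of a quasi-periodic function are related to those of its `∂̄` derivative. -/
theorem coef_dbar {f ψ : ℂ → ℂ} (hf : Continuous f) (hψ : Continuous ψ) {ε : ℤ} (hqp : QP ε f)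
    {S : Set ℂ} (hS : S.Countable)
    (hd : ∀ z ∉ S, ∃ L : ℂ →L[ℝ] ℂ, HasFDerivAt f L z ∧ dbarL L = ψ z) {n : ℤ × ℤ}
    (hn : cls n = ε) : coef ψ n = K * emb n * coef f n := by
  have h := integral_dbar_eq_zero (g := fun z => f z * ee (-n) z)
    (ψ := fun z => ψ z * ee (-n) z - K * emb n * (f z * ee (-n) z))
    (hf.mul (continuous_ee _))
    ((hψ.mul (continuous_ee _)).sub (continuous_const.mul (hf.mul (continuous_ee _)))) ?_ hS ?_
  · rw [integral_sub (integrableOn_cell (f := fun z => ψ z * ee (-n) z) (hψ.mul (continuous_ee _)))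
      (integrableOn_cell (f := fun z => K * emb n * (f z * ee (-n) z))
        (continuous_const.mul (hf.mul (continuous_ee _)))), integral_const_mul] at h
    exact sub_eq_zero.1 h
  · intro γ hγ z
    have h1 : ee (-n) γ = ee (-(ε, 0)) γ := ee_eq_of_cls (by
      rw [cls_neg, cls_neg, hn]; simp [cls]) hγ
    have h2 := ee_mul_neg (ε, 0) γ
    simp only [hqp γ hγ z, ee_add_arg, h1]
    linear_combination (f z * ee (-n) z) * h2
  · intro z hz
    obtain ⟨L, hL, hL'⟩ := hd z hz
    refine ⟨_, hL.mul (hasFDerivAt_ee (-n) z), ?_⟩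
    rw [map_add, dbarL_smul, dbarL_smul, dbarL_eeDeriv, hL', emb_neg]
    ring

end

section

open Filter Topology Complex MeasureTheory

/-- A lattice periodic function as a function on the torus. -/
noncomputable def torusLift (g : ℂ → ℂ) (x : UnitAddTorus (Fin 2)) : ℂ :=
  g (cell ((x 0).out, (x 1).out))

theorem cell_mem_lattice (m n : ℤ) : cell (m, n) ∈ Λ := ⟨n, m, by rw [cell_apply]; push_cast; ring⟩

theorem torusLift_coe {g : ℂ → ℂ} (hper : ∀ γ ∈ Λ, ∀ z, g (z + γ) = g z) (x : Fin 2 → ℝ) :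
    torusLift g (fun i => (x i : UnitAddCircle)) = g (cell (x 0, x 1)) := by
  have h : ∀ i, ∃ m : ℤ, (Quotient.out (x i : UnitAddCircle) : ℝ) = x i + m := by
    intro i
    have h1 : ((Quotient.out (x i : UnitAddCircle) : ℝ) : UnitAddCircle) = (x i : UnitAddCircle) :=
      Quotient.out_eq _
    rw [← sub_eq_zero, ← AddCircle.coe_sub, AddCircle.coe_eq_zero_iff] at h1
    obtain ⟨m, hm⟩ := h1
    exact ⟨m, by rw [zsmul_eq_mul, mul_one] at hm; linarith⟩
  obtain ⟨m, hm⟩ := h 0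
  obtain ⟨n, hn⟩ := h 1
  rw [torusLift, hm, hn, ← hper _ (cell_mem_lattice m n) (cell (x 0, x 1)), ← map_add]
  simp

theorem continuous_torusLift {g : ℂ → ℂ} (hg : Continuous g)
    (hper : ∀ γ ∈ Λ, ∀ z, g (z + γ) = g z) : Continuous (torusLift g) := by
  have hq : IsOpenQuotientMap (Pi.map fun (_ : Fin 2) (x : ℝ) => (x : UnitAddCircle)) :=
    IsOpenQuotientMap.piMap fun _ => QuotientAddGroup.isOpenQuotientMap_mk
  rw [← hq.continuous_comp_iff]
  have : torusLift g ∘ (Pi.map fun (_ : Fin 2) (x : ℝ) => (x : UnitAddCircle)) =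
      fun x : Fin 2 → ℝ => g (cell (x 0, x 1)) := funext fun x => torusLift_coe hper x
  rw [this]
  fun_prop

theorem mFourier_two (k : ℤ × ℤ) (x : Fin 2 → ℝ) :
    UnitAddTorus.mFourier ![k.1, k.2] (fun i => (x i : UnitAddCircle)) =
      ee (perFreq k) (cell (x 0, x 1)) := by
  rw [ee_perFreq]
  simp [UnitAddTorus.mFourier, Fin.prod_univ_two]

theorem mFourierCoeff_torusLift {g : ℂ → ℂ} (hper : ∀ γ ∈ Λ, ∀ z, g (z + γ) = g z) (k : ℤ × ℤ) :
    UnitAddTorus.mFourierCoeff (torusLift g) ![k.1, k.2] = coef g (perFreq k) := by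
  rw [UnitAddTorus.mFourierCoeff_eq_integral _ _ 0, coef]
  have h1 : ∀ x : Fin 2 → ℝ, UnitAddTorus.mFourier (-![k.1, k.2]) (fun i => (x i : UnitAddCircle)) •
      torusLift g (fun i => (x i : UnitAddCircle)) =
      (fun p : ℝ × ℝ => g (cell p) * ee (-perFreq k) (cell p))
        (MeasurableEquiv.finTwoArrow x) := by
    intro x
    have h2 : (-![k.1, k.2] : Fin 2 → ℤ) = ![(-k).1, (-k).2] := by ext i; fin_cases i <;> rfl
    have h3 : perFreq (-k) = -perFreq k := by simp [perFreq]; constructor <;> ring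
    rw [torusLift_coe hper, h2, mFourier_two, h3, smul_eq_mul, mul_comm]
    rfl
  simp only [h1]
  have h4 : {x : Fin 2 → ℝ | ∀ i, x i ∈ Set.Ioc ((0 : Fin 2 → ℝ) i) ((0 : Fin 2 → ℝ) i + 1)} =
      MeasurableEquiv.finTwoArrow ⁻¹' (Set.Ioc (0 : ℝ) 1 ×ˢ Set.Ioc (0 : ℝ) 1) := by
    ext x
    simp [Fin.forall_fin_two, MeasurableEquiv.finTwoArrow]
  rw [h4, Icc_cell]
  refine ((volume_preserving_finTwoArrow ℝ).setIntegral_preimage_emb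
    (MeasurableEquiv.measurableEmbedding _)
    (fun p : ℝ × ℝ => g (cell p) * ee (-perFreq k) (cell p)) _).trans ?_
  refine setIntegral_congr_set ?_
  rw [Measure.volume_eq_prod]
  exact Measure.set_prod_ae_eq Ioc_ae_eq_Icc Ioc_ae_eq_Icc

theorem hasSum_coef {g : ℂ → ℂ} (hg : Continuous g) (hper : ∀ γ ∈ Λ, ∀ z, g (z + γ) = g z)
    (hs : Summable fun k => coef g (perFreq k)) (z : ℂ) :
    HasSum (fun k => coef g (perFreq k) * ee (perFreq k) z) (g z) := by
  obtain ⟨p, rfl⟩ := cell_surjective z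
  let e : (Fin 2 → ℤ) ≃ ℤ × ℤ := finTwoArrowEquiv ℤ
  have he : ∀ m : Fin 2 → ℤ, m = ![(e m).1, (e m).2] := by
    intro m; ext i; fin_cases i <;> rfl
  have hc : ∀ m, UnitAddTorus.mFourierCoeff (torusLift g) m = coef g (perFreq (e m)) := fun m => by
    conv_lhs => rw [he m]
    exact mFourierCoeff_torusLift hper _
  have h := UnitAddTorus.hasSum_mFourier_series_apply_of_summable
    (f := ⟨torusLift g, continuous_torusLift hg hper⟩)
    (show Summable (UnitAddTorus.mFourierCoeff (torusLift g)) from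
      (e.summable_iff.2 hs).congr fun m => (hc m).symm)
    (fun i => ((![p.1, p.2] i : ℝ) : UnitAddCircle))
  have h0 := torusLift_coe hper ![p.1, p.2]
  simp only [ContinuousMap.coe_mk, h0] at h
  rw [← e.hasSum_iff]
  convert h using 1
  · ext m
    rw [hc m, smul_eq_mul]
    conv_rhs => rw [he m]
    rw [mFourier_two]
    rfl
  · rfl

/-- The part of a coefficient family in a given class. -/
def part (v : ℤ × ℤ → ℂ) (c : ZMod 3) (n : ℤ × ℤ) : ℂ := if cls n = c then v n else 0

/-- Fourier inversion for quasi-periodic functions. -/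
theorem eq_fser_coef {f : ℂ → ℂ} (hf : Continuous f) {ε : ℤ} (hqp : QP ε f)
    (hs : Summable (part (coef f) ε)) : f = fser (part (coef f) ε) := by
  set c : ℤ × ℤ → ℂ := part (coef f) ε
  set ι : ℤ × ℤ → ℤ × ℤ := fun k => perFreq k + (ε, 0)
  have hι : Function.Injective ι := fun a b hab => perFreq_injective (add_right_cancel hab)
  have hε : cls ((ε, 0) : ℤ × ℤ) = ε := by simp [cls]
  have hcls : ∀ k, cls (ι k) = ε := fun k => by rw [cls_add, cls_perFreq, zero_add, hε]
  have hco : ∀ k, coef (fun z => f z * ee (-(ε, 0)) z) (perFreq k) = c (ι k) := by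
    intro k
    simp only [c, part, if_pos (hcls k), coef, ι]
    congr 1
    ext p
    rw [neg_add, ee_add]; ring
  funext z
  have h := hasSum_coef (g := fun z => f z * ee (-(ε, 0)) z) (hf.mul (continuous_ee _))
    (fun γ hγ z => by
      have h2 := ee_mul_neg (ε, 0) γ
      simp only [hqp γ hγ z, ee_add_arg]
      linear_combination (f z * ee (-(ε, 0)) z) * h2)
    (by simp only [hco]; exact hs.comp_injective hι) z
  have h2 := h.mul_right (ee (ε, 0) z)
  have h3 : f z * ee (-(ε, 0)) z * ee (ε, 0) z = f z := by
    linear_combination (f z) * ee_mul_neg (ε, 0) z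
  rw [h3] at h2
  rw [fser, ← hι.tsum_eq]
  · rw [← h2.tsum_eq]
    exact tsum_congr fun k => by rw [hco, mul_assoc, ← ee_add]
  · intro n hn
    have hn' : cls n = ε := by
      by_contra hne
      exact hn (by simp [c, part, hne])
    obtain ⟨k, hk⟩ := exists_perFreq (d := n - (ε, 0)) (by rw [cls_sub, hn', hε, sub_self])
    exact ⟨k, by simp only [ι]; rw [hk, sub_add_cancel]⟩

end

section

open Filter Topology Complex MeasureTheory

variable {h : ℤ × ℤ → ℂ} {r : ℕ} {α κ : ℂ}

theorem rapid_iff {c : ℤ × ℤ → ℂ} :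
    Rapid c ↔ ∀ l : ℕ, ∃ B : ℝ, ∀ n, ‖c n‖ * (1 + ‖n‖) ^ l ≤ B := by
  refine forall_congr' fun l => exists_congr fun B => forall_congr' fun n => ?_
  rw [le_div_iff₀ (by positivity)]

theorem Rapid.add {c d : ℤ × ℤ → ℂ} (hc : Rapid c) (hd : Rapid d) : Rapid fun n => c n + d n := by
  rw [rapid_iff] at *
  intro l
  obtain ⟨B, hB⟩ := hc l
  obtain ⟨C, hC⟩ := hd l
  refine ⟨B + C, fun n => ?_⟩
  have : (0 : ℝ) ≤ (1 + ‖n‖) ^ l := by positivity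
  nlinarith [hB n, hC n, norm_add_le (c n) (d n)]

theorem Rapid.const_mul {c : ℤ × ℤ → ℂ} (hc : Rapid c) (a : ℂ) : Rapid fun n => a * c n := by
  rw [rapid_iff] at *
  intro l
  obtain ⟨B, hB⟩ := hc l
  refine ⟨‖a‖ * B, fun n => ?_⟩
  rw [norm_mul, mul_assoc]
  exact mul_le_mul_of_nonneg_left (hB n) (norm_nonneg _)

theorem Rapid.shift {c : ℤ × ℤ → ℂ} (hc : Rapid c) (j : ℤ × ℤ) : Rapid fun n => c (n - j) := by
  rw [rapid_iff] at *
  intro l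
  obtain ⟨B, hB⟩ := hc l
  refine ⟨B * (1 + ‖j‖) ^ l, fun n => ?_⟩
  have h1 : 1 + ‖n‖ ≤ (1 + ‖n - j‖) * (1 + ‖j‖) := by
    have := norm_add_le (n - j) j
    rw [sub_add_cancel] at this
    nlinarith [norm_nonneg (n - j), norm_nonneg j]
  calc ‖c (n - j)‖ * (1 + ‖n‖) ^ l ≤ ‖c (n - j)‖ * ((1 + ‖n - j‖) * (1 + ‖j‖)) ^ l := by gcongr
    _ = ‖c (n - j)‖ * (1 + ‖n - j‖) ^ l * (1 + ‖j‖) ^ l := by rw [mul_pow]; ring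
    _ ≤ _ := by gcongr; exact hB _

theorem Rapid.sum {ι : Type*} (s : Finset ι) {c : ι → ℤ × ℤ → ℂ} (hc : ∀ i, Rapid (c i)) :
    Rapid fun n => ∑ i ∈ s, c i n := by
  classical
  induction s using Finset.induction_on with
  | empty => exact fun l => ⟨0, fun n => by simp⟩
  | insert a s ha ih =>
    simp only [Finset.sum_insert ha]
    exact (hc a).add ih

theorem Rapid.emb_mul {c : ℤ × ℤ → ℂ} (hc : Rapid c) : Rapid fun n => K * emb n * c n := by
  rw [rapid_iff] at *
  intro l
  obtain ⟨B, hB⟩ := hc (l + 1)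
  refine ⟨‖K‖ * 2 * B, fun n => ?_⟩
  have he : ‖emb n‖ ≤ 2 * (1 + ‖n‖) := by
    calc ‖emb n‖ ≤ ‖(n.1 : ℂ)‖ + ‖(n.2 : ℂ) * ω‖ := norm_add_le _ _
      _ = ‖n.1‖ + ‖n.2‖ := by
        rw [norm_mul, norm_omega, mul_one, Complex.norm_intCast, Complex.norm_intCast]; rfl
      _ ≤ _ := by linarith [norm_fst_le n, norm_snd_le n]
  calc ‖K * emb n * c n‖ * (1 + ‖n‖) ^ l ≤ ‖K‖ * (2 * (1 + ‖n‖)) * ‖c n‖ * (1 + ‖n‖) ^ l := by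
        rw [norm_mul, norm_mul]; gcongr
    _ = ‖K‖ * 2 * (‖c n‖ * (1 + ‖n‖) ^ (l + 1)) := by ring
    _ ≤ _ := by gcongr; exact hB n

theorem Rapid.part {v : ℤ × ℤ → ℂ} (hv : Rapid v) (c : ZMod 3) : Rapid (part v c) :=
  hv.mono fun n => by rw [TBG.part]; split_ifs <;> simp

/-- The trigonometric potential with coefficients in class `ε`. -/
noncomputable def pot (h : ℤ × ℤ → ℂ) (r : ℕ) (ε : ZMod 3) (z : ℂ) : ℂ :=
  ∑ j ∈ box r, K * part h ε j * ee j z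

theorem continuous_pot (ε : ZMod 3) : Continuous (pot h r ε) :=
  continuous_finsetSum _ fun j _ => continuous_const.mul (continuous_ee j)

/-- The equation of a walk zero mode in Fourier space. -/
def ModeEq (h : ℤ × ℤ → ℂ) (r : ℕ) (α κ : ℂ) (v : ℤ × ℤ → ℂ) : Prop :=
  (∀ n ∉ Lset, v n = 0) ∧
    ∀ n ∈ Lset, (emb n + κ) * v n + α * ∑ j ∈ box r, h j * v (n - j) = 0

/-- The pair of functions with given Fourier coefficients. -/
noncomputable def synth (v : ℤ × ℤ → ℂ) (z : ℂ) : ℂ × ℂ :=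
  (fser (part v (-1)) z, fser (part v 1) z)

theorem ModeEq.rapid {v : ℤ × ℤ → ℂ} (hv : ModeEq h r α κ v) (hb : ∃ B : ℝ, ∀ n, ‖v n‖ ≤ B) :
    Rapid v := by
  rw [rapid_iff]
  intro l
  induction l with
  | zero => simpa using hb
  | succ l ih =>
    obtain ⟨B, hB⟩ := ih
    have hS : ∃ B' : ℝ, ∀ n, ‖α * ∑ j ∈ box r, h j * v (n - j)‖ * (1 + ‖n‖) ^ l ≤ B' := by
      refine ⟨‖α‖ * ∑ j ∈ box r, ‖h j‖ * (B * (1 + ‖j‖) ^ l), fun n => ?_⟩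
      rw [norm_mul, mul_assoc]
      refine mul_le_mul_of_nonneg_left ?_ (norm_nonneg _)
      refine (mul_le_mul_of_nonneg_right (norm_sum_le _ _) (by positivity)).trans ?_
      rw [Finset.sum_mul]
      refine Finset.sum_le_sum fun j _ => ?_
      rw [norm_mul, mul_assoc]
      refine mul_le_mul_of_nonneg_left ?_ (norm_nonneg _)
      have h1 : 1 + ‖n‖ ≤ (1 + ‖n - j‖) * (1 + ‖j‖) := by
        have := norm_add_le (n - j) j
        rw [sub_add_cancel] at this
        nlinarith [norm_nonneg (n - j), norm_nonneg j]
      calc ‖v (n - j)‖ * (1 + ‖n‖) ^ l ≤ ‖v (n - j)‖ * ((1 + ‖n - j‖) * (1 + ‖j‖)) ^ l := by gcongr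
        _ = ‖v (n - j)‖ * (1 + ‖n - j‖) ^ l * (1 + ‖j‖) ^ l := by rw [mul_pow]; ring
        _ ≤ _ := by gcongr; exact hB _
    obtain ⟨B', hB'⟩ := hS
    have hB0 : 0 ≤ B := le_trans (by positivity) (hB 0)
    have hB0' : 0 ≤ B' := le_trans (by positivity) (hB' 0)
    refine ⟨2 * B' + (1 + 2 * ‖κ‖) * B, fun n => ?_⟩
    by_cases hn : n ∈ Lset
    · have h1 : ‖(emb n + κ) * v n‖ * (1 + ‖n‖) ^ l ≤ B' := by
        rw [eq_neg_of_add_eq_zero_left (hv.2 n hn), norm_neg]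
        exact hB' n
      have h2 : 1 + ‖n‖ ≤ 2 * ‖emb n + κ‖ + (1 + 2 * ‖κ‖) := by
        have h3 := norm_le_two_mul_norm_emb n
        have h4 := norm_sub_le (emb n + κ) κ
        rw [add_sub_cancel_right] at h4
        linarith
      rw [norm_mul] at h1
      calc ‖v n‖ * (1 + ‖n‖) ^ (l + 1) = (1 + ‖n‖) * (‖v n‖ * (1 + ‖n‖) ^ l) := by ring
        _ ≤ (2 * ‖emb n + κ‖ + (1 + 2 * ‖κ‖)) * (‖v n‖ * (1 + ‖n‖) ^ l) := by gcongr
        _ = 2 * (‖emb n + κ‖ * ‖v n‖ * (1 + ‖n‖) ^ l) +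
            (1 + 2 * ‖κ‖) * (‖v n‖ * (1 + ‖n‖) ^ l) := by ring
        _ ≤ _ := by gcongr; exact hB n
    · rw [hv.1 n hn]; simp; positivity

theorem pot_mul_fser {c : ℤ × ℤ → ℂ} (hc : Rapid c) (ε : ZMod 3) (z : ℂ) :
    pot h r ε z * fser c z = fser (fun n => ∑ j ∈ box r, K * part h ε j * c (n - j)) z := by
  have h1 : ∀ j, Summable fun n => K * part h ε j * c (n - j) * ee n z := fun j =>
    ((hc.shift j).const_mul _).summable_ee z
  simp only [fser, Finset.sum_mul]
  rw [Summable.tsum_finsetSum fun j _ => h1 j, pot, Finset.sum_mul]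
  refine Finset.sum_congr rfl fun j _ => ?_
  rw [← tsum_mul_left]
  conv_rhs => rw [← (Equiv.addRight j).tsum_eq]
  refine tsum_congr fun n => ?_
  simp only [Equiv.coe_addRight, add_sub_cancel_right, ee_add]
  ring

theorem coef_pot_mul {f : ℂ → ℂ} (hf : Continuous f) (ε : ZMod 3) (n : ℤ × ℤ) :
    coef (fun z => pot h r ε z * f z) n = ∑ j ∈ box r, K * part h ε j * coef f (n - j) := by
  have h1 : ∀ p : ℝ × ℝ, pot h r ε (cell p) * f (cell p) * ee (-n) (cell p) =
      ∑ j ∈ box r, K * part h ε j * (f (cell p) * ee (-(n - j)) (cell p)) := by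
    intro p
    rw [pot, Finset.sum_mul, Finset.sum_mul]
    refine Finset.sum_congr rfl fun j _ => ?_
    rw [neg_sub, sub_eq_add_neg, ee_add]; ring
  simp only [coef, h1]
  rw [integral_finsetSum]
  · exact Finset.sum_congr rfl fun j _ => integral_const_mul _ _
  · exact fun j _ => integrableOn_cell (f := fun z => K * part h ε j * (f z * ee (-(n - j)) z))
      (continuous_const.mul (hf.mul (continuous_ee _)))

theorem part_mul_part (hL : ∀ j ∉ Lset, h j = 0) {v : ℤ × ℤ → ℂ} (hv : ∀ n ∉ Lset, v n = 0)
    {ε : ZMod 3} (hε : ε ≠ 0) (n j : ℤ × ℤ) :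
    part h ε j * part v ε (n - j) = if cls n = -ε then h j * v (n - j) else 0 := by
  have hcn : cls n = cls j + cls (n - j) := by rw [← cls_add, add_sub_cancel]
  have key : ∀ ε a b : ZMod 3, ε ≠ 0 → (a = ε ∧ b = ε ∧ a + b = -ε) ∨
      (¬(a = ε ∧ b = ε) ∧ (a + b ≠ -ε ∨ a = 0 ∨ b = 0)) := by decide
  rcases key ε (cls j) (cls (n - j)) hε with ⟨h1, h2, h3⟩ | ⟨h1, h2⟩
  · rw [part, part, if_pos h1, if_pos h2, if_pos (hcn.trans h3)]
  · have hz : part h ε j * part v ε (n - j) = 0 := by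
      rw [part, part]
      split_ifs with h3 h4
      · exact absurd ⟨h3, h4⟩ h1
      all_goals simp
    rw [hz]
    split_ifs with h3
    · rcases h2 with h2 | h2 | h2
      · exact absurd (hcn.symm.trans h3) h2
      · rw [hL _ (cls_eq_zero_iff.1 h2), zero_mul]
      · rw [hv _ (cls_eq_zero_iff.1 h2), mul_zero]
    · rfl

theorem ModeEq.Dbar_add {v : ℤ × ℤ → ℂ} (hL : ∀ j ∉ Lset, h j = 0) (hv : ModeEq h r α κ v)
    (hR : Rapid v) {ε : ZMod 3} (hε : ε ≠ 0) (z : ℂ) :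
    Dbar (fser (part v (-ε))) z + K * κ * fser (part v (-ε)) z +
      α * pot h r ε z * fser (part v ε) z = 0 := by
  have hP := hR.part (-ε)
  have hS : Rapid fun n => ∑ j ∈ box r, K * part h ε j * part v ε (n - j) :=
    Rapid.sum _ fun j => ((hR.part ε).shift j).const_mul _
  rw [hP.Dbar_fser, mul_assoc α, pot_mul_fser (hR.part ε)]
  simp only [fser]
  rw [← tsum_mul_left, ← tsum_mul_left, ← Summable.tsum_add (hP.emb_mul.summable_ee z)
    ((hP.summable_ee z).mul_left _), ← Summable.tsum_add
    ((hP.emb_mul.summable_ee z).add ((hP.summable_ee z).mul_left _))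
    ((hS.summable_ee z).mul_left _)]
  rw [← tsum_zero (α := ℂ) (β := ℤ × ℤ)]
  refine tsum_congr fun n => ?_
  have h1 : ∀ j, K * part h ε j * part v ε (n - j) =
      K * if cls n = -ε then h j * v (n - j) else 0 := fun j => by
    rw [mul_assoc, part_mul_part hL hv.1 hε]
  simp only [h1, ← Finset.mul_sum]
  rw [part]
  split_ifs with h2
  · have hn : n ∈ Lset := by
      by_contra hn
      rw [cls_eq_zero_iff.2 hn] at h2
      exact hε (neg_eq_zero.1 h2.symm)
    linear_combination (K * ee n z) * hv.2 n hn
  · simp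

/-- Rapidly decaying solutions in Fourier space are zero modes. -/
theorem ModeEq.inKer {v : ℤ × ℤ → ℂ} (hL : ∀ j ∉ Lset, h j = 0) (hv : ModeEq h r α κ v)
    (hR : Rapid v) : InKer (pot h r 1) (pot h r (-1)) α (K * κ) (synth v) := by
  refine ⟨(hR.part _).contDiff_fser.prodMk (hR.part _).contDiff_fser,
    fun z => hv.Dbar_add hL hR (ε := 1) (by decide) z, fun z => ?_, fun γ hγ z => ?_, fun γ hγ z => ?_⟩
  · have := hv.Dbar_add hL hR (ε := -1) (by decide) z
    rw [neg_neg] at this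
    exact this
  · rw [← ee_neg_one]
    refine Rapid.fser_qp (c := part v (-1)) (ε := -1) (fun n hn => ?_) γ hγ z
    by_contra h0
    exact hn (if_neg (by simpa using h0))
  · rw [← ee_one]
    refine Rapid.fser_qp (c := part v 1) (ε := 1) (fun n hn => ?_) γ hγ z
    by_contra h0
    exact hn (if_neg (by simpa using h0))

/-- Weak zero modes are given by rapidly decaying solutions in Fourier space. -/
theorem exists_modeEq (hL : ∀ j ∉ Lset, h j = 0) {u₁ u₂ : ℂ → ℂ} (hu₁ : Continuous u₁)
    (hu₂ : Continuous u₂) (hq₁ : QP (-1) u₁) (hq₂ : QP 1 u₂) {S : Set ℂ} (hS : S.Countable)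
    (hd₁ : ∀ z ∉ S, ∃ L : ℂ →L[ℝ] ℂ, HasFDerivAt u₁ L z ∧
      dbarL L + K * κ * u₁ z + α * pot h r 1 z * u₂ z = 0)
    (hd₂ : ∀ z ∉ S, ∃ L : ℂ →L[ℝ] ℂ, HasFDerivAt u₂ L z ∧
      dbarL L + K * κ * u₂ z + α * pot h r (-1) z * u₁ z = 0) :
    ∃ v, ModeEq h r α κ v ∧ Rapid v ∧ (fun z => (u₁ z, u₂ z)) = synth v := by
  set v : ℤ × ℤ → ℂ := fun n => if cls n = -1 then coef u₁ n else part (coef u₂) 1 n with hvdef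
  have hv1 : part v (-1) = part (coef u₁) ((-1 : ℤ) : ZMod 3) := by
    ext n; simp only [part, v]; split_ifs with h1 h2 <;> simp_all
  have hv2 : part v 1 = part (coef u₂) ((1 : ℤ) : ZMod 3) := by
    ext n
    have : (1 : ZMod 3) ≠ -1 := by decide
    simp only [part, v]; split_ifs with h1 h2 <;> simp_all
  have hcoef : ∀ {w₁ w₂ : ℂ → ℂ} {e : ℤ} {ε : ZMod 3}, Continuous w₁ → Continuous w₂ → QP e w₁ →
      (∀ z ∉ S, ∃ L : ℂ →L[ℝ] ℂ, HasFDerivAt w₁ L z ∧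
        dbarL L + K * κ * w₁ z + α * pot h r ε z * w₂ z = 0) → ∀ n, cls n = e →
      K * emb n * coef w₁ n + K * κ * coef w₁ n +
        α * ∑ j ∈ box r, K * part h ε j * coef w₂ (n - j) = 0 := by
    intro w₁ w₂ e ε hw₁ hw₂ hq hd n hn
    have hc := (continuous_pot (h := h) (r := r) ε).mul hw₂
    rw [← coef_dbar (ψ := fun z => (-(K * κ)) * w₁ z + (-α) * (pot h r ε z * w₂ z)) hw₁
      ((continuous_const.mul hw₁).add (continuous_const.mul hc)) hq hS (fun z hz => by
        obtain ⟨L, hL, hL'⟩ := hd z hz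
        exact ⟨L, hL, by linear_combination hL'⟩) hn, ← coef_pot_mul hw₂]
    have h1 : coef (fun z => (-(K * κ)) * w₁ z + (-α) * (pot h r ε z * w₂ z)) n =
        (-(K * κ)) * coef w₁ n + (-α) * coef (fun z => pot h r ε z * w₂ z) n := by
      simp only [coef, add_mul, mul_assoc]
      rw [integral_add, integral_const_mul]
      · simp only [integral_const_mul]
      · exact integrableOn_cell (f := fun z => -(K * κ) * (w₁ z * ee (-n) z))
          (continuous_const.mul (hw₁.mul (continuous_ee _)))
      · exact integrableOn_cell (f := fun z => -α * (pot h r ε z * (w₂ z * ee (-n) z)))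
          (continuous_const.mul ((continuous_pot ε).mul (hw₂.mul (continuous_ee _))))
    rw [h1]; ring
  have hvL : ∀ n ∉ Lset, v n = 0 := by
    intro n hn
    have h0 := cls_eq_zero_iff.2 hn
    have h1 : (0 : ZMod 3) ≠ -1 := by decide
    have h2 : (0 : ZMod 3) ≠ 1 := by decide
    simp [v, part, h0, h1, h2]
  have hmode : ModeEq h r α κ v := by
    refine ⟨hvL, fun n hn => ?_⟩
    have hcls : cls n = -1 ∨ cls n = 1 := by
      have h3 : ∀ a : ZMod 3, a ≠ 0 → a = -1 ∨ a = 1 := by decide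
      exact h3 _ fun h0 => cls_eq_zero_iff.1 h0 hn
    have hsum : ∀ {w : ℂ → ℂ} {ε : ZMod 3}, ε ≠ 0 → cls n = -ε →
        part v ε = part (coef w) ε → ∑ j ∈ box r, K * part h ε j * coef w (n - j) =
          K * ∑ j ∈ box r, h j * v (n - j) := by
      intro w ε hε hn' hp
      rw [Finset.mul_sum]
      refine Finset.sum_congr rfl fun j _ => ?_
      have h1 := part_mul_part hL hvL hε n j
      rw [if_pos hn', hp] at h1
      rw [← h1, ← mul_assoc]
      by_cases hj : cls j = ε
      · have h4 : cls (n - j) = ε := by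
          rw [cls_sub, hn', hj]
          have : ∀ a : ZMod 3, -a - a = a := by decide
          exact this ε
        rw [part, part, if_pos hj, if_pos h4]
      · rw [part, if_neg hj]; simp
    rcases hcls with hc | hc
    · have h1 := hcoef hu₁ hu₂ hq₁ hd₁ n (by rw [hc]; simp)
      rw [hsum (by decide) hc (by simpa using hv2)] at h1
      have h2 : v n = coef u₁ n := by simp [v, hc]
      rw [h2]
      have : K * ((emb n + κ) * coef u₁ n + α * ∑ j ∈ box r, h j * v (n - j)) = 0 := by
        linear_combination h1
      exact (mul_eq_zero.1 this).resolve_left K_ne_zero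
    · have h1 := hcoef hu₂ hu₁ hq₂ hd₂ n (by rw [hc]; simp)
      rw [hsum (by decide) (by rw [hc, neg_neg]) (by simpa using hv1)] at h1
      have h5 : (1 : ZMod 3) ≠ -1 := by decide
      have h2 : v n = coef u₂ n := by simp [v, hc, part, h5]
      rw [h2]
      have : K * ((emb n + κ) * coef u₂ n + α * ∑ j ∈ box r, h j * v (n - j)) = 0 := by
        linear_combination h1
      exact (mul_eq_zero.1 this).resolve_left K_ne_zero
  have hR : Rapid v := hmode.rapid (by
    obtain ⟨B₁, hB₁⟩ := exists_coef_bound hu₁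
    obtain ⟨B₂, hB₂⟩ := exists_coef_bound hu₂
    have h1 := (norm_nonneg _).trans (hB₁ 0)
    have h2 := (norm_nonneg _).trans (hB₂ 0)
    refine ⟨B₁ + B₂, fun n => ?_⟩
    simp only [v, part]
    split_ifs
    · linarith [hB₁ n]
    · linarith [hB₂ n]
    · simp; linarith)
  refine ⟨v, hmode, hR, ?_⟩
  have e1 := eq_fser_coef hu₁ hq₁ (by rw [← hv1]; exact (hR.part _).summable_norm.of_norm)
  have e2 := eq_fser_coef hu₂ hq₂ (by rw [← hv2]; exact (hR.part _).summable_norm.of_norm)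
  funext z
  rw [synth, hv1, hv2, ← e1, ← e2]

end

section

open Filter Topology Complex MeasureTheory

variable {h : ℤ × ℤ → ℂ} {r : ℕ} {α κ : ℂ}

theorem synth_injective {v w : ℤ × ℤ → ℂ} (hv : Rapid v) (hw : Rapid w)
    (hv0 : ∀ n ∉ Lset, v n = 0) (hw0 : ∀ n ∉ Lset, w n = 0) (hvw : synth v = synth w) : v = w := by
  have key : ∀ ε : ZMod 3, fser (part v ε) = fser (part w ε) → ∀ n, cls n = ε → v n = w n := by
    intro ε he n hn
    have h1 : ∀ {u : ℤ × ℤ → ℂ}, Rapid u → coef (fser (part u ε)) n = u n := fun {u} hu => by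
      rw [coef_fser (hu.part ε).summable_norm (fun m hm => ?_) hn, part, if_pos hn]
      by_contra h0
      exact hm (if_neg h0)
    rw [← h1 hv, he, h1 hw]
  funext n
  have h3 : ∀ a : ZMod 3, a = 0 ∨ a = -1 ∨ a = 1 := by decide
  rcases h3 (cls n) with hn | hn | hn
  · rw [hv0 n (cls_eq_zero_iff.1 hn), hw0 n (cls_eq_zero_iff.1 hn)]
  · exact key _ (funext fun z => congrArg Prod.fst (congrFun hvw z)) n hn
  · exact key _ (funext fun z => congrArg Prod.snd (congrFun hvw z)) n hn

theorem synth_rot {v : ℤ × ℤ → ℂ} (hv : ∀ n, v (rot n) = v n) (z : ℂ) :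
    synth v (ω * z) = synth v z := by
  have key : ∀ ε : ZMod 3, fser (part v ε) (ω * z) = fser (part v ε) z := by
    intro ε
    rw [fser, ← rot.toEquiv.tsum_eq]
    refine tsum_congr fun n => ?_
    change part v ε (rot n) * ee (rot n) (ω * z) = _
    rw [ee_rot, part, part, cls_rot, hv]
  rw [synth, key, key, synth]

theorem Rapid.bounded {v : ℤ × ℤ → ℂ} (hv : Rapid v) : ∃ B : ℝ, ∀ n, ‖v n‖ ≤ B := by
  obtain ⟨B, hB⟩ := hv 0
  exact ⟨B, fun n => by simpa using hB n⟩

theorem InKer.exists_modeEq (hL : ∀ j ∉ Lset, h j = 0) {u : ℂ → ℂ × ℂ}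
    (hu : InKer (pot h r 1) (pot h r (-1)) α (K * κ) u) :
    ∃ v, ModeEq h r α κ v ∧ Rapid v ∧ u = synth v := by
  obtain ⟨hs, h1, h2, h3, h4⟩ := hu
  have hd1 : Differentiable ℝ fun z => (u z).1 := (hs.fst.differentiable (by simp))
  have hd2 : Differentiable ℝ fun z => (u z).2 := (hs.snd.differentiable (by simp))
  obtain ⟨v, hv, hR, he⟩ := TBG.exists_modeEq (h := h) (r := r) (α := α) (κ := κ) hL hd1.continuous
    hd2.continuous (fun γ hγ z => by rw [ee_neg_one]; exact h3 γ hγ z)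
    (fun γ hγ z => by rw [ee_one]; exact h4 γ hγ z) Set.countable_empty
    (fun z _ => ⟨_, (hd1 z).hasFDerivAt, h1 z⟩) (fun z _ => ⟨_, (hd2 z).hasFDerivAt, h2 z⟩)
  exact ⟨v, hv, hR, he⟩

/-- The space of rapidly decaying solutions of the walk equation. -/
def modes (h : ℤ × ℤ → ℂ) (r : ℕ) (α κ : ℂ) : Submodule ℂ (ℤ × ℤ → ℂ) where
  carrier := {v | ModeEq h r α κ v ∧ Rapid v}
  add_mem' := by
    rintro v w ⟨⟨h1, h2⟩, h3⟩ ⟨⟨h4, h5⟩, h6⟩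
    refine ⟨⟨fun n hn => by simp [h1 n hn, h4 n hn], fun n hn => ?_⟩, h3.add h6⟩
    simp only [Pi.add_apply, mul_add, Finset.sum_add_distrib]
    linear_combination h2 n hn + h5 n hn
  zero_mem' := ⟨⟨fun n _ => rfl, fun n _ => by simp⟩, fun l => ⟨0, fun n => by simp⟩⟩
  smul_mem' := by
    rintro c v ⟨⟨h1, h2⟩, h3⟩
    refine ⟨⟨fun n hn => by simp [h1 n hn], fun n hn => ?_⟩, h3.const_mul c⟩
    simp only [Pi.smul_apply, smul_eq_mul, mul_left_comm _ c, ← Finset.mul_sum]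
    linear_combination c * h2 n hn

theorem ModeEq.exists_cutoff (h : ℤ × ℤ → ℂ) (r : ℕ) (α κ : ℂ) :
    ∃ R : ℕ, ∀ v, ModeEq h r α κ v → Rapid v → (∀ n ∈ box R, v n = 0) → v = 0 := by
  set A : ℝ := ‖α‖ * ∑ j ∈ box r, ‖h j‖
  have hA : 0 ≤ A := by positivity
  refine ⟨⌈2 * (‖κ‖ + 2 * A + 1)⌉₊, fun v hv hR h0 => ?_⟩
  obtain ⟨B, hB⟩ := hR.bounded
  have key : ∀ m : ℕ, ∀ n, ‖v n‖ ≤ B / 2 ^ m := by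
    intro m
    induction m with
    | zero => simpa using hB
    | succ m ih =>
      intro n
      have hBm := (norm_nonneg _).trans (ih 0)
      have hBm' : 0 ≤ B / 2 ^ (m + 1) := by rw [pow_succ, ← div_div]; positivity
      by_cases hn : n ∈ Lset
      swap
      · rwa [hv.1 n hn, norm_zero]
      by_cases hb : n ∈ box ⌈2 * (‖κ‖ + 2 * A + 1)⌉₊
      · rwa [h0 n hb, norm_zero]
      rw [mem_box, not_le] at hb
      have h1 : 2 * (‖κ‖ + 2 * A + 1) < ‖n‖ := lt_of_le_of_lt (Nat.le_ceil _) hb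
      have h2 := norm_le_two_mul_norm_emb n
      have h3 := norm_sub_le (emb n + κ) κ
      rw [add_sub_cancel_right] at h3
      have h4 : 2 * A + 1 ≤ ‖emb n + κ‖ := by linarith
      have h5 : ‖emb n + κ‖ * ‖v n‖ ≤ A * (B / 2 ^ m) := by
        rw [← norm_mul, eq_neg_of_add_eq_zero_left (hv.2 n hn), norm_neg, norm_mul, mul_assoc,
          Finset.sum_mul]
        gcongr
        refine norm_sum_le_of_le _ fun j _ => ?_
        rw [norm_mul]
        gcongr
        exact ih _
      have h6 : (2 * A + 1) * ‖v n‖ ≤ A * (B / 2 ^ m) :=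
        (mul_le_mul_of_nonneg_right h4 (norm_nonneg _)).trans h5
      rw [pow_succ, ← div_div]
      by_contra! h7
      nlinarith
  funext n
  have ht : Tendsto (fun m : ℕ => B / 2 ^ m) atTop (𝓝 0) :=
    tendsto_const_nhds.div_atTop (tendsto_pow_atTop_atTop_of_one_lt one_lt_two)
  exact norm_le_zero_iff.1 (ge_of_tendsto' ht fun m => key m n)

instance finite_modes : Module.Finite ℂ (modes h r α κ) := by
  obtain ⟨R, hR⟩ := ModeEq.exists_cutoff h r α κ
  let f : modes h r α κ →ₗ[ℂ] (box R → ℂ) :=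
    { toFun := fun v n => v.1 n
      map_add' := fun _ _ => rfl
      map_smul' := fun _ _ => rfl }
  refine Module.Finite.of_injective f ((injective_iff_map_eq_zero f).2 fun v hv => ?_)
  exact Subtype.ext (hR v.1 v.2.1 v.2.2 fun n hn => congrFun hv ⟨n, hn⟩)

/-- Fourier synthesis as a linear map. -/
noncomputable def synthL (h : ℤ × ℤ → ℂ) (r : ℕ) (α κ : ℂ) : modes h r α κ →ₗ[ℂ] (ℂ → ℂ × ℂ) where
  toFun v := synth v.1
  map_add' v w := by
    have key : ∀ ε z, fser (part (v.1 + w.1) ε) z = fser (part v.1 ε) z + fser (part w.1 ε) z := by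
      intro ε z
      rw [fser, fser, fser, ← ((v.2.2.part ε).summable_ee z).tsum_add ((w.2.2.part ε).summable_ee z)]
      refine tsum_congr fun n => ?_
      simp only [part, Pi.add_apply]
      split_ifs <;> ring
    funext z
    exact Prod.ext (key _ z) (key _ z)
  map_smul' c v := by
    have key : ∀ ε z, fser (part (c • v.1) ε) z = c * fser (part v.1 ε) z := by
      intro ε z
      rw [fser, fser, ← tsum_mul_left]
      refine tsum_congr fun n => ?_
      simp only [part, Pi.smul_apply, smul_eq_mul]
      split_ifs <;> ring
    funext z
    exact Prod.ext (key _ z) (key _ z)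

theorem kerSet_eq_range (hL : ∀ j ∉ Lset, h j = 0) :
    kerSet (pot h r 1) (pot h r (-1)) α (K * κ) = LinearMap.range (synthL h r α κ) := by
  ext u
  constructor
  · intro hu
    obtain ⟨v, hv, hR, rfl⟩ := InKer.exists_modeEq hL hu
    exact ⟨⟨v, hv, hR⟩, rfl⟩
  · rintro ⟨v, rfl⟩
    exact v.2.1.inKer hL v.2.2

/-- Zero modes vanishing at arbitrary points force the kernel to be at least two dimensional. -/
theorem two_le_kerDim (hL : ∀ j ∉ Lset, h j = 0) {k : ℂ}
    (hz : ∀ ζ : ℂ, ∃ u ∈ kerSet (pot h r 1) (pot h r (-1)) α k, u ≠ 0 ∧ u ζ = 0) :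
    2 ≤ kerDim (pot h r 1) (pot h r (-1)) α k := by
  obtain ⟨κ, rfl⟩ : ∃ κ, k = K * κ := ⟨k / K, by field_simp [K_ne_zero]⟩
  rw [kerDim, kerSet_eq_range hL, Submodule.span_eq]
  rw [kerSet_eq_range hL] at hz
  by_contra! hlt
  obtain ⟨u, hu, hu0, -⟩ := hz 0
  obtain ⟨ζ, hζ⟩ := Function.ne_iff.1 hu0
  obtain ⟨w, hw, hw0, hwζ⟩ := hz ζ
  have hdim : Module.finrank ℂ (LinearMap.range (synthL h r α κ)) ≤ 1 := by omega
  obtain ⟨c, hc⟩ := finrank_le_one_iff.1 hdim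
  obtain ⟨a, ha⟩ := hc ⟨u, hu⟩
  obtain ⟨b, hb⟩ := hc ⟨w, hw⟩
  have ha' : a • c.1 = u := congrArg Subtype.val ha
  have hb' : b • c.1 = w := congrArg Subtype.val hb
  have hb0 : b ≠ 0 := fun h0 => hw0 (by rw [← hb', h0, zero_smul])
  have hcζ : c.1 ζ = 0 := by
    have := hwζ
    rw [← hb', Pi.smul_apply] at this
    exact (smul_eq_zero.1 this).resolve_left hb0
  exact hζ (by rw [← ha', Pi.smul_apply, hcζ, smul_zero]; rfl)

theorem emb_ne_zero {n : ℤ × ℤ} (hn : n ∈ Lset) : emb n ≠ 0 := by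
  rw [← emb_zero, emb_injective.ne_iff]
  rintro rfl
  exact hn (by simp)

theorem modeEq_iff_walkOp {v : ℤ × ℤ → ℂ} :
    ModeEq h r α 0 v ↔ (-α) • walkOp h r v = v := by
  have key : (∀ n ∉ Lset, v n = 0) → ∀ n ∈ Lset,
      emb n * walkOp h r v n = ∑ j ∈ box r, h j * v (n - j) := by
    intro hv n hn
    rw [walkOp_apply, Finset.mul_sum]
    refine Finset.sum_congr rfl fun j _ => ?_
    by_cases hj : n - j ∈ Lset
    · have := emb_ne_zero hn
      rw [walkMat, if_pos ⟨hn, hj⟩, sub_sub_cancel, add_zero]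
      field_simp
    · rw [hv _ hj, mul_zero, mul_zero, mul_zero]
  constructor
  · rintro ⟨h1, h2⟩
    funext n
    rw [Pi.smul_apply, smul_eq_mul]
    by_cases hn : n ∈ Lset
    · refine mul_left_cancel₀ (emb_ne_zero hn) ?_
      linear_combination -h2 n hn - α * key h1 n hn
    · rw [walkOp_supported v hn, h1 n hn, mul_zero]
  · intro hv
    have h1 : ∀ n ∉ Lset, v n = 0 := fun n hn => by
      rw [← hv, Pi.smul_apply, walkOp_supported v hn, smul_zero]
    refine ⟨h1, fun n hn => ?_⟩
    have h2 := congrFun hv n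
    rw [Pi.smul_apply, smul_eq_mul] at h2
    linear_combination -emb n * h2 - α * key h1 n hn

theorem isEig_of_isMagic (hr : ∀ j, h j ≠ 0 → ‖j‖ ≤ r) (hL : ∀ j ∉ Lset, h j = 0)
    (hm : IsMagic (pot h r 1) (pot h r (-1)) α) : IsEig (fourMat h) (α ^ 4) := by
  obtain ⟨u, hu, hu0⟩ := hm (K * 0)
  rw [kerSet_eq_range hL] at hu
  obtain ⟨v, rfl⟩ := hu
  have := isEig_fourMat hr (w := v.1) (μ := -α) (fun h0 => hu0 ?_) v.2.2.bounded
    (modeEq_iff_walkOp.1 v.2.1)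
  · rwa [neg_pow, show (-1 : ℂ) ^ 4 = 1 by norm_num, one_mul] at this
  · rw [show v = 0 from Subtype.ext h0, map_zero]

end

section

open Filter Topology Complex

/-- The elliptic nome of the lattice. -/
noncomputable def nome : ℂ := exp (2 * Real.pi * I * ω)

theorem norm_nome_lt_one : ‖nome‖ < 1 := by
  rw [nome, norm_exp, Real.exp_lt_one_iff, omega_eq]
  have : (2 * (Real.pi : ℂ) * I * (-1 / 2 + ((Real.sqrt 3 / 2 : ℝ) : ℂ) * I)).re = -(Real.pi * Real.sqrt 3) := by
    simp [Complex.add_re, Complex.mul_re, Complex.add_im, Complex.mul_im]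
    ring
  rw [this]
  have : 0 < Real.pi * Real.sqrt 3 := by positivity
  linarith

/-- The product `∏ (1 - q ^ n w)` for the nome `q`. -/
noncomputable def eulerProd (w : ℂ) : ℂ := ∏' n : ℕ, (1 + -(nome ^ n * w))

theorem summable_eulerProd (w : ℂ) : Summable fun n : ℕ => ‖-(nome ^ n * w)‖ := by
  simp only [norm_neg, norm_mul, norm_pow]
  exact (summable_geometric_of_lt_one (norm_nonneg _) norm_nome_lt_one).mul_right _

theorem eulerProd_eq (w : ℂ) : eulerProd w = (1 - w) * eulerProd (nome * w) := by
  have h : Multipliable fun n : ℕ => 1 + -(nome ^ (n + 1) * w) :=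
    multipliable_one_add_of_summable ((summable_nat_add_iff 1).2 (summable_eulerProd w))
  have h1 := tprod_eq_zero_mul' (f := fun n : ℕ => 1 + -(nome ^ n * w)) h
  simp only [pow_succ, mul_assoc, pow_zero, one_mul, ← sub_eq_add_neg] at h1
  simp only [eulerProd, ← sub_eq_add_neg, h1]

theorem eulerProd_one : eulerProd 1 = 0 := by rw [eulerProd_eq]; simp

theorem eulerProd_ne_zero {w : ℂ} (hw : ∀ n : ℕ, nome ^ n * w ≠ 1) : eulerProd w ≠ 0 :=
  tprod_one_add_ne_zero_of_summable
    (fun n h => hw n (by linear_combination -h)) (summable_eulerProd w)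

theorem differentiable_eulerProd : Differentiable ℂ eulerProd := by
  intro w
  have hu : Summable fun n : ℕ => ‖nome‖ ^ n * (‖w‖ + 1) :=
    (summable_geometric_of_lt_one (norm_nonneg _) norm_nome_lt_one).mul_right _
  have h := hu.hasProdLocallyUniformlyOn_nat_one_add (f := fun n z => -(nome ^ n * z))
    (K := Metric.ball (0 : ℂ) (‖w‖ + 1)) Metric.isOpen_ball (.of_forall fun n z hz => by
      rw [norm_neg, norm_mul, norm_pow]
      gcongr
      exact (mem_ball_zero_iff.1 hz).le) (fun n => by fun_prop)
  have h2 : DifferentiableOn ℂ eulerProd (Metric.ball (0 : ℂ) (‖w‖ + 1)) :=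
    h.differentiableOn (.of_forall fun _ => by
      simpa [Finset.prod_fn] using DifferentiableOn.finsetProd (fun _ _ => by fun_prop))
      Metric.isOpen_ball
  exact h2.differentiableAt (Metric.isOpen_ball.mem_nhds (by simp))

/-- A theta function vanishing exactly on the lattice. -/
noncomputable def thetaFn (z : ℂ) : ℂ :=
  eulerProd (exp (2 * Real.pi * I * z)) * eulerProd (nome * exp (-(2 * Real.pi * I * z)))

theorem differentiable_thetaFn : Differentiable ℂ thetaFn :=
  (differentiable_eulerProd.comp (by fun_prop)).mul (differentiable_eulerProd.comp (by fun_prop))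

theorem thetaFn_add_one (z : ℂ) : thetaFn (z + 1) = thetaFn z := by
  have h1 : exp (2 * Real.pi * I * (z + 1)) = exp (2 * Real.pi * I * z) := by
    rw [mul_add, mul_one, Complex.exp_add, Complex.exp_two_pi_mul_I, mul_one]
  rw [thetaFn, Complex.exp_neg, h1, thetaFn, Complex.exp_neg]

theorem thetaFn_add_omega (z : ℂ) : thetaFn (z + ω) = -exp (-(2 * Real.pi * I * z)) * thetaFn z := by
  have h1 : exp (2 * Real.pi * I * (z + ω)) = nome * exp (2 * Real.pi * I * z) := by
    rw [mul_add, Complex.exp_add, mul_comm]; rfl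
  have h0 : nome ≠ 0 := Complex.exp_ne_zero _
  have h2 := Complex.exp_ne_zero (2 * Real.pi * I * z)
  rw [thetaFn, Complex.exp_neg, h1, thetaFn, Complex.exp_neg]
  set w := exp (2 * Real.pi * I * z)
  rw [eulerProd_eq w, mul_inv, mul_inv_cancel_left₀ h0, eulerProd_eq w⁻¹]
  field_simp
  ring

/-- The period lattice is the additive subgroup generated by `1` and `ω`. -/
theorem mem_of_mem_lattice {S : AddSubgroup ℂ} (h1 : (1 : ℂ) ∈ S) (hω : ω ∈ S) {γ : ℂ} (hγ : γ ∈ Λ) :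
    γ ∈ S := by
  obtain ⟨m, n, rfl⟩ := hγ
  have := S.add_mem (S.zsmul_mem hω m) (S.zsmul_mem h1 n)
  simpa using this

theorem thetaFn_add_lattice {γ : ℂ} (hγ : γ ∈ Λ) :
    ∃ b c : ℂ, ∀ z, thetaFn (z + γ) = exp (c + b * z) * thetaFn z := by
  let S : AddSubgroup ℂ :=
    { carrier := {γ | ∃ b c : ℂ, ∀ z, thetaFn (z + γ) = exp (c + b * z) * thetaFn z}
      add_mem' := by
        rintro γ δ ⟨b, c, h⟩ ⟨b', c', h'⟩
        refine ⟨b + b', c + c' + b' * γ, fun z => ?_⟩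
        rw [← add_assoc, h', h, ← mul_assoc, ← Complex.exp_add]
        ring_nf
      zero_mem' := ⟨0, 0, fun z => by simp⟩
      neg_mem' := by
        rintro γ ⟨b, c, h⟩
        refine ⟨-b, -c + b * γ, fun z => ?_⟩
        have := h (z + -γ)
        rw [neg_add_cancel_right] at this
        rw [this, ← mul_assoc, ← Complex.exp_add]
        ring_nf
        simp }
  refine mem_of_mem_lattice (S := S) ⟨0, 0, fun z => by simp [thetaFn_add_one]⟩
    ⟨-(2 * Real.pi * I), Real.pi * I, fun z => ?_⟩ hγ
  rw [thetaFn_add_omega, Complex.exp_add, Complex.exp_pi_mul_I]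
  ring_nf

theorem thetaFn_zero : thetaFn 0 = 0 := by simp [thetaFn, eulerProd_one]

theorem hasDerivAt_thetaFn_zero : HasDerivAt thetaFn (-(2 * Real.pi * I) * eulerProd nome ^ 2) 0 := by
  have h1 : thetaFn = fun z => (1 - exp (2 * Real.pi * I * z)) *
      (eulerProd (nome * exp (2 * Real.pi * I * z)) *
        eulerProd (nome * exp (-(2 * Real.pi * I * z)))) := by
    funext z; rw [thetaFn, eulerProd_eq, mul_assoc]
  have h2 : Differentiable ℂ fun z => eulerProd (nome * exp (2 * Real.pi * I * z)) *
      eulerProd (nome * exp (-(2 * Real.pi * I * z))) :=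
    (differentiable_eulerProd.comp (by fun_prop)).mul (differentiable_eulerProd.comp (by fun_prop))
  have h3 : HasDerivAt (fun z : ℂ => 1 - exp (2 * Real.pi * I * z)) (-(2 * Real.pi * I)) 0 := by
    have h := (((hasDerivAt_id (0 : ℂ)).const_mul (2 * Real.pi * I)).cexp).const_sub 1
    simpa using h
  rw [h1]
  refine (h3.mul (h2 0).hasDerivAt).congr_deriv ?_
  simp only [mul_zero, neg_zero, Complex.exp_zero, mul_one, sub_self, zero_mul, add_zero]
  ring

theorem eulerProd_nome_ne_zero : eulerProd nome ≠ 0 := by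
  refine eulerProd_ne_zero fun n h => ?_
  have h1 := congrArg norm h
  rw [← pow_succ, norm_pow, norm_one] at h1
  exact (pow_lt_one₀ (norm_nonneg _) norm_nome_lt_one (by simp)).ne h1

/-- The zeros of `thetaFn` at lattice points are simple. -/
theorem thetaFn_lattice {γ : ℂ} (hγ : γ ∈ Λ) : thetaFn γ = 0 ∧ deriv thetaFn γ ≠ 0 := by
  obtain ⟨b, c, h⟩ := thetaFn_add_lattice hγ
  refine ⟨by simpa [thetaFn_zero] using h 0, ?_⟩
  have h1 : thetaFn = fun z => exp (c + b * (z - γ)) * thetaFn (z - γ) := by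
    funext z; rw [← h, sub_add_cancel]
  have h2 : HasDerivAt (fun z => thetaFn (z - γ)) (-(2 * Real.pi * I) * eulerProd nome ^ 2) γ := by
    apply HasDerivAt.comp_sub_const
    rw [sub_self]; exact hasDerivAt_thetaFn_zero
  have h3 : Differentiable ℂ fun z => exp (c + b * (z - γ)) := by fun_prop
  have h4 := (h3 γ).hasDerivAt.mul h2
  rw [show (fun z => exp (c + b * (z - γ))) * (fun z => thetaFn (z - γ)) = thetaFn from h1.symm] at h4
  rw [h4.deriv, sub_self, thetaFn_zero]
  simp [eulerProd_nome_ne_zero, Real.pi_ne_zero]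

theorem mem_lattice_of_thetaFn_eq_zero {z : ℂ} (hz : thetaFn z = 0) : z ∈ Λ := by
  have key : ∀ (n : ℕ) (x : ℂ), nome ^ n * exp (2 * Real.pi * I * x) = 1 → x ∈ Λ := by
    intro n x h
    rw [nome, ← Complex.exp_nat_mul, ← Complex.exp_add, Complex.exp_eq_one_iff] at h
    obtain ⟨m, hm⟩ := h
    refine ⟨-n, m, ?_⟩
    have h2 : (2 * Real.pi * I : ℂ) ≠ 0 := Complex.two_pi_I_ne_zero
    refine mul_left_cancel₀ h2 ?_
    push_cast
    linear_combination hm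
  rcases mul_eq_zero.1 hz with h | h
  · by_contra hc
    exact eulerProd_ne_zero (fun n hn => hc (key n z hn)) h
  · by_contra hc
    refine eulerProd_ne_zero (fun n hn => hc ?_) h
    have := key (n + 1) (-z) (by rw [mul_neg, pow_succ, mul_assoc]; exact hn)
    obtain ⟨m, l, hml⟩ := this
    exact ⟨-m, -l, by push_cast; linear_combination -hml⟩

theorem countable_lattice : Λ.Countable := by
  refine (Set.countable_range fun p : ℤ × ℤ => (p.1 : ℂ) * ω + p.2).mono ?_
  rintro _ ⟨m, n, rfl⟩
  exact ⟨(m, n), rfl⟩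

end

section

open Filter Topology Complex

variable {h : ℤ × ℤ → ℂ} {r : ℕ} {α κ : ℂ}

/-- Removing simple zeros from a quotient. -/
theorem continuous_removeZeros {f Y : ℂ → ℂ} (hf : Continuous f) (hY : Differentiable ℂ Y)
    (h : ∀ z, Y z = 0 → f z = 0 ∧ DifferentiableAt ℂ f z ∧ deriv Y z ≠ 0) :
    Continuous fun z => if Y z = 0 then deriv f z / deriv Y z else f z / Y z := by
  rw [continuous_iff_continuousAt]
  intro z₀
  by_cases hz : Y z₀ = 0
  · obtain ⟨h0, hd, hne⟩ := h z₀ hz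
    rw [continuousAt_iff_punctured_nhds]
    simp only [if_pos hz]
    refine (hd.hasDerivAt.tendsto_slope.div (hY z₀).hasDerivAt.tendsto_slope hne).congr' ?_
    filter_upwards [self_mem_nhdsWithin, (hY z₀).hasDerivAt.eventually_ne (c := 0) hne] with z hz1 hz2
    have hz3 : z - z₀ ≠ 0 := sub_ne_zero.2 hz1
    rw [if_neg hz2, Pi.div_apply, slope_def_field, slope_def_field, h0, hz, sub_zero, sub_zero]
    field_simp
  · have h1 : ∀ᶠ z in 𝓝 z₀, f z / Y z = if Y z = 0 then deriv f z / deriv Y z else f z / Y z := by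
      filter_upwards [hY.continuous.continuousAt.eventually_ne hz] with z hz'
      rw [if_neg hz']
    exact (hf.continuousAt.div hY.continuous.continuousAt hz).congr h1

theorem differentiableAt_of_dbarL {f : ℂ → ℂ} {L : ℂ →L[ℝ] ℂ} {z : ℂ} (hf : HasFDerivAt f L z)
    (hL : dbarL L = 0) : DifferentiableAt ℂ f z := by
  rw [dbarL_apply] at hL
  have h1 : L 1 + I * L I = 0 := by
    have := (mul_eq_zero.1 hL).resolve_left (by simp)
    exact this
  have h2 : L I = I * L 1 := by linear_combination -I * h1 + L I * I_mul_I
  refine (HasDerivAt.differentiableAt (f' := L 1) ?_)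
  rw [hasDerivAt_iff_hasFDerivAt]
  refine hasFDerivAt_of_restrictScalars ℝ hf ?_
  refine ContinuousLinearMap.ext fun x => ?_
  have hx : x = x.re • (1 : ℂ) + x.im • I := by simp
  rw [hx, map_add, map_add, map_smul, map_smul, map_smul, map_smul, h2]
  simp

theorem dbarL_restrictScalars {f : ℂ → ℂ} {z : ℂ} (hf : DifferentiableAt ℂ f z) :
    ∃ L : ℂ →L[ℝ] ℂ, HasFDerivAt f L z ∧ dbarL L = 0 := by
  refine ⟨_, hf.hasDerivAt.hasFDerivAt.restrictScalars ℝ, ?_⟩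
  rw [dbarL_apply]
  simp
  linear_combination deriv f z * I_mul_I

/-- The zeros forced by rotation invariance. -/
noncomputable def stack : ℂ := I / Real.sqrt 3

theorem omega_mul_stack : ω * stack = stack + (-1 + -ω) := by
  have h3 : (Real.sqrt 3 : ℂ) ≠ 0 := by simp
  have h4 : (Real.sqrt 3 : ℂ) ^ 2 = 3 := by
    rw [← ofReal_pow, Real.sq_sqrt (by norm_num)]; simp
  rw [omega_eq, stack]
  push_cast
  field_simp
  linear_combination h4 * I + (Real.sqrt 3 : ℂ) * I_sq

theorem two_stack_notMem : 2 * stack ∉ Λ := by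
  rintro ⟨m, n, h⟩
  have h1 := congrArg Complex.im h
  rw [omega_eq, stack] at h1
  have h3 : Real.sqrt 3 ^ 2 = 3 := Real.sq_sqrt (by norm_num)
  have h0 : Real.sqrt 3 ≠ 0 := by simp
  have h2 : 2 / Real.sqrt 3 = m * (Real.sqrt 3 / 2) := by
    simp at h1
    exact h1
  field_simp at h2
  rw [h3] at h2
  have : (4 : ℤ) = 3 * m := by exact_mod_cast (by linarith : (4 : ℝ) = 3 * m)
  omega

theorem QP.neg_mul_lattice {f : ℂ → ℂ} {ε : ℤ} (hε : ε = 1 ∨ ε = -1) (hf : QP ε f)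
    (hrot : ∀ z, f (ω * z) = f z) {z : ℂ} (hz : z = stack ∨ z = -stack) : f z = 0 := by
  have hγ : (-1 + -ω : ℂ) ∈ Λ := ⟨-1, -1, by push_cast; ring⟩
  have hγ' : (1 + ω : ℂ) ∈ Λ := ⟨1, 1, by push_cast; ring⟩
  have hne : ∀ ε : ℤ, ε = 1 ∨ ε = -1 → ee (ε, 0) (1 + ω) ≠ 1 := by
    intro ε hε h1
    have h2 := freq_cell (ε, 0) 1 1
    rw [ofReal_one, one_mul] at h2
    rw [ee, h2, exp_eq_one_iff] at h1
    obtain ⟨n, hn⟩ := h1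
    have h3 : (2 * Real.pi * I : ℂ) * ε = (2 * Real.pi * I) * (3 * n) := by
      push_cast at hn
      linear_combination 3 * hn
    have h4 := mul_left_cancel₀ two_pi_I_ne_zero h3
    have h5 : ε = 3 * n := by exact_mod_cast h4
    omega
  rcases hz with rfl | rfl
  · have h1 := hf _ hγ stack
    rw [← omega_mul_stack, hrot, show (-1 + -ω : ℂ) = -(1 + ω) by ring, ee_neg_arg] at h1
    have h2 := hne (-ε) (by omega)
    rw [show (-(ε, (0 : ℤ)) : ℤ × ℤ) = (-ε, 0) by simp] at h1
    by_contra h0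
    exact h2 (mul_right_cancel₀ h0 (by rw [one_mul]; exact h1.symm))
  · have h1 := hf _ hγ' (-stack)
    rw [show -stack + (1 + ω) = ω * -stack by rw [mul_neg, omega_mul_stack]; ring, hrot] at h1
    by_contra h0
    exact hne ε hε (mul_right_cancel₀ h0 (by rw [one_mul]; exact h1.symm))

theorem QP.eq_zero_of_stack {f : ℂ → ℂ} {ε : ℤ} (hε : ε = 1 ∨ ε = -1) (hf : QP ε f)
    (hrot : ∀ z, f (ω * z) = f z) {z : ℂ} (hz : z - stack ∈ Λ ∨ z + stack ∈ Λ) : f z = 0 := by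
  rcases hz with hz | hz
  · have := hf _ hz stack
    rwa [add_sub_cancel, hf.neg_mul_lattice hε hrot (Or.inl rfl), mul_zero] at this
  · have := hf _ hz (-stack)
    rwa [add_comm z, neg_add_cancel_left, hf.neg_mul_lattice hε hrot (Or.inr rfl), mul_zero] at this

/-- A theta quotient denominator with simple zeros at the points congruent to `stack`, `-stack`. -/
noncomputable def stackFn (z : ℂ) : ℂ := thetaFn (z - stack) * thetaFn (z + stack)

theorem differentiable_stackFn : Differentiable ℂ stackFn :=
  (differentiable_thetaFn.comp (by fun_prop)).mul (differentiable_thetaFn.comp (by fun_prop))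

theorem stackFn_eq_zero {z : ℂ} (hz : stackFn z = 0) : z - stack ∈ Λ ∨ z + stack ∈ Λ :=
  (mul_eq_zero.1 hz).imp mem_lattice_of_thetaFn_eq_zero mem_lattice_of_thetaFn_eq_zero

theorem deriv_stackFn_ne_zero {z : ℂ} (hz : stackFn z = 0) : deriv stackFn z ≠ 0 := by
  have hd := (differentiable_thetaFn (z - stack)).hasDerivAt.comp_sub_const z stack |>.mul
    ((differentiable_thetaFn (z + stack)).hasDerivAt.comp_add_const z stack)
  have hd' : deriv stackFn z = deriv thetaFn (z - stack) * thetaFn (z + stack) +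
      thetaFn (z - stack) * deriv thetaFn (z + stack) := hd.deriv
  have hsub : ∀ {x y : ℂ}, x ∈ Λ → y ∈ Λ → x - y ∈ Λ := by
    rintro _ _ ⟨m, n, rfl⟩ ⟨m', n', rfl⟩
    exact ⟨m - m', n - n', by push_cast; ring⟩
  have hne : ¬ (z - stack ∈ Λ ∧ z + stack ∈ Λ) := fun h => two_stack_notMem (by
    have := hsub h.2 h.1
    rwa [show z + stack - (z - stack) = 2 * stack by ring] at this)
  rw [hd']
  rcases stackFn_eq_zero hz with h1 | h1
  · rw [(thetaFn_lattice h1).1, zero_mul, add_zero]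
    exact mul_ne_zero (thetaFn_lattice h1).2
      fun h2 => hne ⟨h1, mem_lattice_of_thetaFn_eq_zero h2⟩
  · rw [(thetaFn_lattice h1).1, mul_zero, zero_add]
    exact mul_ne_zero (fun h2 => hne ⟨mem_lattice_of_thetaFn_eq_zero h2, h1⟩)
      (thetaFn_lattice h1).2

theorem countable_translate (c : ℂ) : {z : ℂ | z - c ∈ Λ}.Countable := by
  exact (countable_lattice.image (· + c)).mono fun z hz =>
    (Set.mem_image _ _ _).2 ⟨z - c, hz, sub_add_cancel z c⟩

theorem countable_stackFn_zeros : {z | stackFn z = 0}.Countable := by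
  refine ((countable_translate stack).union (countable_translate (-stack))).mono fun z hz => ?_
  rcases stackFn_eq_zero hz with h | h
  · exact Or.inl h
  · exact Or.inr (by simpa [sub_neg_eq_add] using h)

/-- The numerator of the theta quotient shifting the quasimomentum by `k`, with a zero at `a`. -/
noncomputable def shiftFn (k a z : ℂ) : ℂ :=
  exp (I * k * (z - (starRingEnd ℂ) z) / 2) *
    (thetaFn (z - a) * thetaFn (z - (-(k / (4 * Real.pi)) * (I * Real.sqrt 3) - a)))

theorem shiftFn_add_one (k a z : ℂ) : shiftFn k a (z + 1) = shiftFn k a z := by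
  have h : z + 1 - (starRingEnd ℂ) (z + 1) = z - (starRingEnd ℂ) z := by
    rw [map_add, map_one, add_sub_add_right_eq_sub]
  rw [shiftFn, h, add_sub_right_comm z 1 a, add_sub_right_comm z 1 (_ - a), thetaFn_add_one,
    thetaFn_add_one, shiftFn]

theorem stackFn_add_one (z : ℂ) : stackFn (z + 1) = stackFn z := by
  rw [stackFn, add_sub_right_comm, thetaFn_add_one, add_right_comm, thetaFn_add_one, stackFn]

theorem stackFn_add_omega (z : ℂ) : stackFn (z + ω) = exp (-(4 * Real.pi * I * z)) * stackFn z := by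
  have h : exp (-(4 * Real.pi * I * z)) = exp (-(2 * Real.pi * I * (z - stack))) *
      exp (-(2 * Real.pi * I * (z + stack))) := by rw [← Complex.exp_add]; ring_nf
  rw [stackFn, add_sub_right_comm, thetaFn_add_omega, add_right_comm, thetaFn_add_omega, stackFn, h]
  ring

theorem shiftFn_add_omega (k a z : ℂ) :
    shiftFn k a (z + ω) = exp (-(4 * Real.pi * I * z)) * shiftFn k a z := by
  set s : ℂ := -(k / (4 * Real.pi)) * (I * Real.sqrt 3) - a with hs
  have hω : ω - (starRingEnd ℂ) ω = I * Real.sqrt 3 := by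
    rw [sub_conj, omega_eq]
    simp
    ring
  have h : exp (-(4 * Real.pi * I * z)) * exp (I * k * (z - (starRingEnd ℂ) z) / 2) =
      exp (I * k * (z + ω - (starRingEnd ℂ) (z + ω)) / 2) *
        (exp (-(2 * Real.pi * I * (z - a))) * exp (-(2 * Real.pi * I * (z - s)))) := by
    rw [← Complex.exp_add, ← Complex.exp_add, ← Complex.exp_add, map_add,
      show z + ω - ((starRingEnd ℂ) z + (starRingEnd ℂ) ω) =
        z - (starRingEnd ℂ) z + (ω - (starRingEnd ℂ) ω) by ring, hω, hs]
    congr 1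
    have : (Real.pi : ℂ) ≠ 0 := by simp [Real.pi_ne_zero]
    field_simp
    ring
  rw [shiftFn, ← hs, add_sub_right_comm z ω a, thetaFn_add_omega, add_sub_right_comm z ω s,
    thetaFn_add_omega, shiftFn, ← hs]
  linear_combination -(thetaFn (z - a) * thetaFn (z - s)) * h

theorem shiftFn_div_stackFn_add {γ : ℂ} (hγ : γ ∈ Λ) (k a z : ℂ) :
    shiftFn k a (z + γ) / stackFn (z + γ) = shiftFn k a z / stackFn z := by
  let S : AddSubgroup ℂ :=
    { carrier := {γ | ∀ z, shiftFn k a (z + γ) / stackFn (z + γ) = shiftFn k a z / stackFn z}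
      add_mem' := fun {γ δ} hγ hδ z => by rw [← add_assoc, hδ, hγ]
      zero_mem' := fun z => by rw [add_zero]
      neg_mem' := fun {γ} hγ z => by rw [← hγ (z + -γ), neg_add_cancel_right] }
  refine mem_of_mem_lattice (S := S) (fun z => ?_) (fun z => ?_) hγ z
  · rw [shiftFn_add_one, stackFn_add_one]
  · rw [shiftFn_add_omega, stackFn_add_omega, mul_div_mul_left _ _ (Complex.exp_ne_zero _)]

theorem hasFDerivAt_shiftFn (k a z : ℂ) :
    ∃ L : ℂ →L[ℝ] ℂ, HasFDerivAt (shiftFn k a) L z ∧ dbarL L = -k * shiftFn k a z := by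
  set s : ℂ := -(k / (4 * Real.pi)) * (I * Real.sqrt 3) - a with hs
  have h1 : Differentiable ℂ fun z => thetaFn (z - a) * thetaFn (z - s) :=
    (differentiable_thetaFn.comp (by fun_prop)).mul (differentiable_thetaFn.comp (by fun_prop))
  obtain ⟨L, hL, hL0⟩ := dbarL_restrictScalars (h1 z)
  have h2 : HasFDerivAt (fun z => z - (starRingEnd ℂ) z)
      (ContinuousLinearMap.id ℝ ℂ - (conjCLE : ℂ →L[ℝ] ℂ)) z :=
    (hasFDerivAt_id z).sub conjCLE.hasFDerivAt
  have h3 := (((h2.const_mul (I * k)).mul_const (2⁻¹ : ℂ)).cexp).mul hL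
  simp only [← div_eq_mul_inv] at h3
  refine ⟨_, h3, ?_⟩
  have h4 : dbarL (ContinuousLinearMap.id ℝ ℂ - (conjCLE : ℂ →L[ℝ] ℂ)) = 2 * I := by
    rw [dbarL_apply]
    simp
    linear_combination -(2 * I) * I_mul_I
  rw [map_add, dbarL_smul, dbarL_smul, hL0, dbarL_smul, dbarL_smul, dbarL_smul, h4, shiftFn, ← hs]
  linear_combination (k * cexp (I * k * (z - (starRingEnd ℂ) z) / 2) *
    (thetaFn (z - a) * thetaFn (z - s))) * I_mul_I

theorem continuous_shiftFn (k a : ℂ) : Continuous (shiftFn k a) :=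
  continuous_iff_continuousAt.2 fun z =>
    let ⟨_, h, _⟩ := hasFDerivAt_shiftFn k a z
    h.continuousAt

/-- The quotient of `f` by `stackFn`, twisted to shift the quasimomentum by `k`. -/
noncomputable def twist (k a : ℂ) (f : ℂ → ℂ) (z : ℂ) : ℂ :=
  shiftFn k a z * if stackFn z = 0 then deriv f z / deriv stackFn z else f z / stackFn z

section Twist

variable {k a : ℂ} {f : ℂ → ℂ}

theorem twist_of_ne {z : ℂ} (hz : stackFn z ≠ 0) :
    twist k a f z = shiftFn k a z / stackFn z * f z := by
  rw [twist, if_neg hz]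
  ring

theorem twist_self (k a : ℂ) (f : ℂ → ℂ) : twist k a f a = 0 := by
  rw [twist, shiftFn, sub_self, thetaFn_zero, zero_mul, mul_zero, zero_mul]

theorem continuous_twist (hf : Differentiable ℝ f) (h0 : ∀ z, stackFn z = 0 → f z = 0)
    (hD : ∀ z, stackFn z = 0 → dbarL (fderiv ℝ f z) = 0) : Continuous (twist k a f) :=
  (continuous_shiftFn k a).mul (continuous_removeZeros hf.continuous differentiable_stackFn
    fun z hz => ⟨h0 z hz, differentiableAt_of_dbarL (hf z).hasFDerivAt (hD z hz),
      deriv_stackFn_ne_zero hz⟩)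

theorem qp_twist {ε : ℤ} (hf : QP ε f) (hc : Continuous (twist k a f)) : QP ε (twist k a f) := by
  intro γ hγ
  refine congrFun (Continuous.ext_on (f := fun z => twist k a f (z + γ))
    ((countable_stackFn_zeros.union
      (countable_stackFn_zeros.preimage (add_left_injective γ))).dense_compl ℝ)
    (by fun_prop) (by fun_prop) fun z hz => ?_)
  have h1 : stackFn z ≠ 0 := fun h => hz (Or.inl h)
  have h2 : stackFn (z + γ) ≠ 0 := fun h => hz (Or.inr h)
  simp only [twist_of_ne h1, twist_of_ne h2, shiftFn_div_stackFn_add hγ, hf γ hγ z]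
  ring

theorem hasFDerivAt_twist (hf : Differentiable ℝ f) {z : ℂ} (hz : stackFn z ≠ 0) :
    ∃ L : ℂ →L[ℝ] ℂ, HasFDerivAt (twist k a f) L z ∧
      dbarL L = -k * twist k a f z + shiftFn k a z / stackFn z * dbarL (fderiv ℝ f z) := by
  obtain ⟨L₁, h1, h1'⟩ := hasFDerivAt_shiftFn k a z
  obtain ⟨L₂, h2, h2'⟩ := dbarL_restrictScalars ((differentiable_stackFn z).inv hz)
  refine ⟨_, ((h1.mul h2).mul (hf z).hasFDerivAt).congr_of_eventuallyEq ?_, ?_⟩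
  · filter_upwards [differentiable_stackFn.continuous.continuousAt.eventually_ne hz] with y hy
    rw [twist_of_ne hy, Pi.mul_apply, Pi.mul_apply, div_eq_mul_inv]
    rfl
  · rw [map_add, dbarL_smul, dbarL_smul, map_add, dbarL_smul, dbarL_smul, h1', h2', twist_of_ne hz,
      Pi.mul_apply, div_eq_mul_inv]
    simp only [Pi.inv_apply]
    ring

theorem countable_shiftFn_zeros (k a : ℂ) : {z | shiftFn k a z = 0}.Countable := by
  refine ((countable_translate a).union (countable_translate
    (-(k / (4 * Real.pi)) * (I * Real.sqrt 3) - a))).mono fun z hz => ?_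
  exact (mul_eq_zero.1 ((mul_eq_zero.1 hz).resolve_left (Complex.exp_ne_zero _))).imp
    mem_lattice_of_thetaFn_eq_zero mem_lattice_of_thetaFn_eq_zero

end Twist

/-- Zero modes with prescribed zeros, built by theta quotients from a rotation invariant mode. -/
theorem exists_zero_at (hL : ∀ j ∉ Lset, h j = 0) {u : ℂ → ℂ × ℂ}
    (hu : InKer (pot h r 1) (pot h r (-1)) α 0 u) (hrot : ∀ z, u (ω * z) = u z) (hne : u ≠ 0)
    (k ζ : ℂ) : ∃ w ∈ kerSet (pot h r 1) (pot h r (-1)) α k, w ≠ 0 ∧ w ζ = 0 := by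
  obtain ⟨κ, rfl⟩ : ∃ κ, k = K * κ := ⟨k / K, by field_simp [K_ne_zero]⟩
  obtain ⟨hs, h1, h2, h3, h4⟩ := hu
  have hd1 : Differentiable ℝ fun z => (u z).1 := hs.fst.differentiable (by simp)
  have hd2 : Differentiable ℝ fun z => (u z).2 := hs.snd.differentiable (by simp)
  have hq1 : QP (-1) fun z => (u z).1 := fun γ hγ z => by rw [ee_neg_one]; exact h3 γ hγ z
  have hq2 : QP 1 fun z => (u z).2 := fun γ hγ z => by rw [ee_one]; exact h4 γ hγ z
  have hz1 : ∀ z, stackFn z = 0 → (u z).1 = 0 := fun z hz =>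
    hq1.eq_zero_of_stack (Or.inr rfl) (fun z => by rw [hrot]) (stackFn_eq_zero hz)
  have hz2 : ∀ z, stackFn z = 0 → (u z).2 = 0 := fun z hz =>
    hq2.eq_zero_of_stack (Or.inl rfl) (fun z => by rw [hrot]) (stackFn_eq_zero hz)
  have he1 : ∀ z, dbarL (fderiv ℝ (fun z => (u z).1) z) = -(α * pot h r 1 z * (u z).2) := fun z => by
    have := h1 z
    rw [Dbar_eq (hd1 z).hasFDerivAt] at this
    linear_combination this
  have he2 : ∀ z, dbarL (fderiv ℝ (fun z => (u z).2) z) = -(α * pot h r (-1) z * (u z).1) := fun z => by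
    have := h2 z
    rw [Dbar_eq (hd2 z).hasFDerivAt] at this
    linear_combination this
  have hc1 : Continuous (twist (K * κ) ζ fun z => (u z).1) :=
    continuous_twist hd1 hz1 fun z hz => by rw [he1, hz2 z hz, mul_zero, neg_zero]
  have hc2 : Continuous (twist (K * κ) ζ fun z => (u z).2) :=
    continuous_twist hd2 hz2 fun z hz => by rw [he2, hz1 z hz, mul_zero, neg_zero]
  obtain ⟨v, hv, hR, hw⟩ := exists_modeEq (h := h) (r := r) (α := α) (κ := κ) hL hc1 hc2
    (qp_twist hq1 hc1) (qp_twist hq2 hc2) countable_stackFn_zeros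
    (fun z hz => by
      obtain ⟨L, hL, hL'⟩ := hasFDerivAt_twist (k := K * κ) (a := ζ) hd1 hz
      refine ⟨L, hL, ?_⟩
      rw [hL', he1, twist_of_ne hz, twist_of_ne hz]
      ring)
    (fun z hz => by
      obtain ⟨L, hL, hL'⟩ := hasFDerivAt_twist (k := K * κ) (a := ζ) hd2 hz
      refine ⟨L, hL, ?_⟩
      rw [hL', he2, twist_of_ne hz, twist_of_ne hz]
      ring)
  have hker := hv.inKer hL hR
  rw [← hw] at hker
  refine ⟨_, hker, fun h0 => hne ?_, ?_⟩
  · refine Continuous.ext_on ((countable_stackFn_zeros.union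
      (countable_shiftFn_zeros (K * κ) ζ)).dense_compl ℝ) hs.continuous continuous_const fun z hz => ?_
    have hz1 : stackFn z ≠ 0 := fun h => hz (Or.inl h)
    have hz2 : shiftFn (K * κ) ζ z ≠ 0 := fun h => hz (Or.inr h)
    have h5 := congrFun h0 z
    simp only [twist_of_ne hz1, Pi.zero_apply, Prod.mk_eq_zero, mul_eq_zero,
      div_ne_zero hz2 hz1, false_or] at h5
    exact Prod.ext h5.1 h5.2
  · simp only [twist_self]
    rfl

end

section

open Filter Topology Complex

variable {h : ℤ × ℤ → ℂ} {r : ℕ} {α : ℂ}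

/-- Eigenvalues of the invariant sector give non-simple magic parameters. -/
theorem exists_nonsimple_of_isEig (hr : ∀ j, h j ≠ 0 → ‖j‖ ≤ r) (hL : ∀ j ∉ Lset, h j = 0)
    (hrot : ∀ j, h (rot j) = ω * h j) {x : ℂ} (hx : IsEig (secMat h) x) :
    ∃ α, α ^ 4 = x ∧ IsMagic (pot h r 1) (pot h r (-1)) α ∧
      ∀ k, 2 ≤ kerDim (pot h r 1) (pot h r (-1)) α k := by
  obtain ⟨μ, hμ, w, hw0, hwL, hwrot, hw, hR⟩ := exists_invariant_vector hr hrot hx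
  have hv : ModeEq h r (-μ) 0 w := modeEq_iff_walkOp.2 (by rw [neg_neg, hw])
  have hu := hv.inKer hL hR
  rw [mul_zero] at hu
  have hne : synth w ≠ 0 := fun h0 => hw0 <| synth_injective hR
    (fun l => ⟨0, fun n => by simp⟩) hwL (fun n _ => rfl) (by
      rw [h0]
      funext z
      simp [synth, fser, part]
      rfl)
  have hz := exists_zero_at hL hu (synth_rot hwrot) hne
  exact ⟨-μ, by rw [neg_pow, hμ]; norm_num,
    fun k => let ⟨u, hu, hu0, _⟩ := hz k 0; ⟨u, hu, hu0⟩, fun k => two_le_kerDim hL (hz k)⟩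

/-- Infinitely many non-simple magic parameters, given one magic parameter, unless the Fredholm
coefficients of the invariant sector eventually vanish without all traces vanishing. -/
theorem infinite_nonsimple (hr : ∀ j, h j ≠ 0 → ‖j‖ ≤ r) (hL : ∀ j ∉ Lset, h j = 0)
    (hrot : ∀ j, h (rot j) = ω * h j)
    (hh : (∃ n, ∀ k, n < k → newtonSeq (trPow (secMat h)) k = 0) →
      ∀ l, trPow (fourMat h) (l + 1) = 0)
    (hm : IsMagic (pot h r 1) (pot h r (-1)) α) :
    {α | IsMagic (pot h r 1) (pot h r (-1)) α ∧
      ∀ k, 2 ≤ kerDim (pot h r 1) (pot h r (-1)) α k}.Infinite := by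
  intro hfin
  refine not_isEig_of_trPow_eq_zero (absSummable_fourMat hr) (hh ?_) _ (isEig_of_isMagic hr hL hm)
  refine newtonSeq_trPow_eventually_eq_zero (absSummable_secMat hr) ?_
  refine (hfin.image (· ^ 4)).subset fun x hx => ?_
  obtain ⟨α, hα, h1⟩ := exists_nonsimple_of_isEig hr hL hrot hx
  exact ⟨α, h1, hα⟩

end

section

open Filter Topology Complex

variable {N : ℕ}

/-- The frequency label of the plane wave with index `(4πi/√3)(q₁ + q₂ω)`. -/
def dualIdx (q : ℤ × ℤ) : ℤ × ℤ := (1 + q.1 - 2 * q.2, 2 * q.1 - q.2)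

theorem dualIdx_injective : Function.Injective dualIdx := by
  rintro ⟨a, b⟩ ⟨c, d⟩ h
  simp only [dualIdx, Prod.mk.injEq] at h ⊢
  omega

theorem K_mul_emb_dualIdx (q : ℤ × ℤ) :
    K * emb (dualIdx q) - K = 4 * Real.pi * I / Real.sqrt 3 * ((q.1 : ℂ) + (q.2 : ℂ) * ω) := by
  have h3 : (Real.sqrt 3 : ℂ) ≠ 0 := sqrt_three_ne_zero
  have h4 : I * Real.sqrt 3 = 1 + 2 * ω := by
    rw [omega_eq]
    push_cast
    ring
  have h5 : 4 * Real.pi * I / Real.sqrt 3 = K * (1 + 2 * ω) := by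
    rw [← h4, K, div_eq_iff h3]
    linear_combination (-(4 * Real.pi * I / 3)) * sqrt_three_sq
  rw [h5, emb, dualIdx]
  push_cast
  linear_combination (-2 * K * q.2) * omega_sq

theorem cls_dualIdx (q : ℤ × ℤ) : cls (dualIdx q) = 1 := by
  have h : (3 : ZMod 3) = 0 := rfl
  simp only [cls, dualIdx]
  push_cast
  linear_combination (q.1 - q.2 : ZMod 3) * h

theorem mem_IN {p : ℂ} : p ∈ IN N ↔ ∃ q : ℤ × ℤ, ‖q‖ ≤ N ∧ p = K * emb (dualIdx q) - K := by
  rw [IN, Finset.mem_image]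
  refine exists_congr fun q => ?_
  rw [K_mul_emb_dualIdx, ← mem_box, box, Finset.mem_product, Finset.mem_Icc, Finset.mem_Icc,
    Finset.mem_Icc, Prod.le_def, Prod.le_def, eq_comm (a := p)]
  tauto

theorem cls_cases (j : ℤ × ℤ) : cls j = 0 ∨ cls j = 1 ∨ cls j = -1 := by
  generalize cls j = c
  revert c
  decide

/-- Coefficients extended by zero. -/
noncomputable def extCoeff (a : ↥(IN N) → ℂ) (p : ℂ) : ℂ :=
  if hp : p ∈ IN N then a ⟨p, hp⟩ else 0

/-- The even hopping function of a potential. -/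
noncomputable def hop (a : ↥(IN N) → ℂ) (j : ℤ × ℤ) : ℂ :=
  if cls j = 1 then extCoeff a (K * emb j - K) / K
  else if cls j = -1 then extCoeff a (K * emb (-j) - K) / K
  else 0

theorem hop_neg (a : ↥(IN N) → ℂ) (j : ℤ × ℤ) : hop a (-j) = hop a j := by
  rw [hop, hop, cls_neg, neg_neg]
  rcases cls_cases j with h | h | h <;> rw [h]
  · rw [if_neg (by decide), if_neg (by decide), if_neg (by decide), if_neg (by decide)]
  · rw [if_neg (by decide), if_pos rfl, if_pos rfl]
  · rw [if_pos (neg_neg 1), if_neg (by decide), if_pos rfl]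

theorem hop_eq_zero (a : ↥(IN N) → ℂ) {j : ℤ × ℤ} (hj : j ∉ Lset) : hop a j = 0 := by
  rw [hop, cls_eq_zero_iff.2 hj, if_neg (by decide), if_neg (by decide)]

theorem exists_of_hop_ne_zero {a : ↥(IN N) → ℂ} {j : ℤ × ℤ} (hj : hop a j ≠ 0) (h1 : cls j = 1) :
    ∃ q, ‖q‖ ≤ N ∧ j = dualIdx q := by
  rw [hop, if_pos h1, extCoeff] at hj
  have hp : K * emb j - K ∈ IN N := by
    by_contra h
    simp [h] at hj
  obtain ⟨q, hq, h⟩ := mem_IN.1 hp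
  exact ⟨q, hq, emb_injective (mul_left_cancel₀ K_ne_zero (sub_left_injective h))⟩

theorem norm_dualIdx_le {q : ℤ × ℤ} (hq : ‖q‖ ≤ N) : ‖dualIdx q‖ ≤ (3 * N + 1 : ℕ) := by
  rw [← mem_box, box, Finset.mem_Icc, Prod.le_def, Prod.le_def] at hq ⊢
  simp only [dualIdx] at hq ⊢
  push_cast
  omega

theorem exists_of_hop_ne_zero' {a : ↥(IN N) → ℂ} {j : ℤ × ℤ} (hj : hop a j ≠ 0) :
    ∃ q, ‖q‖ ≤ N ∧ (j = dualIdx q ∨ j = -dualIdx q) := by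
  rcases cls_cases j with h | h | h
  · exact absurd (hop_eq_zero a (cls_eq_zero_iff.1 h)) hj
  · obtain ⟨q, hq, rfl⟩ := exists_of_hop_ne_zero hj h
    exact ⟨q, hq, Or.inl rfl⟩
  · rw [← hop_neg] at hj
    obtain ⟨q, hq, h⟩ := exists_of_hop_ne_zero hj (by rw [cls_neg, h, neg_neg])
    exact ⟨q, hq, Or.inr (by rw [← h, neg_neg])⟩

theorem norm_le_of_hop_ne_zero {a : ↥(IN N) → ℂ} {j : ℤ × ℤ} (hj : hop a j ≠ 0) :
    ‖j‖ ≤ (3 * N + 1 : ℕ) := by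
  obtain ⟨q, hq, rfl | rfl⟩ := exists_of_hop_ne_zero' hj
  · exact norm_dualIdx_le hq
  · rw [norm_neg]
    exact norm_dualIdx_le hq

theorem Ua_eq_pot (a : ↥(IN N) → ℂ) (z : ℂ) : Ua N a z = pot (hop a) (3 * N + 1) 1 z := by
  have hinj : Function.Injective fun j => K * emb j - K := fun i j h =>
    emb_injective (mul_left_cancel₀ K_ne_zero (sub_left_injective h))
  have hIN : IN N = (box N).image fun q => K * emb (dualIdx q) - K := by
    ext p
    simp only [mem_IN, Finset.mem_image, mem_box, eq_comm (a := p)]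
  have h1 : Ua N a z = ∑ p ∈ IN N, extCoeff a p * exp (I * (pair (p + K) z : ℂ)) := by
    rw [Ua, ← Finset.sum_coe_sort (IN N) fun p => extCoeff a p * exp (I * (pair (p + K) z : ℂ))]
    exact Finset.sum_congr rfl fun p _ => by rw [extCoeff, dif_pos p.2]
  rw [h1, hIN, Finset.sum_image fun x _ y _ h => dualIdx_injective (hinj h), pot,
    ← Finset.sum_subset (s₁ := (box N).image dualIdx) (s₂ := box (3 * N + 1)), Finset.sum_image fun x _ y _ h =>
      dualIdx_injective h]
  · refine Finset.sum_congr rfl fun q _ => ?_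
    rw [sub_add_cancel, part, if_pos (cls_dualIdx q), hop, if_pos (cls_dualIdx q),
      mul_div_cancel₀ _ K_ne_zero, ee, freq_apply]
  · intro j hj
    obtain ⟨q, hq, rfl⟩ := Finset.mem_image.1 hj
    exact mem_box.2 (norm_dualIdx_le (mem_box.1 hq))
  · intro j _ hj
    rw [part]
    split_ifs with h
    · by_cases h0 : hop a j = 0
      · rw [h0, mul_zero, zero_mul]
      · obtain ⟨q, hq, rfl⟩ := exists_of_hop_ne_zero h0 h
        exact absurd (Finset.mem_image_of_mem _ (mem_box.2 hq)) hj
    · rw [mul_zero, zero_mul]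

theorem pot_neg {h : ℤ × ℤ → ℂ} (heven : ∀ j, h (-j) = h j) (r : ℕ) (ε : ZMod 3) (z : ℂ) :
    pot h r ε (-z) = pot h r (-ε) z := by
  rw [pot, pot]
  refine Finset.sum_nbij' (fun j => -j) (fun j => -j) ?_ ?_ (by simp) (by simp) ?_
  · intro j hj
    rwa [mem_box, norm_neg, ← mem_box]
  · intro j hj
    rwa [mem_box, norm_neg, ← mem_box]
  · intro j _
    simp only [ee_neg_arg, part, heven, cls_neg, neg_inj]

theorem Ua_neg_eq_pot (a : ↥(IN N) → ℂ) :
    (fun z => Ua N a (-z)) = pot (hop a) (3 * N + 1) (-1) := by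
  funext z
  rw [Ua_eq_pot, pot_neg (hop_neg a)]

section Rotation

variable {h : ℤ × ℤ → ℂ} {r : ℕ}

theorem finite_support_part (hr : ∀ j, h j ≠ 0 → ‖j‖ ≤ r) (ε : ZMod 3) :
    (Function.support (part h ε)).Finite :=
  (box r).finite_toSet.subset fun j hj => mem_box.2 (hr j fun h0 => hj (by simp [part, h0]))

theorem pot_eq_fser (hr : ∀ j, h j ≠ 0 → ‖j‖ ≤ r) (ε : ZMod 3) (z : ℂ) :
    pot h r ε z = K * fser (part h ε) z := by
  rw [pot, fser, tsum_eq_sum (s := box r), Finset.mul_sum]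
  · exact Finset.sum_congr rfl fun j _ => mul_assoc _ _ _
  · intro j hj
    have : h j = 0 := by
      by_contra h0
      exact hj (mem_box.2 (hr j h0))
    simp [part, this]

theorem fser_omega_mul (c : ℤ × ℤ → ℂ) (z : ℂ) :
    fser c (ω * z) = fser (fun n => c (rot n)) z := by
  rw [fser, ← rot.toEquiv.tsum_eq]
  exact tsum_congr fun n => by
    change c (rot n) * ee (rot n) (ω * z) = _
    rw [ee_rot]

theorem pot_omega_mul_iff (hr : ∀ j, h j ≠ 0 → ‖j‖ ≤ r) (ε : ZMod 3) :
    (∀ z, pot h r ε (ω * z) = ω * pot h r ε z) ↔ ∀ j, cls j = ε → h (rot j) = ω * h j := by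
  have hs := finite_support_part hr ε
  have hs' : (Function.support fun n => part h ε (rot n)).Finite :=
    hs.preimage rot.injective.injOn
  have hpart : ∀ j, cls j ≠ ε → part h ε j = 0 := fun j hj => if_neg hj
  constructor
  · intro hz j hj
    have h1 : fser (fun n => part h ε (rot n)) = fser fun n => ω * part h ε n := by
      funext z
      have h2 := hz z
      rw [pot_eq_fser hr, pot_eq_fser hr, fser_omega_mul] at h2
      refine mul_left_cancel₀ K_ne_zero (h2.trans ?_)
      rw [fser, fser, mul_left_comm, ← tsum_mul_left]
      simp only [mul_assoc]
    have h3 := coef_fser (c := fun n => part h ε (rot n)) (ε := ε) (m := j)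
      (summable_of_hasFiniteSupport (hs'.subset fun n hn => by simpa using hn))
      (fun n hn => by
        by_contra h0
        exact hn (hpart _ (by rwa [cls_rot]))) hj
    have h4 := coef_fser (c := fun n => ω * part h ε n) (ε := ε) (m := j)
      (summable_of_hasFiniteSupport (hs.subset fun n hn => fun h0 => hn (by simp [h0])))
      (fun n hn => by
        by_contra h0
        exact hn (by rw [hpart _ h0, mul_zero])) hj
    rw [h1, h4, part, part, if_pos hj, if_pos (by rwa [cls_rot])] at h3
    exact h3.symm
  · intro hj z
    rw [pot_eq_fser hr, pot_eq_fser hr, fser_omega_mul, mul_left_comm]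
    refine congrArg (K * ·) ?_
    rw [fser, fser, ← tsum_mul_left]
    refine tsum_congr fun n => ?_
    rw [part, part, cls_rot]
    split_ifs with hn
    · rw [hj n hn, mul_assoc]
    · simp

end Rotation

theorem mem_WN_iff {a : ↥(IN N) → ℂ} : a ∈ WN N ↔ ∀ j, hop a (rot j) = ω * hop a j := by
  have h1 : a ∈ WN N ↔ ∀ z, pot (hop a) (3 * N + 1) 1 (ω * z) = ω * pot (hop a) (3 * N + 1) 1 z := by
    simp only [← Ua_eq_pot]
    rfl
  rw [h1, pot_omega_mul_iff fun j => norm_le_of_hop_ne_zero]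
  refine ⟨fun h j => ?_, fun h j _ => h j⟩
  rcases cls_cases j with hj | hj | hj
  · rw [hop_eq_zero a (cls_eq_zero_iff.1 hj),
      hop_eq_zero a (cls_eq_zero_iff.1 (by rwa [cls_rot])), mul_zero]
  · exact h j hj
  · rw [← hop_neg, ← map_neg, h _ (by rw [cls_neg, hj, neg_neg]), hop_neg]

end

section

open Filter Topology Complex

variable {N : ℕ}

theorem continuous_hop (j : ℤ × ℤ) : Continuous fun a : ↥(IN N) → ℂ => hop a j := by
  have h : ∀ p, Continuous fun a : ↥(IN N) → ℂ => extCoeff a p := fun p => by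
    unfold extCoeff
    split_ifs
    · exact continuous_apply _
    · exact continuous_const
  unfold hop
  split_ifs
  · exact (h _).div_const _
  · exact (h _).div_const _
  · exact continuous_const

theorem goodN_of (a : ↥(WN N))
    (hh : (∃ n, ∀ k, n < k → newtonSeq (trPow (secMat (hop a.1))) k = 0) →
      ∀ l, trPow (fourMat (hop a.1)) (l + 1) = 0) : GoodN N a := by
  rintro ⟨α, hα⟩
  have h1 : Ua N a.1 = pot (hop a.1) (3 * N + 1) 1 := funext (Ua_eq_pot a.1)
  rw [Ua_neg_eq_pot, h1] at hα ⊢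
  exact infinite_nonsimple (fun _ => norm_le_of_hop_ne_zero) (fun j => hop_eq_zero a.1)
    (mem_WN_iff.1 a.2) hh hα

theorem trPow_fourMat_hop_eq_zero {a : ↥(WN N)} (ha : ∀ j, hop a.1 j ∈ fieldQ)
    (hn : ∃ n, ∀ k, n < k → newtonSeq (trPow (secMat (hop a.1))) k = 0) (l : ℕ) :
    trPow (fourMat (hop a.1)) (l + 1) = 0 :=
  let ⟨_, hn⟩ := hn
  trPow_fourMat_eq_zero (fun _ => norm_le_of_hop_ne_zero) (mem_WN_iff.1 a.2) ha hn l

theorem hop_mem_fieldQ {a : ↥(IN N) → ℂ} (ha : ∀ p, InPiQomega (a p)) (j : ℤ × ℤ) :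
    hop a j ∈ fieldQ := by
  have h : ∀ p, extCoeff a p / K ∈ fieldQ := fun p => by
    unfold extCoeff
    split_ifs with hp
    · obtain ⟨q, hq, h⟩ := ha ⟨p, hp⟩
      have hπ : (Real.pi : ℂ) ≠ 0 := by simp [Real.pi_ne_zero]
      have h1 : a ⟨p, hp⟩ / K = ((3 / 4 : ℚ) : ℂ) * q := by
        rw [h, K]
        push_cast
        field_simp
      rw [h1]
      exact mul_mem (SubfieldClass.ratCast_mem _ _) hq
    · rw [zero_div]
      exact zero_mem _
  unfold hop
  split_ifs
  · exact h _
  · exact h _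
  · exact zero_mem _

/-- Approximation by field elements, compatible with the rotation. -/
theorem exists_equivariant_approx {ε : ℝ} (hε : 0 < ε) :
    ∃ φ : ℂ → ℂ, φ 0 = 0 ∧ (∀ x, φ (ω * x) = ω * φ x) ∧ (∀ x, φ x ∈ fieldQ) ∧
      ∀ x, ‖φ x - x‖ < ε := by
  have h1 : ∀ x : ℂ, ∃ q ∈ fieldQ, ‖q - x‖ < ε ∧ (x = 0 → q = 0) := fun x => by
    by_cases hx : x = 0
    · exact ⟨0, zero_mem _, by simpa [hx] using hε, fun _ => rfl⟩
    obtain ⟨s, hs⟩ := exists_rat_near x.re (half_pos hε)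
    obtain ⟨t, ht⟩ := exists_rat_near x.im (half_pos hε)
    refine ⟨s + t * I, add_mem (SubfieldClass.ratCast_mem _ _)
      (mul_mem (SubfieldClass.ratCast_mem _ _) I_mem), ?_, fun h => absurd h hx⟩
    refine (Complex.norm_le_abs_re_add_abs_im _).trans_lt ?_
    have hre : ((s : ℂ) + t * I - x).re = s - x.re := by simp
    have him : ((s : ℂ) + t * I - x).im = t - x.im := by simp
    rw [hre, him, abs_sub_comm, abs_sub_comm (t : ℝ)]
    linarith
  choose q hqF hq hq0 using h1
  have hω : ‖ω‖ = 1 := by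
    have : ‖ω‖ ^ 3 = 1 := by rw [← norm_pow, omega_cube, norm_one]
    exact (pow_eq_one_iff_of_nonneg (norm_nonneg _) (by norm_num)).1 this
  refine ⟨fun x => ((1 / 3 : ℚ) : ℂ) * (q x + ω ^ 2 * q (ω * x) + ω * q (ω ^ 2 * x)), ?_, fun x => ?_,
    fun x => ?_, fun x => ?_⟩
  · simp [hq0]
  · have h3 : ω ^ 2 * (ω * x) = x := by linear_combination x * omega_cube
    beta_reduce
    rw [h3, show ω * (ω * x) = ω ^ 2 * x by ring]
    linear_combination (-((1 / 3 : ℚ) : ℂ) * q (ω * x)) * omega_cube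
  · exact mul_mem (SubfieldClass.ratCast_mem _ _) (add_mem (add_mem (hqF _)
      (mul_mem (pow_mem omega_mem _) (hqF _))) (mul_mem omega_mem (hqF _)))
  · have h3 : ((1 / 3 : ℚ) : ℂ) * (q x + ω ^ 2 * q (ω * x) + ω * q (ω ^ 2 * x)) - x =
        (1 / 3 : ℝ) * ((q x - x) + ω ^ 2 * (q (ω * x) - ω * x) + ω * (q (ω ^ 2 * x) - ω ^ 2 * x)) := by
      push_cast
      linear_combination (2 * x / 3) * omega_cube
    rw [h3, norm_mul, norm_real, Real.norm_of_nonneg (by norm_num)]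
    have h4 := norm_add₃_le (a := q x - x) (b := ω ^ 2 * (q (ω * x) - ω * x))
      (c := ω * (q (ω ^ 2 * x) - ω ^ 2 * x))
    rw [norm_mul, norm_mul, norm_pow, hω, one_pow, one_mul, one_mul] at h4
    linarith [hq x, hq (ω * x), hq (ω ^ 2 * x)]

theorem hop_map {φ : ℂ → ℂ} (h0 : φ 0 = 0) (a : ↥(IN N) → ℂ) (j : ℤ × ℤ) :
    hop (fun p => K * φ (a p / K)) j = φ (hop a j) := by
  have h : ∀ p, extCoeff (fun p => K * φ (a p / K)) p / K = φ (extCoeff a p / K) := fun p => by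
    unfold extCoeff
    split_ifs
    · rw [mul_div_cancel_left₀ _ K_ne_zero]
    · rw [zero_div, h0]
  unfold hop
  split_ifs
  · exact h _
  · exact h _
  · exact h0.symm

theorem dense_hop_mem_fieldQ : Dense {a : ↥(WN N) | ∀ j, hop a.1 j ∈ fieldQ} := by
  rw [Metric.dense_iff]
  intro a ε hε
  have hK : 0 < ‖K‖ := norm_pos_iff.2 K_ne_zero
  obtain ⟨φ, h0, hrot, hF, hφ⟩ := exists_equivariant_approx (div_pos hε hK)
  refine ⟨⟨fun p => K * φ (a.1 p / K), mem_WN_iff.2 fun j => ?_⟩, ?_, fun j => ?_⟩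
  · rw [hop_map h0, hop_map h0, mem_WN_iff.1 a.2, hrot]
  · rw [Metric.mem_ball, Subtype.dist_eq, dist_pi_lt_iff hε]
    intro p
    have h1 : K * φ (a.1 p / K) - a.1 p = K * (φ (a.1 p / K) - a.1 p / K) := by
      field_simp [K_ne_zero]
    rw [dist_eq_norm, h1, norm_mul, mul_comm, ← lt_div_iff₀ hK]
    exact hφ _
  · rw [hop_map h0]
    exact hF _

theorem isClosed_newtonSeq_eq_zero (n : ℕ) :
    IsClosed {a : ↥(WN N) | ∀ k, n < k → newtonSeq (trPow (secMat (hop a.1))) k = 0} := by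
  refine IsSeqClosed.isClosed fun a b ha hb k hk => ?_
  refine tendsto_nhds_unique (tendsto_newtonSeq_secMat (fun _ => norm_le_of_hop_ne_zero)
    (fun _ _ => norm_le_of_hop_ne_zero)
    (fun j => ((continuous_hop j).comp continuous_subtype_val).continuousAt.tendsto.comp hb) k) ?_
  exact tendsto_const_nhds.congr fun i => (ha i k hk).symm

theorem isClosed_trPow_eq_zero :
    IsClosed {a : ↥(WN N) | ∀ l, trPow (fourMat (hop a.1)) (l + 1) = 0} := by
  refine IsSeqClosed.isClosed fun a b ha hb l => ?_
  refine tendsto_nhds_unique (tendsto_trPow_fourMat (fun _ => norm_le_of_hop_ne_zero)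
    (fun _ _ => norm_le_of_hop_ne_zero)
    (fun j => ((continuous_hop j).comp continuous_subtype_val).continuousAt.tendsto.comp hb) l) ?_
  exact tendsto_const_nhds.congr fun i => (ha i l).symm

end

/-- **races to infinity, genericity in the coefficient space.**
The set of coefficients in `W_N` for which the good property holds contains a countable
intersection of open dense subsets of `W_N`, and contains all coefficient tuples with
entries in `π·ℚ(ω/√3)`. -/
theorem races_to_infinity_generic (N : ℕ) :
    (∃ Vs : ℕ → Set ↥(WN N), (∀ n, IsOpen (Vs n) ∧ Dense (Vs n)) ∧
      ∀ a ∈ ⋂ n, Vs n, GoodN N a) ∧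
    ∀ a : ↥(WN N), (∀ p : ↥(IN N), InPiQomega (a.1 p)) → GoodN N a := by
  refine ⟨?_, fun a ha => goodN_of a (trPow_fourMat_hop_eq_zero (hop_mem_fieldQ ha))⟩
  set B : ℕ → Set ↥(WN N) := fun n =>
    {a | ∀ k, n < k → newtonSeq (trPow (secMat (hop a.1))) k = 0} with hB
  have hBc : ∀ n, IsClosed (B n) := isClosed_newtonSeq_eq_zero
  refine ⟨fun n => (frontier (B n))ᶜ, fun n => ⟨isClosed_frontier.isOpen_compl, ?_⟩, fun a ha => ?_⟩
  · exact interior_eq_empty_iff_dense_compl.1 (interior_frontier (hBc n))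
  · refine goodN_of a fun ⟨n, hn⟩ => ?_
    have h1 : a ∈ interior (B n) := by
      have h2 := Set.mem_iInter.1 ha n
      rw [(hBc n).frontier_eq] at h2
      by_contra h3
      exact h2 ⟨hn, h3⟩
    refine closure_minimal ?_ isClosed_trPow_eq_zero
      (dense_hop_mem_fieldQ.open_subset_closure_inter isOpen_interior h1)
    rintro b ⟨hb1, hb2⟩
    exact trPow_fourMat_hop_eq_zero hb2 ⟨n, interior_subset hb1⟩

end TBG
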